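/- Let k be a field and F a bad field generator of A = k[X,Y] (i.e., k(F,G) = k(X,Y) for some G ∈ k(X,Y) but not for any G ∈ k[X,Y]). Then |Γ_alg(F,A)| ≤ 2, where Γ_alg(F,A) is the set of prime ideals p with k[F] → A/p an isomorphism. -/

import Mathlib

open MvPolynomial

/-- The set `Γ_alg(F,A)` of primes `p` of `A = k[X,Y]` such that the composite
`k[F] ↪ A → A/p` is an isomorphism. -/
def GammaAlg (k : Type) [Field k] (F : MvPolynomial (Fin 2) k) :
    Set (Ideal (MvPolynomial (Fin 2) k)) :=
  {p | p.IsPrime ∧ Function.Bijective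
    (fun q : Polynomial k => Ideal.Quotient.mk p (Polynomial.aeval F q))}

namespace FieldGen

open scoped Polynomial

set_option linter.unusedSectionVars false

theorem valuation_aeval_le_one {K L : Type*} [Field K] [Field L] [Algebra K L]
    (V : ValuationSubring L) (hK : ∀ c : K, algebraMap K L c ∈ V) {y : L} (hy : y ∈ V)
    (a : K[X]) : Polynomial.aeval y a ∈ V := by
  rw [Polynomial.aeval_eq_sum_range]
  refine sum_mem fun i _ => ?_
  rw [Algebra.smul_def]
  exact mul_mem (hK _) (pow_mem hy _)

theorem valuation_algebraMap_eq_one {K L : Type*} [Field K] [Field L] [Algebra K L]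
    (V : ValuationSubring L) (hK : ∀ c : K, algebraMap K L c ∈ V) {c : K} (hc : c ≠ 0) :
    V.valuation (algebraMap K L c) = 1 := by
  refine le_antisymm ((V.valuation_le_one_iff _).2 (hK c)) ?_
  have h1 := (V.valuation_le_one_iff _).2 (hK c⁻¹)
  rw [map_inv₀, map_inv₀] at h1
  have h0 : V.valuation (algebraMap K L c) ≠ 0 := by simpa using hc
  exact (inv_le_one₀ (zero_lt_iff.2 h0)).1 h1

theorem valuation_lt_one_mem {L : Type*} [Field L] (V : ValuationSubring L) {y : L}
    (hy : V.valuation y < 1) : y ∈ V := (V.valuation_le_one_iff _).1 hy.le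

theorem aeval_eq_add_mul {K L : Type*} [Field K] [Field L] [Algebra K L] (y : L) (a : K[X]) :
    Polynomial.aeval y a = y * Polynomial.aeval y a.divX + algebraMap K L (a.coeff 0) := by
  have h := congrArg (Polynomial.aeval y) (Polynomial.divX_mul_X_add a)
  rw [← h]
  simp only [map_add, map_mul, Polynomial.aeval_X, Polynomial.aeval_C]
  ring

theorem valuation_aeval_eq_one {K L : Type*} [Field K] [Field L] [Algebra K L]
    (V : ValuationSubring L) (hK : ∀ c : K, algebraMap K L c ∈ V) {y : L}
    (hy : V.valuation y < 1) {a : K[X]} (ha : a.coeff 0 ≠ 0) : V.valuation (Polynomial.aeval y a) = 1 := by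
  rw [aeval_eq_add_mul, ← valuation_algebraMap_eq_one V hK ha]
  apply Valuation.map_add_eq_of_lt_right
  rw [valuation_algebraMap_eq_one V hK ha, map_mul]
  exact mul_lt_one_of_lt_of_le hy ((V.valuation_le_one_iff _).2
    (valuation_aeval_le_one V hK (valuation_lt_one_mem V hy) _))

theorem valuation_aeval_lt_one {K L : Type*} [Field K] [Field L] [Algebra K L]
    (V : ValuationSubring L) (hK : ∀ c : K, algebraMap K L c ∈ V) {y : L}
    (hy : V.valuation y < 1) {a : K[X]} (ha : a.coeff 0 = 0) : V.valuation (Polynomial.aeval y a) < 1 := by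
  rw [aeval_eq_add_mul, ha, map_zero, add_zero, map_mul]
  exact mul_lt_one_of_lt_of_le hy ((V.valuation_le_one_iff _).2
    (valuation_aeval_le_one V hK (valuation_lt_one_mem V hy) _))

theorem exists_coprime_of_mem_adjoin {K L : Type*} [Field K] [Field L] [Algebra K L] {y l : L}
    (hl : l ∈ IntermediateField.adjoin K {y}) :
    ∃ a b : K[X], IsCoprime a b ∧ Polynomial.aeval y b ≠ 0 ∧
      l * Polynomial.aeval y b = Polynomial.aeval y a := by
  obtain ⟨a, b, rfl⟩ := (IntermediateField.mem_adjoin_simple_iff K l).1 hl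
  by_cases hb : Polynomial.aeval y b = 0
  · exact ⟨0, 1, isCoprime_one_right, by simp, by simp [hb]⟩
  have hb0 : b ≠ 0 := by rintro rfl; simp at hb
  obtain ⟨a', b', c, hc, rfl, rfl⟩ := UniqueFactorizationMonoid.exists_reduced_factors' a b hb0
  rw [map_mul] at hb
  have hc0 := left_ne_zero_of_mul hb
  have hb0 := right_ne_zero_of_mul hb
  refine ⟨a', b', hc.isCoprime, hb0, ?_⟩
  rw [map_mul, map_mul]
  field_simp

theorem exists_coprime_of_adjoin_eq_top {K L : Type*} [Field K] [Field L] [Algebra K L] {y : L}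
    (hy : IntermediateField.adjoin K {y} = ⊤) (l : L) :
    ∃ a b : K[X], IsCoprime a b ∧ Polynomial.aeval y b ≠ 0 ∧
      l * Polynomial.aeval y b = Polynomial.aeval y a :=
  exists_coprime_of_mem_adjoin (by rw [hy]; trivial)

/-- A polynomial fraction which is regular at a place centred at `y = 0` has a denominator which
does not vanish there. -/
theorem exists_fraction_of_mem_adjoin {K L : Type*} [Field K] [Field L] [Algebra K L]
    (V : ValuationSubring L) (hK : ∀ c : K, algebraMap K L c ∈ V) {y : L}
    (hy : V.valuation y < 1) {l : L} (hly : l ∈ IntermediateField.adjoin K {y}) (hl : l ∈ V) :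
    ∃ a b : K[X], b.coeff 0 ≠ 0 ∧ Polynomial.aeval y b ≠ 0 ∧
      l * Polynomial.aeval y b = Polynomial.aeval y a := by
  obtain ⟨a, b, hc, hb, h⟩ := exists_coprime_of_mem_adjoin hly
  refine ⟨a, b, fun h0 => ?_, hb, h⟩
  have hb1 := valuation_aeval_lt_one V hK hy h0
  have ha0 : a.coeff 0 ≠ 0 := by
    intro ha0
    have := hc.isUnit_of_dvd' (Polynomial.X_dvd_iff.2 ha0) (Polynomial.X_dvd_iff.2 h0)
    exact Polynomial.not_isUnit_X this
  have := valuation_aeval_eq_one V hK hy ha0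
  rw [← h, map_mul] at this
  rw [mul_comm] at this
  exact absurd this (mul_lt_one_of_lt_of_le hb1 ((V.valuation_le_one_iff _).2 hl)).ne

theorem exists_fraction_of_mem {K L : Type*} [Field K] [Field L] [Algebra K L]
    (V : ValuationSubring L) (hK : ∀ c : K, algebraMap K L c ∈ V) {y : L}
    (hy : V.valuation y < 1) (htop : IntermediateField.adjoin K {y} = ⊤) {l : L} (hl : l ∈ V) :
    ∃ a b : K[X], b.coeff 0 ≠ 0 ∧ Polynomial.aeval y b ≠ 0 ∧
      l * Polynomial.aeval y b = Polynomial.aeval y a :=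
  exists_fraction_of_mem_adjoin V hK hy (by rw [htop]; trivial) hl

theorem exists_sub_eq_mul_of_mem_adjoin {K L : Type*} [Field K] [Field L] [Algebra K L]
    (V : ValuationSubring L) (hK : ∀ c : K, algebraMap K L c ∈ V) {y : L}
    (hy : V.valuation y < 1) {l : L}
    (hly : l ∈ IntermediateField.adjoin K {y}) (hl : l ∈ V) :
    ∃ w : K, ∃ v ∈ V, l - algebraMap K L w = y * v := by
  obtain ⟨a, b, h0, hb, h⟩ := exists_fraction_of_mem_adjoin V hK hy hly hl
  have hb1 := valuation_aeval_eq_one V hK hy h0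
  have hb' : algebraMap K L (b.coeff 0) ≠ 0 := by simpa using h0
  refine ⟨a.coeff 0 / b.coeff 0, (Polynomial.aeval y a.divX - algebraMap K L
    (a.coeff 0 / b.coeff 0) * Polynomial.aeval y b.divX) * (Polynomial.aeval y b)⁻¹, ?_, ?_⟩
  · refine mul_mem (sub_mem (valuation_aeval_le_one V hK (valuation_lt_one_mem V hy) _)
      (mul_mem (hK _) (valuation_aeval_le_one V hK (valuation_lt_one_mem V hy) _))) ?_
    rw [← V.valuation_le_one_iff, map_inv₀, hb1, inv_one]
  · rw [← mul_assoc, eq_mul_inv_iff_mul_eq₀ hb, sub_mul, h, aeval_eq_add_mul y a]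
    nth_rw 1 [aeval_eq_add_mul y b]
    rw [map_div₀]
    field_simp
    ring

theorem exists_sub_eq_mul {K L : Type*} [Field K] [Field L] [Algebra K L]
    (V : ValuationSubring L) (hK : ∀ c : K, algebraMap K L c ∈ V) {y : L}
    (hy : V.valuation y < 1) (htop : IntermediateField.adjoin K {y} = ⊤) {l : L} (hl : l ∈ V) :
    ∃ w : K, ∃ v ∈ V, l - algebraMap K L w = y * v :=
  exists_sub_eq_mul_of_mem_adjoin V hK hy (by rw [htop]; trivial) hl

theorem le_of_valuation_lt_one {K L : Type*} [Field K] [Field L] [Algebra K L]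
    (V W : ValuationSubring L) (hV : ∀ c : K, algebraMap K L c ∈ V)
    (hW : ∀ c : K, algebraMap K L c ∈ W) {y : L} (hyV : V.valuation y < 1)
    (hyW : W.valuation y < 1) (htop : IntermediateField.adjoin K {y} = ⊤) : V ≤ W := by
  intro l hl
  obtain ⟨a, b, h0, hb, h⟩ := exists_fraction_of_mem V hV hyV htop hl
  have hb1 := valuation_aeval_eq_one W hW hyW h0
  have ha := (W.valuation_le_one_iff _).2 (valuation_aeval_le_one W hW
    (valuation_lt_one_mem W hyW) a)
  rw [← h, map_mul, hb1, mul_one] at ha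
  exact (W.valuation_le_one_iff _).1 ha

/-- A rational function field has at most one place with a prescribed zero of its generator. -/
theorem eq_of_valuation_lt_one {K L : Type*} [Field K] [Field L] [Algebra K L]
    (V W : ValuationSubring L) (hV : ∀ c : K, algebraMap K L c ∈ V)
    (hW : ∀ c : K, algebraMap K L c ∈ W) {y : L} (hyV : V.valuation y < 1)
    (hyW : W.valuation y < 1) (htop : IntermediateField.adjoin K {y} = ⊤) : V = W :=
  le_antisymm (le_of_valuation_lt_one V W hV hW hyV hyW htop)
    (le_of_valuation_lt_one W V hW hV hyW hyV htop)

theorem adjoin_eq_top_of_mem {K L : Type*} [Field K] [Field L] [Algebra K L] {x y : L}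
    (hx : IntermediateField.adjoin K {x} = ⊤) (h : x ∈ IntermediateField.adjoin K {y}) :
    IntermediateField.adjoin K {y} = ⊤ :=
  top_le_iff.1 (hx ▸ IntermediateField.adjoin_simple_le_iff.2 h)

/-- The valuation ring of the fraction field `L` of a factorial domain `R` attached to a prime
element `p`. -/
def primeVal {R : Type*} (L : Type*) [CommRing R] [IsDomain R] [UniqueFactorizationMonoid R]
    [Field L] [Algebra R L] [IsFractionRing R L] (p : R) (hp : Prime p) : ValuationSubring L where
  carrier := {l | ∃ a b : R, ¬ p ∣ b ∧ l * algebraMap R L b = algebraMap R L a}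
  mul_mem' := by
    rintro l m ⟨a, b, hb, h⟩ ⟨c, d, hd, h'⟩
    refine ⟨a * c, b * d, fun h => (hp.dvd_or_dvd h).elim hb hd, ?_⟩
    rw [map_mul, map_mul, ← h, ← h']; ring
  one_mem' := ⟨1, 1, fun h => hp.not_isUnit (isUnit_of_dvd_one h), by simp⟩
  add_mem' := by
    rintro l m ⟨a, b, hb, h⟩ ⟨c, d, hd, h'⟩
    refine ⟨a * d + c * b, b * d, fun h => (hp.dvd_or_dvd h).elim hb hd, ?_⟩
    rw [map_add, map_mul, map_mul, map_mul, ← h, ← h']; ring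
  zero_mem' := ⟨0, 1, fun h => hp.not_isUnit (isUnit_of_dvd_one h), by simp⟩
  neg_mem' := by
    rintro l ⟨a, b, hb, h⟩
    exact ⟨-a, b, hb, by rw [map_neg, ← h]; ring⟩
  mem_or_inv_mem' := by
    intro l
    obtain ⟨a, b, hc, rfl⟩ := IsFractionRing.exists_reduced_fraction (A := R) l
    have hb0 : algebraMap R L b ≠ 0 := by
      simp
    by_cases hb : p ∣ (b : R)
    · have ha : ¬ p ∣ a := fun ha => hp.not_isUnit (hc ha hb)
      have ha0 : algebraMap R L a ≠ 0 := by
        rw [Ne, FaithfulSMul.algebraMap_eq_zero_iff]; rintro rfl; exact ha (dvd_zero p)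
      refine Or.inr ⟨b, a, ha, ?_⟩
      rw [IsFractionRing.mk'_eq_div]; field_simp
    · refine Or.inl ⟨a, b, hb, ?_⟩
      rw [IsFractionRing.mk'_eq_div]; field_simp

section

variable {R L : Type*} [CommRing R] [IsDomain R] [UniqueFactorizationMonoid R]
    [Field L] [Algebra R L] [IsFractionRing R L]

theorem mem_primeVal {p : R} (hp : Prime p) {l : L} : l ∈ primeVal L p hp ↔
    ∃ a b : R, ¬ p ∣ b ∧ l * algebraMap R L b = algebraMap R L a := Iff.rfl

theorem algebraMap_mem_primeVal {p : R} (hp : Prime p) (a : R) :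
    algebraMap R L a ∈ primeVal L p hp :=
  ⟨a, 1, fun h => hp.not_isUnit (isUnit_of_dvd_one h), by simp⟩

theorem inv_algebraMap_mem_primeVal {p : R} (hp : Prime p) {a : R} (ha : ¬ p ∣ a) :
    (algebraMap R L a)⁻¹ ∈ primeVal L p hp := by
  refine ⟨1, a, ha, ?_⟩
  rw [map_one, inv_mul_cancel₀]
  rw [Ne, FaithfulSMul.algebraMap_eq_zero_iff]; rintro rfl; exact ha (dvd_zero p)

theorem not_mem_primeVal {p : R} (hp : Prime p) {a b : R} (ha : ¬ p ∣ a) (hb : p ∣ b)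
    {l : L} (h : l * algebraMap R L b = algebraMap R L a) : l ∉ primeVal L p hp := by
  rintro ⟨c, d, hd, h'⟩
  have : a * d = c * b := by
    apply FaithfulSMul.algebraMap_injective R L
    rw [map_mul, map_mul, ← h, ← h']; ring
  have : p ∣ a * d := this ▸ hb.mul_left c
  exact (hp.dvd_or_dvd this).elim ha hd

theorem valuation_algebraMap_lt_one {p : R} (hp : Prime p) {a : R} :
    (primeVal L p hp).valuation (algebraMap R L a) < 1 ↔ p ∣ a := by
  constructor
  · intro h
    by_contra ha
    have h1 := ((primeVal L p hp).valuation_le_one_iff _).2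
      (inv_algebraMap_mem_primeVal (L := L) hp ha)
    have ha0 : algebraMap R L a ≠ 0 := by
      rw [Ne, FaithfulSMul.algebraMap_eq_zero_iff]; rintro rfl; exact ha (dvd_zero p)
    have h2 : (primeVal L p hp).valuation (algebraMap R L a) *
      (primeVal L p hp).valuation (algebraMap R L a)⁻¹ = 1 := by
      rw [← map_mul, mul_inv_cancel₀ ha0, map_one]
    exact absurd h2 (mul_lt_one_of_lt_of_le h h1).ne
  · intro ha
    by_cases ha0 : a = 0
    · simp [ha0]
    have ha0' : algebraMap R L a ≠ 0 := by simpa using ha0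
    have h : (algebraMap R L a)⁻¹ ∉ primeVal L p hp := by
      apply not_mem_primeVal hp (a := 1) (b := a) _ ha
      · simp [ha0']
      · exact fun h => hp.not_isUnit (isUnit_of_dvd_one h)
    have h1 := (not_congr ((primeVal L p hp).valuation_le_one_iff _)).2 h
    rw [not_le, map_inv₀] at h1
    exact (one_lt_inv₀ (zero_lt_iff.2 (by simpa using ha0))).1 h1

variable (k : Type*) [Field k] [Algebra k R] [Algebra k L] [IsScalarTower k R L]

/-- A prime element is horizontal over `τ` if it divides no nonzero polynomial in `τ`. -/
def Horizontal (τ p : R) : Prop := ∀ b : k[X], b ≠ 0 → ¬ p ∣ Polynomial.aeval τ b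

variable {k}

theorem adjoin_le_primeVal {τ p : R} (hp : Prime p) (h : Horizontal k τ p) {c : L}
    (hc : c ∈ IntermediateField.adjoin k {algebraMap R L τ}) : c ∈ primeVal L p hp := by
  obtain ⟨a, b, rfl⟩ := (IntermediateField.mem_adjoin_simple_iff k c).1 hc
  rw [Polynomial.aeval_algebraMap_apply, Polynomial.aeval_algebraMap_apply, div_eq_mul_inv]
  by_cases hb : b = 0
  · simp [hb, zero_mem]
  exact mul_mem (algebraMap_mem_primeVal hp _) (inv_algebraMap_mem_primeVal hp (h b hb))

theorem exists_dvd_aeval (τ b : R) (hb : b ≠ 0)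
    (h : ∀ p, Prime p → p ∣ b → ¬ Horizontal k τ p) :
    ∃ σ : k[X], σ ≠ 0 ∧ b ∣ Polynomial.aeval τ σ := by
  induction b using UniqueFactorizationMonoid.induction_on_prime with
  | h₁ => exact absurd rfl hb
  | h₂ x hx => exact ⟨1, one_ne_zero, hx.dvd⟩
  | h₃ a p ha hp ih =>
    obtain ⟨σ, hσ, h1⟩ := ih ha fun q hq hqa => h q hq (hqa.mul_left p)
    have := h p hp (dvd_mul_right p a)
    simp only [Horizontal, not_forall, not_not] at this
    obtain ⟨ρ, hρ, h2⟩ := this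
    exact ⟨ρ * σ, mul_ne_zero hρ hσ, by rw [map_mul]; exact mul_dvd_mul h2 h1⟩

/-- An element which is regular at all horizontal primes becomes regular after multiplication by a
nonzero polynomial in `τ`. -/
theorem exists_aeval_mul_mem (τ : R) (f : L) (h : ∀ (p : R) (hp : Prime p), Horizontal k τ p → f ∈ primeVal L p hp) :
    ∃ σ : k[X], σ ≠ 0 ∧ ∃ g : R, algebraMap R L (Polynomial.aeval τ σ) * f = algebraMap R L g := by
  obtain ⟨a, b, hc, rfl⟩ := IsFractionRing.exists_reduced_fraction (A := R) f
  have hb0 : (b : R) ≠ 0 := nonZeroDivisors.ne_zero b.2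
  have hb0' : algebraMap R L b ≠ 0 := by simp
  have hmk : IsLocalization.mk' L a b * algebraMap R L b = algebraMap R L a :=
    IsLocalization.mk'_spec L a b
  obtain ⟨σ, hσ, c, hc⟩ := exists_dvd_aeval τ (b : R) hb0 fun p hp hpb hor =>
    not_mem_primeVal hp (fun ha => hp.not_isUnit (hc ha hpb)) hpb hmk (h p hp hor)
  refine ⟨σ, hσ, c * a, ?_⟩
  rw [hc, map_mul, map_mul, ← hmk]; ring

theorem adjoin_good (τ : R) (hτ : Function.Injective (Polynomial.aeval (R := k) τ))
    (V : ValuationSubring L)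
    (hV : ∀ c : IntermediateField.adjoin k {algebraMap R L τ}, (c : L) ∈ V)
    (f₀ : R) (hf₀ : algebraMap R L f₀ ∉ V)
    (hres : ∀ l ∈ V, ∃ w : IntermediateField.adjoin k {algebraMap R L τ},
      V.valuation (l - w) < 1) {x : L}
    (hx : IntermediateField.adjoin (IntermediateField.adjoin k {algebraMap R L τ}) {x} = ⊤) :
    ∃ G : R, IntermediateField.adjoin (IntermediateField.adjoin k {algebraMap R L τ})
      {algebraMap R L G} = ⊤ := by
  set K := IntermediateField.adjoin k {algebraMap R L τ} with hK
  obtain ⟨z, hz, hz1⟩ : ∃ z : L, IntermediateField.adjoin K {z} = ⊤ ∧ V.valuation z < 1 := by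
    by_cases hxV : x ∈ V
    · obtain ⟨w, hw⟩ := hres x hxV
      refine ⟨x - w, adjoin_eq_top_of_mem hx ?_, hw⟩
      have : x = (x - w) + algebraMap K L w := by
        change x = (x - w) + (w : L); ring
      rw [this]
      exact add_mem (by simpa using IntermediateField.mem_adjoin_simple_self K (x - w))
        (IntermediateField.algebraMap_mem _ w)
    · refine ⟨x⁻¹, adjoin_eq_top_of_mem hx ?_, ?_⟩
      · rw [← inv_mem_iff]; exact IntermediateField.mem_adjoin_simple_self K _
      · rw [← V.valuation_le_one_iff, not_le] at hxV
        rw [map_inv₀]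
        exact inv_lt_one_of_one_lt₀ hxV
  have hz0 : z ≠ 0 := by
    rintro rfl
    apply hf₀
    have : algebraMap R L f₀ ∈ IntermediateField.adjoin K {(0 : L)} := by rw [hz]; trivial
    rw [IntermediateField.adjoin_zero, IntermediateField.mem_bot] at this
    obtain ⟨c, hc⟩ := this
    rw [← hc]; exact hV c
  obtain ⟨σ, hσ, G, hG⟩ := exists_aeval_mul_mem τ z⁻¹ fun p hp hor => by
    by_contra hmem
    have h1 : (primeVal L p hp).valuation z < 1 := by
      rw [← (primeVal L p hp).valuation_le_one_iff, not_le, map_inv₀] at hmem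
      exact (one_lt_inv₀ (zero_lt_iff.2 (by simpa using hz0))).1 hmem
    have := eq_of_valuation_lt_one (K := K) V (primeVal L p hp) hV
      (fun c => adjoin_le_primeVal hp hor c.2) hz1 h1 hz
    exact hf₀ (this ▸ algebraMap_mem_primeVal hp f₀)
  refine ⟨G, adjoin_eq_top_of_mem hz ?_⟩
  have hs : algebraMap R L (Polynomial.aeval τ σ) ≠ 0 := by
    rw [Ne, FaithfulSMul.algebraMap_eq_zero_iff]
    intro h
    exact hσ (hτ (by rw [h, map_zero]))
  have hsK : algebraMap R L (Polynomial.aeval τ σ) ∈ K := by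
    rw [← Polynomial.aeval_algebraMap_apply]
    exact (IntermediateField.mem_adjoin_simple_iff k _).2 ⟨σ, 1, by simp⟩
  have : z = algebraMap K L ⟨_, hsK⟩ * (algebraMap R L G)⁻¹ := by
    change z = algebraMap R L (Polynomial.aeval τ σ) * _
    rw [← hG]; field_simp
  rw [this]
  exact mul_mem (IntermediateField.algebraMap_mem _ _)
    (inv_mem (IntermediateField.mem_adjoin_simple_self K _))

end

theorem no_linear_relation {k R : Type*} [Field k] [CommRing R] [IsDomain R] [Algebra k R]
    {τ e N : R} {π : k[X]} (hπ : Irreducible π)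
    (ht : Prime (Polynomial.aeval τ π)) (hte : ¬ Polynomial.aeval τ π ∣ e)
    (hmod : ∀ a : k[X], Polynomial.aeval τ a ∈ Ideal.span {Polynomial.aeval τ π, e} → π ∣ a)
    (htN : ¬ Polynomial.aeval τ π ∣ N) (hN : N ∈ Ideal.span {Polynomial.aeval τ π, e ^ 2})
    (n : ℕ) : ∀ (r₀ r₁ : k[X]) (H : R), r₀.natDegree + r₁.natDegree = n → (r₀ ≠ 0 ∨ r₁ ≠ 0) →
      Polynomial.aeval τ r₀ + Polynomial.aeval τ r₁ * e ≠ N * H := by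
  induction n using Nat.strong_induction_on with
  | _ n ih =>
  intro r₀ r₁ H hn hr h
  set t := Polynomial.aeval τ π with ht_def
  have hNH : N * H ∈ Ideal.span {t, e ^ 2} := Ideal.mul_mem_right _ _ hN
  obtain ⟨c, d, hcd⟩ := Ideal.mem_span_pair.1 hNH
  have h0 : π ∣ r₀ := by
    apply hmod
    rw [Ideal.mem_span_pair]
    exact ⟨c, d * e - Polynomial.aeval τ r₁, by linear_combination hcd - h⟩
  obtain ⟨s₀, rfl⟩ := h0
  have h1 : t ∣ e * (Polynomial.aeval τ r₁ - e * d) := by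
    refine ⟨c - Polynomial.aeval τ s₀, ?_⟩
    rw [map_mul] at h
    linear_combination h - hcd
  obtain ⟨b, hb⟩ := (ht.dvd_or_dvd h1).resolve_left hte
  have h2 : π ∣ r₁ := by
    apply hmod
    rw [Ideal.mem_span_pair]
    exact ⟨b, d, by linear_combination -hb⟩
  obtain ⟨s₁, rfl⟩ := h2
  have h3 : t ∣ N * H := by
    rw [← h, map_mul, map_mul, mul_assoc, ← mul_add]
    exact dvd_mul_right _ _
  obtain ⟨H', rfl⟩ := (ht.dvd_or_dvd h3).resolve_left htN
  have hπd : 0 < π.natDegree := hπ.natDegree_pos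
  have hs : s₀ ≠ 0 ∨ s₁ ≠ 0 := by
    by_contra! hs
    simp [hs.1, hs.2] at hr
  refine ih (s₀.natDegree + s₁.natDegree) ?_ s₀ s₁ H' rfl hs ?_
  · rw [← hn]
    rcases eq_or_ne s₀ 0 with rfl | h0 <;> rcases eq_or_ne s₁ 0 with rfl | h1
    · simp at hs
    · rw [Polynomial.natDegree_mul hπ.ne_zero h1]; simp; omega
    · rw [Polynomial.natDegree_mul hπ.ne_zero h0]; simp; omega
    · rw [Polynomial.natDegree_mul hπ.ne_zero h1, Polynomial.natDegree_mul hπ.ne_zero h0]; omega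
  · apply mul_left_cancel₀ ht.ne_zero
    rw [map_mul, map_mul] at h
    linear_combination h

section
variable {k R L : Type*} [Field k] [CommRing R] [IsDomain R] [UniqueFactorizationMonoid R]
    [Field L] [Algebra R L] [IsFractionRing R L] [Algebra k R] [Algebra k L] [IsScalarTower k R L]

theorem exists_linear_relation (τ e N : R) (hN0 : N ≠ 0)
    (hτ : Function.Injective (Polynomial.aeval (R := k) τ)) {y : L}
    (hy : IntermediateField.adjoin (IntermediateField.adjoin k {algebraMap R L τ}) {y} = ⊤)
    (hval : ∀ (p : R) (hp : Prime p), Horizontal k τ p → p ∣ N →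
      (primeVal L p hp).valuation y = (primeVal L p hp).valuation (algebraMap R L N)) :
    ∃ (r₀ r₁ : k[X]) (H : R), (r₀ ≠ 0 ∨ r₁ ≠ 0) ∧
      Polynomial.aeval τ r₀ + Polynomial.aeval τ r₁ * e = N * H := by
  set K := IntermediateField.adjoin k {algebraMap R L τ} with hK
  have hN0' : algebraMap R L N ≠ 0 := by simpa using hN0
  by_cases hex : ∃ (p : R) (_ : Prime p), Horizontal k τ p ∧ p ∣ N
  · obtain ⟨p, hp, hor, hpN⟩ := hex
    set V := primeVal L p hp
    have hlt : ∀ (q : R) (hq : Prime q), Horizontal k τ q → q ∣ N →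
        (primeVal L q hq).valuation y < 1 := fun q hq hor hqN => by
      rw [hval q hq hor hqN, valuation_algebraMap_lt_one]; exact hqN
    have hKV : ∀ (q : R) (hq : Prime q), Horizontal k τ q →
        ∀ c : K, algebraMap K L c ∈ primeVal L q hq := fun q hq hor c =>
      adjoin_le_primeVal hq hor c.2
    obtain ⟨w, v, hv, hwv⟩ := exists_sub_eq_mul V (hKV p hp hor) (hlt p hp hor hpN) hy
      (algebraMap_mem_primeVal hp e)
    obtain ⟨σ, hσ, H, hH⟩ := exists_aeval_mul_mem (k := k) τ
      ((algebraMap R L e - algebraMap K L w) * (algebraMap R L N)⁻¹) fun q hq horq => by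
        by_cases hqN : q ∣ N
        · have hVW : V = primeVal L q hq := eq_of_valuation_lt_one V _ (hKV p hp hor)
            (hKV q hq horq) (hlt p hp hor hpN) (hlt q hq horq hqN) hy
          rw [← hVW, hwv, ← V.valuation_le_one_iff, map_mul, map_mul, map_inv₀,
            hval p hp hor hpN, mul_right_comm, mul_inv_cancel₀ (by simpa using hN0), one_mul]
          exact (V.valuation_le_one_iff _).2 hv
        · exact mul_mem (sub_mem (algebraMap_mem_primeVal hq e) (hKV q hq horq w))
            (inv_algebraMap_mem_primeVal hq hqN)
    obtain ⟨a, b, hab⟩ := (IntermediateField.mem_adjoin_simple_iff k _).1 w.2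
    change algebraMap K L w = _ at hab
    rw [Polynomial.aeval_algebraMap_apply, Polynomial.aeval_algebraMap_apply] at hab
    by_cases hb : b = 0
    · refine ⟨0, σ, H, Or.inr hσ, ?_⟩
      apply FaithfulSMul.algebraMap_injective R L
      rw [map_mul _ N, ← hH, hab, hb]
      simp only [map_zero, div_zero, zero_add, map_mul, sub_zero]
      field_simp
    · have hb' : algebraMap R L (Polynomial.aeval τ b) ≠ 0 := by
        rw [Ne, FaithfulSMul.algebraMap_eq_zero_iff]
        intro h
        exact hb (hτ (by rw [h, map_zero]))
      refine ⟨-(σ * a), σ * b, Polynomial.aeval τ b * H, Or.inr (mul_ne_zero hσ hb), ?_⟩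
      apply FaithfulSMul.algebraMap_injective R L
      rw [map_mul _ N, map_mul _ _ H, ← hH, hab]
      simp only [map_neg, map_mul, map_add]
      field_simp
      ring
  · obtain ⟨σ, hσ, H, hH⟩ := exists_aeval_mul_mem (k := k) τ (algebraMap R L N)⁻¹
      fun q hq horq => inv_algebraMap_mem_primeVal hq fun h => hex ⟨q, hq, horq, h⟩
    refine ⟨σ, 0, H, Or.inl hσ, ?_⟩
    apply FaithfulSMul.algebraMap_injective R L
    rw [map_mul _ N, ← hH]
    simp only [map_zero, zero_mul, add_zero]
    field_simp

/-- If `y` generates `L` over the field generated by `τ`, a local equation for the horizontal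
divisor of zeros of `y` is not tangent to the fibre `π(τ) = 0`. -/
theorem not_tangent {τ e N : R} {π : k[X]} (hπ : Irreducible π)
    (hτ : Function.Injective (Polynomial.aeval (R := k) τ))
    (ht : Prime (Polynomial.aeval τ π)) (hte : ¬ Polynomial.aeval τ π ∣ e)
    (hmod : ∀ a : k[X], Polynomial.aeval τ a ∈ Ideal.span {Polynomial.aeval τ π, e} → π ∣ a)
    (htN : ¬ Polynomial.aeval τ π ∣ N) {y : L}
    (hy : IntermediateField.adjoin (IntermediateField.adjoin k {algebraMap R L τ}) {y} = ⊤)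
    (hval : ∀ (p : R) (hp : Prime p), Horizontal k τ p → p ∣ N →
      (primeVal L p hp).valuation y = (primeVal L p hp).valuation (algebraMap R L N)) :
    N ∉ Ideal.span {Polynomial.aeval τ π, e ^ 2} := by
  intro hN
  have hN0 : N ≠ 0 := by rintro rfl; exact htN (dvd_zero _)
  obtain ⟨r₀, r₁, H, hr, h⟩ := exists_linear_relation τ e N hN0 hτ hy hval
  exact no_linear_relation hπ ht hte hmod htN hN _ r₀ r₁ H rfl hr h

end

theorem isUnit_mul_add {R : Type*} [CommRing R] [IsLocalRing R] {ξ c u : R} (hξ : ¬ IsUnit ξ) :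
    IsUnit (ξ * c + u) ↔ IsUnit u := by
  have hξc : ¬ IsUnit (ξ * c) := fun h => hξ (isUnit_of_mul_isUnit_left h)
  constructor
  · exact fun h => (IsLocalRing.isUnit_or_isUnit_of_isUnit_add h).resolve_left hξc
  · intro h
    have h' : IsUnit ((ξ * c + u) + -(ξ * c)) := by rwa [add_neg_cancel_comm]
    exact (IsLocalRing.isUnit_or_isUnit_of_isUnit_add h').resolve_right
      fun h => hξc ((IsUnit.neg_iff _).1 h)

theorem aeval_eq_mul_divX {D R : Type*} [CommRing D] [CommRing R] [Algebra D R] (ξ : R) (α : D[X]) :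
    Polynomial.aeval ξ α = ξ * Polynomial.aeval ξ α.divX + algebraMap D R (α.coeff 0) := by
  have h := congrArg (Polynomial.aeval ξ) (Polynomial.divX_mul_X_add α)
  rw [← h]
  simp only [map_add, map_mul, Polynomial.aeval_X, Polynomial.aeval_C]
  ring

theorem not_dvd_aeval {D R : Type*} [CommRing D] [CommRing R] [IsLocalRing R]
    [Algebra D R] {π : D} (ht : Prime (algebraMap D R π))
    (hunit : ∀ u : D, ¬ π ∣ u → IsUnit (algebraMap D R u)) {ξ : R} (hξ : ¬ IsUnit ξ)
    (htξ : ¬ algebraMap D R π ∣ ξ) (n : ℕ) : ∀ α : D[X], α.natDegree ≤ n → ¬ Polynomial.C π ∣ α →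
    ¬ algebraMap D R π ∣ Polynomial.aeval ξ α := by
  induction n with
  | zero =>
    intro α hn hα hd
    rw [Polynomial.eq_C_of_natDegree_le_zero hn] at hα hd
    rw [Polynomial.aeval_C] at hd
    exact ht.not_isUnit (isUnit_of_dvd_unit hd (hunit _ fun h => hα (Polynomial.C_dvd_iff_dvd_coeff _ _ |>.2
      fun i => by rw [Polynomial.coeff_C]; split_ifs <;> simp [h])))
  | succ n ih =>
    intro α hn hα hd
    rw [aeval_eq_mul_divX] at hd
    by_cases h0 : π ∣ α.coeff 0
    · rw [dvd_add_left (map_dvd _ h0)] at hd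
      refine ih α.divX ?_ (fun h => hα ?_) ((ht.dvd_or_dvd hd).resolve_left htξ)
      · rw [Polynomial.natDegree_divX_eq_natDegree_tsub_one]; omega
      · rw [← Polynomial.divX_mul_X_add α]
        exact dvd_add (h.mul_right _) (map_dvd Polynomial.C h0)
    · exact ht.not_isUnit (isUnit_of_dvd_unit hd ((isUnit_mul_add hξ).2 (hunit _ h0)))

theorem exists_primitive_multiple {D K : Type*} [CommRing D] [IsDomain D]
    [UniqueFactorizationMonoid D] [Field K] [Algebra D K] [IsFractionRing D K] {π : D}
    (hπ : Prime π) {a : K[X]} (ha : a ≠ 0) :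
    ∃ (c : K) (α : D[X]), c ≠ 0 ∧ ¬ Polynomial.C π ∣ α ∧
      α.map (algebraMap D K) = Polynomial.C c * a := by
  obtain ⟨b, hb0, hb⟩ := IsLocalization.integerNormalization_spec (nonZeroDivisors D) a
  set α := IsLocalization.integerNormalization (nonZeroDivisors D) a
  have hα : α ≠ 0 := by
    rwa [Ne, IsFractionRing.integerNormalization_eq_zero_iff]
  obtain ⟨m, β, hβ, h⟩ := WfDvdMonoid.max_power_factor hα (Polynomial.prime_C_iff.2 hπ).irreducible
  have hπ0 : algebraMap D K π ≠ 0 := by simpa using hπ.ne_zero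
  refine ⟨(algebraMap D K π ^ m)⁻¹ * algebraMap D K b, β, ?_, hβ, ?_⟩
  · have : b ≠ 0 := nonZeroDivisors.ne_zero hb0
    exact mul_ne_zero (inv_ne_zero (pow_ne_zero m hπ0)) (by simpa using this)
  · have h1 : (Polynomial.C (algebraMap D K π ^ m)) * β.map (algebraMap D K) =
        Polynomial.C (algebraMap D K b) * a := by
      rw [h] at hb
      rw [Polynomial.map_mul, Polynomial.map_pow, Polynomial.map_C, ← Polynomial.C_pow] at hb
      rw [hb, Algebra.smul_def]; rfl
    rw [Polynomial.C_mul, mul_assoc, ← h1, ← mul_assoc, ← Polynomial.C_mul,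
      inv_mul_cancel₀ (pow_ne_zero m hπ0), Polynomial.C_1, one_mul]

theorem exists_bezout {D K : Type*} [CommRing D] [IsDomain D] [Field K] [Algebra D K]
    [IsFractionRing D K] {α β : D[X]}
    (h : IsCoprime (α.map (algebraMap D K)) (β.map (algebraMap D K))) :
    ∃ (U V : D[X]) (r : D), r ≠ 0 ∧ U * α + V * β = Polynomial.C r := by
  obtain ⟨u, v, huv⟩ := h
  obtain ⟨b, hb0, hb⟩ := IsLocalization.integerNormalization_spec (nonZeroDivisors D) u
  obtain ⟨c, hc0, hc⟩ := IsLocalization.integerNormalization_spec (nonZeroDivisors D) v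
  refine ⟨Polynomial.C c * IsLocalization.integerNormalization (nonZeroDivisors D) u,
    Polynomial.C b * IsLocalization.integerNormalization (nonZeroDivisors D) v, b * c,
    mul_ne_zero (nonZeroDivisors.ne_zero hb0) (nonZeroDivisors.ne_zero hc0), ?_⟩
  apply Polynomial.map_injective _ (IsFractionRing.injective D K)
  simp only [Polynomial.map_add, Polynomial.map_mul, Polynomial.map_C, hb, hc, Algebra.smul_def,
    map_mul]
  change Polynomial.C _ * (Polynomial.C _ * u) * _ + Polynomial.C _ * (Polynomial.C _ * v) * _ = _
  linear_combination Polynomial.C (algebraMap D K b) * Polynomial.C (algebraMap D K c) * huv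

theorem isCoprime_reverse {K : Type*} [Field K] {a b : K[X]} (ha : a.Monic) (hab : IsCoprime a b) :
    IsCoprime a.reverse b.reverse := by
  rw [Polynomial.isCoprime_iff_aeval_ne_zero_of_isAlgClosed K (AlgebraicClosure K)] at hab ⊢
  intro x
  by_cases hx : x = 0
  · left
    rw [hx, ← Polynomial.coeff_zero_eq_aeval_zero', Polynomial.coeff_zero_reverse, ha.leadingCoeff]
    simp
  · let : Invertible x⁻¹ := invertibleOfNonzero (inv_ne_zero hx)
    have h : ⅟(x⁻¹) = x := by simp
    refine (hab x⁻¹).imp (fun h1 => ?_) (fun h1 => ?_)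
    all_goals
      rw [Polynomial.aeval_def] at h1 ⊢
      rwa [Ne, ← Polynomial.eval₂_reverse_eq_zero_iff, h] at h1

theorem aeval_eq_reverse {K L : Type*} [Field K] [Field L] [Algebra K L] {ξ : L} (hξ : ξ ≠ 0)
    (a : K[X]) :
    Polynomial.aeval ξ⁻¹ a * ξ ^ a.natDegree = Polynomial.aeval ξ a.reverse := by
  let : Invertible ξ⁻¹ := invertibleOfNonzero (inv_ne_zero hξ)
  have h : ⅟(ξ⁻¹) = ξ := by simp
  rw [Polynomial.aeval_def, Polynomial.aeval_def, ← Polynomial.eval₂_reverse_mul_pow, h, mul_assoc,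
    ← mul_pow, inv_mul_cancel₀ hξ, one_pow, mul_one]

section
variable {D K R L : Type*} [CommRing D] [IsDomain D]
    [UniqueFactorizationMonoid D] [Field K] [Algebra D K] [IsFractionRing D K]
    [CommRing R] [IsDomain R] [IsLocalRing R] [Algebra D R]
    [Field L] [Algebra R L] [FaithfulSMul R L] [Algebra K L] [Algebra D L] [IsScalarTower D R L]
    [IsScalarTower D K L]

theorem coeff_mem_primeVal_of_isUnit {π : D} (hπ : Prime π)
    (ht : ¬ IsUnit (algebraMap D R π))
    {ξ : R} (hξ : ¬ IsUnit ξ) {a : K[X]} (ha : a.coeff 0 = 1) {c : K} {α : D[X]}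
    (hα : α.map (algebraMap D K) = Polynomial.C c * a) (hu : IsUnit (Polynomial.aeval ξ α))
    (i : ℕ) :
    a.coeff i ∈ primeVal K π hπ := by
  rw [aeval_eq_mul_divX, isUnit_mul_add hξ] at hu
  have hc (i : ℕ) : algebraMap D K (α.coeff i) = c * a.coeff i := by
    rw [← Polynomial.coeff_map, hα, Polynomial.coeff_C_mul]
  refine ⟨α.coeff i, α.coeff 0, fun h => ht (isUnit_of_dvd_unit (map_dvd _ h) hu), ?_⟩
  rw [hc, hc, ha]; ring

/-- A Fatou-type integrality property: a quotient of coprime normalized polynomials in `ξ` which is,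
up to a scalar, a unit of `R` has coefficients which are integral at `π`. -/
theorem coeff_mem_primeVal {π : D} (hπ : Prime π) (ht : Prime (algebraMap D R π))
    (hunit : ∀ u : D, ¬ π ∣ u → IsUnit (algebraMap D R u)) {ξ : R} (hξ : ¬ IsUnit ξ)
    (htξ : ¬ algebraMap D R π ∣ ξ) {a b : K[X]} (hab : IsCoprime a b) (ha : a.coeff 0 = 1)
    (hb : b.coeff 0 = 1) {h : R} (hh : IsUnit h) {κ : K}
    (heq : Polynomial.aeval (algebraMap R L ξ) a =
      algebraMap K L κ * algebraMap R L h * Polynomial.aeval (algebraMap R L ξ) b) (i : ℕ) :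
    a.coeff i ∈ primeVal K π hπ ∧ b.coeff i ∈ primeVal K π hπ := by
  have ha0 : a ≠ 0 := by rintro rfl; simp at ha
  have hb0 : b ≠ 0 := by rintro rfl; simp at hb
  obtain ⟨c, α, hc, hα, hca⟩ := exists_primitive_multiple hπ ha0
  obtain ⟨d, β, hd, hβ, hdb⟩ := exists_primitive_multiple hπ hb0
  have hα' := not_dvd_aeval ht hunit hξ htξ _ α le_rfl hα
  have hβ' := not_dvd_aeval ht hunit hξ htξ _ β le_rfl hβ
  have key {c : K} {α : D[X]} {a : K[X]} (hca : α.map (algebraMap D K) = Polynomial.C c * a) :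
      algebraMap R L (Polynomial.aeval ξ α) = algebraMap K L c *
        Polynomial.aeval (algebraMap R L ξ) a := by
    rw [← Polynomial.aeval_algebraMap_apply, ← Polynomial.aeval_map_algebraMap K, hca, map_mul,
      Polynomial.aeval_C]
  have hinj := FaithfulSMul.algebraMap_injective R L
  obtain ⟨p, q, hpq, hmk⟩ := IsFractionRing.exists_reduced_fraction (A := D) (κ * c / d)
  have hq0 : algebraMap D K q ≠ 0 := by simp
  have hpqκ : algebraMap D K p * d = algebraMap D K q * κ * c := by
    rw [IsFractionRing.mk'_eq_div] at hmk
    field_simp at hmk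
    linear_combination hmk
  have hassoc : algebraMap D R q * Polynomial.aeval ξ α =
      algebraMap D R p * h * Polynomial.aeval ξ β := by
    apply hinj
    have h1 := congrArg (algebraMap K L) hpqκ
    simp only [map_mul, ← IsScalarTower.algebraMap_apply] at h1 ⊢
    rw [key hca, key hdb, heq]
    linear_combination -(algebraMap R L h * Polynomial.aeval (algebraMap R L ξ) b) * h1
  have hp : ¬ π ∣ p := fun hp => by
    have : algebraMap D R π ∣ algebraMap D R q * Polynomial.aeval ξ α := by
      rw [hassoc, mul_assoc]; exact (map_dvd _ hp).mul_right _
    rcases ht.dvd_or_dvd this with h1 | h1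
    · exact ht.not_isUnit (isUnit_of_dvd_unit h1 (hunit _ fun hq => hπ.not_isUnit (hpq hp hq)))
    · exact hα' h1
  have hq : ¬ π ∣ (q : D) := fun hq => by
    have : algebraMap D R π ∣ algebraMap D R p * h * Polynomial.aeval ξ β := by
      rw [← hassoc]; exact (map_dvd _ hq).mul_right _
    rcases ht.dvd_or_dvd this with h1 | h1
    · exact ht.not_isUnit (isUnit_of_dvd_unit h1 ((hunit _ hp).mul hh))
    · exact hβ' h1
  have hpu := hunit p hp
  have hqu := hunit _ hq
  have hdvd : Polynomial.aeval ξ α ∣ Polynomial.aeval ξ β :=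
    ((hpu.mul hh).dvd_mul_left).1 (hassoc ▸ dvd_mul_left _ _)
  have hcop : IsCoprime (α.map (algebraMap D K)) (β.map (algebraMap D K)) := by
    rw [hca, hdb]
    have hC {c : K} (hc : c ≠ 0) : IsUnit (Polynomial.C c) := Polynomial.isUnit_C.2 hc.isUnit
    rwa [isCoprime_mul_unit_left_left (hC hc), isCoprime_mul_unit_left_right (hC hd)]
  obtain ⟨U, V, r, hr, hUV⟩ := exists_bezout hcop
  obtain ⟨l, r', hr', rfl⟩ := WfDvdMonoid.max_power_factor hr hπ.irreducible
  have hr1 : Polynomial.aeval ξ α ∣ algebraMap D R π ^ l := by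
    have h1 := congrArg (Polynomial.aeval ξ) hUV
    simp only [map_add, map_mul, Polynomial.aeval_C, map_pow] at h1
    rw [← (hunit _ hr').dvd_mul_right, ← h1]
    exact dvd_add (dvd_mul_left _ _) (hdvd.mul_left _)
  have hαu : IsUnit (Polynomial.aeval ξ α) := by
    obtain ⟨s, hs⟩ := hr1
    obtain ⟨s', rfl⟩ := ht.pow_dvd_of_dvd_mul_left l hα' (dvd_of_eq hs)
    refine IsUnit.of_mul_eq_one s' (mul_left_cancel₀ (pow_ne_zero l ht.ne_zero) ?_)
    rw [mul_one]
    conv_rhs => rw [hs]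
    ring
  have hβu : IsUnit (Polynomial.aeval ξ β) := by
    have h1 : IsUnit (algebraMap D R p * h * Polynomial.aeval ξ β) := hassoc ▸ hqu.mul hαu
    exact isUnit_of_mul_isUnit_right h1
  exact ⟨coeff_mem_primeVal_of_isUnit hπ ht.not_isUnit hξ ha hca hαu i,
    coeff_mem_primeVal_of_isUnit hπ ht.not_isUnit hξ hb hdb hβu i⟩

theorem coeff_mem_primeVal_of_monic {π : D} (hπ : Prime π) (ht : Prime (algebraMap D R π))
    (hunit : ∀ u : D, ¬ π ∣ u → IsUnit (algebraMap D R u)) {ξ : R} (hξ : ¬ IsUnit ξ)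
    (htξ : ¬ algebraMap D R π ∣ ξ) {a b : K[X]} (hab : IsCoprime a b) (ha : a.Monic)
    (hb : b.Monic) (hdeg : b.natDegree = a.natDegree + 1) {h : R} (hh : IsUnit h) {κ : K}
    (heq : Polynomial.aeval (algebraMap R L ξ)⁻¹ a =
      algebraMap K L κ * algebraMap R L (ξ * h) * Polynomial.aeval (algebraMap R L ξ)⁻¹ b) (i : ℕ) :
    a.coeff i ∈ primeVal K π hπ ∧ b.coeff i ∈ primeVal K π hπ := by
  have hξ0 : algebraMap R L ξ ≠ 0 := by
    rw [Ne, FaithfulSMul.algebraMap_eq_zero_iff]; rintro rfl; exact htξ (dvd_zero _)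
  have key := coeff_mem_primeVal hπ ht hunit hξ htξ (isCoprime_reverse ha hab)
    (by rw [Polynomial.coeff_zero_reverse, ha.leadingCoeff])
    (by rw [Polynomial.coeff_zero_reverse, hb.leadingCoeff]) hh (κ := κ) (L := L) (by
      rw [← aeval_eq_reverse hξ0, ← aeval_eq_reverse hξ0, heq, hdeg, map_mul]; ring)
  have hrev (f : K[X]) (i : ℕ) : f.reverse.coeff (Polynomial.revAt f.natDegree i) = f.coeff i := by
    rw [Polynomial.coeff_reverse, Polynomial.revAt_invol]
  exact ⟨hrev a i ▸ (key _).1, hrev b i ▸ (key _).2⟩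

end

theorem prime_of_span_eq {S : Type*} [CommRing S] [IsDomain S] [UniqueFactorizationMonoid S]
    [IsLocalRing S] {t e : S} (ht : ¬ IsUnit t)
    (hspan : ∀ s : S, ¬ IsUnit s → s ∈ Ideal.span {t, e}) (het : ¬ e ∣ t) : Prime t := by
  rw [← UniqueFactorizationMonoid.irreducible_iff_prime]
  refine ⟨ht, fun a b hab => ?_⟩
  by_contra! h
  obtain ⟨a₁, a₂, ha⟩ := Ideal.mem_span_pair.1 (hspan a h.1)
  obtain ⟨b₁, b₂, hb⟩ := Ideal.mem_span_pair.1 (hspan b h.2)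
  have hu : IsUnit (t * -(a₁ * b₁ * 1) + 1) := (isUnit_mul_add ht).2 isUnit_one
  apply het
  rw [← hu.dvd_mul_right]
  refine ⟨a₁ * t * b₂ + b₁ * t * a₂ + a₂ * b₂ * e, ?_⟩
  rw [← ha, ← hb] at hab
  linear_combination hab

theorem not_dvd_of_prime_of_not_dvd {S : Type*} [CommRing S] [IsDomain S] {t e : S} (ht : Prime t)
    (he : Prime e) (het : ¬ e ∣ t) : ¬ t ∣ e := fun h =>
  het (ht.irreducible.associated_of_dvd he.irreducible h).symm.dvd

theorem aeval_mem_adjoin {k S L : Type*} [Field k] [CommRing S] [Field L] [Algebra S L]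
    [Algebra k S] [Algebra k L] [IsScalarTower k S L] (τ : S)
    (a : k[X]) : algebraMap S L (Polynomial.aeval τ a) ∈
    IntermediateField.adjoin k {algebraMap S L τ} := by
  rw [← Polynomial.aeval_algebraMap_apply]
  exact (IntermediateField.mem_adjoin_simple_iff k _).2 ⟨a, 1, by simp⟩

theorem adjoin_sub_eq_top {K L : Type*} [Field K] [Field L] [Algebra K L] {y : L}
    (hy : IntermediateField.adjoin K {y} = ⊤) (c : K) :
    IntermediateField.adjoin K {y - algebraMap K L c} = ⊤ := by
  refine adjoin_eq_top_of_mem hy ?_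
  have : y = (y - algebraMap K L c) + algebraMap K L c := by ring
  rw [this]
  exact add_mem (by simpa using IntermediateField.mem_adjoin_simple_self K (y - algebraMap K L c))
    (IntermediateField.algebraMap_mem _ _)

section
variable {k S L : Type*} [Field k] [CommRing S] [IsDomain S] [UniqueFactorizationMonoid S]
    [IsLocalRing S]
    [Field L] [Algebra S L] [IsFractionRing S L] [Algebra k S] [Algebra k L] [IsScalarTower k S L]

theorem exists_mul_sub_mem {τ P : S} {π : k[X]} (hπ : Irreducible π)
    (hτ : Function.Injective (Polynomial.aeval (R := k) τ))
    (ht : Prime (Polynomial.aeval τ π)) (htP : ¬ Polynomial.aeval τ π ∣ P)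
    (hP : Prime P) (hPt : ¬ P ∣ Polynomial.aeval τ π)
    (hunit : ∀ u : k[X], ¬ π ∣ u → IsUnit (Polynomial.aeval τ u))
    (hres : ∀ s : S, ∃ f u : k[X], ¬ π ∣ u ∧ P ∣ Polynomial.aeval τ u * s - Polynomial.aeval τ f)
    (V : ValuationSubring L) (hSV : ∀ s : S, algebraMap S L s ∈ V)
    (hVP : ∀ s : S, V.valuation (algebraMap S L s) < 1 ↔ P ∣ s)
    {K : IntermediateField k L} (hK : K = IntermediateField.adjoin k {algebraMap S L τ})
    (hKV : ∀ c : K, (c : L) ∈ V) {y : L} (hy : IntermediateField.adjoin K {y} = ⊤)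
    (hy1 : V.valuation (algebraMap S L P * y - 1) < 1)
    {σ : k[X]} (hσ : σ ≠ 0)
    (hmem : ∃ g : S, algebraMap S L (Polynomial.aeval τ σ * P) * y = algebraMap S L g) :
    ∃ (c : K) (g : S),
      algebraMap S L P * (y - c) = algebraMap S L g := by
  classical
  subst hK
  set K := IntermediateField.adjoin k {algebraMap S L τ} with hK
  set t := Polynomial.aeval τ π with ht_def
  have hinj := FaithfulSMul.algebraMap_injective S L
  have hmax (s : S) : ∃ α : k[X], s - Polynomial.aeval τ α ∈ Ideal.span {t, P} := by
    obtain ⟨f, u, hu, g, hg⟩ := hres s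
    obtain ⟨v, w, hvw⟩ := (hπ.coprime_iff_not_dvd.2 hu).symm
    refine ⟨v * f, Ideal.mem_span_pair.2 ⟨Polynomial.aeval τ w * s, Polynomial.aeval τ v * g, ?_⟩⟩
    have h1 := congrArg (Polynomial.aeval τ) hvw
    simp only [map_add, map_mul, map_one] at h1 ⊢
    linear_combination s * h1 - Polynomial.aeval τ v * hg
  have hmod : ∀ a : k[X], Polynomial.aeval τ a ∈ Ideal.span {t, P} → π ∣ a := by
    intro a ha
    by_contra h
    have h1 := hunit a h
    have h2 : Ideal.span {t, P} ≤ IsLocalRing.maximalIdeal S := by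
      rw [Ideal.span_le]
      rintro x (rfl | rfl)
      · exact (IsLocalRing.mem_maximalIdeal _).2 ht.not_isUnit
      · exact (IsLocalRing.mem_maximalIdeal _).2 hP.not_isUnit
    exact (IsLocalRing.mem_maximalIdeal _).1 (h2 ha) h1
  have hex : ∃ n : ℕ, ∃ (c : K) (g : S), algebraMap S L (t ^ n * P) * (y - c) = algebraMap S L g := by
    obtain ⟨n, σ', hσ', rfl⟩ := WfDvdMonoid.max_power_factor hσ hπ
    obtain ⟨g, hg⟩ := hmem
    obtain ⟨u, hu⟩ := hunit σ' hσ'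
    refine ⟨n, 0, ↑u⁻¹ * g, ?_⟩
    rw [map_mul _ _ g, ← hg, ← mul_assoc, ← map_mul]
    congr 2
    · rw [map_mul, map_pow, ← hu]
      linear_combination (-(t ^ n * P)) * u.inv_mul
    · simp
  obtain ⟨c, G, hG⟩ := Nat.find_spec hex
  set n := Nat.find hex with hn
  rcases Nat.eq_zero_or_pos n with h0 | hpos
  · exact ⟨c, G, by rw [← hG, h0, pow_zero, one_mul]⟩
  exfalso
  have hmin (c' : K) (g : S) : algebraMap S L (t ^ (n - 1) * P) * (y - c') ≠ algebraMap S L g :=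
    fun h => Nat.find_min hex (m := n - 1) (by omega) ⟨c', g, h⟩
  obtain ⟨m, hm⟩ : ∃ m, n = m + 1 := ⟨n - 1, by omega⟩
  have hGP : P ∣ G - t ^ n := by
    rw [← hVP, map_sub, ← hG]
    have : algebraMap S L (t ^ n * P) * (y - c) - algebraMap S L (t ^ n) =
        (algebraMap S L P * y - 1 - algebraMap S L P * c) * algebraMap S L (t ^ n) := by
      rw [map_mul]; ring
    rw [this, map_mul]
    refine mul_lt_one_of_lt_of_le (Valuation.map_sub_lt _ hy1 ?_) ((V.valuation_le_one_iff _).2 (hSV _))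
    rw [map_mul]
    exact mul_lt_one_of_lt_of_le ((hVP P).2 dvd_rfl) ((V.valuation_le_one_iff _).2 (hKV _))
  obtain ⟨h, hh⟩ := hGP
  obtain ⟨α, hα⟩ := hmax h
  obtain ⟨d₁, d₂, hd⟩ := Ideal.mem_span_pair.1 hα
  set G' := G - Polynomial.aeval τ α * P with hG'
  have ht0 : algebraMap S L t ≠ 0 := by simpa using ht.ne_zero
  let c' : K := c + ⟨_, aeval_mem_adjoin τ α⟩ / ⟨_, aeval_mem_adjoin τ π⟩ ^ n
  have hc' : (c' : L) = c + algebraMap S L (Polynomial.aeval τ α) / algebraMap S L t ^ n := rfl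
  have hGc : algebraMap S L (t ^ n * P) * (y - c') = algebraMap S L G' := by
    rw [hG', map_sub, ← hG, hc']
    simp only [map_mul, map_pow]
    field_simp
    ring
  have htG : ¬ t ∣ G' := by
    rintro ⟨g, hg⟩
    apply hmin c' g
    apply mul_left_cancel₀ ht0
    rw [← map_mul _ t g, ← hg, ← hGc, hm]
    simp only [map_mul, map_pow, Nat.add_sub_cancel]
    ring
  have hPG : ¬ P ∣ G' := by
    intro hd
    have : P ∣ t ^ n := by
      have h2 : t ^ n = G' + P * (Polynomial.aeval τ α - h) := by rw [hG']; linear_combination -hh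
      rw [h2]; exact dvd_add hd (dvd_mul_right _ _)
    exact hPt (hP.dvd_of_dvd_pow this)
  refine not_tangent hπ hτ ht htP hmod htG (y := y - algebraMap K L c') (adjoin_sub_eq_top hy c') ?_ ?_
  · intro p hp hor hpG
    have hone {a : S} (ha : ¬ p ∣ a) : (primeVal L p hp).valuation (algebraMap S L a) = 1 := by
      refine le_antisymm (((primeVal L p hp).valuation_le_one_iff _).2
        (algebraMap_mem_primeVal hp a)) (not_lt.1 fun h => ha ?_)
      exact (valuation_algebraMap_lt_one hp).1 h
    have hpP : ¬ p ∣ P := fun h =>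
      hPG ((hp.irreducible.associated_of_dvd hP.irreducible h).symm.dvd.trans hpG)
    rw [← hGc, map_mul _ (algebraMap S L _), hone, one_mul]
    · rfl
    · exact fun h => (hp.dvd_or_dvd h).elim (fun h => hor π hπ.ne_zero (hp.dvd_of_dvd_pow h)) hpP
  · refine Ideal.mem_span_pair.2 ⟨t ^ m + d₁ * P, d₂, ?_⟩
    rw [hG']
    rw [hm] at hh
    linear_combination P * hd - hh

theorem exists_isUnit_mul_sub {τ P : S} {π : k[X]} (hπ : Irreducible π)
    (hτ : Function.Injective (Polynomial.aeval (R := k) τ))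
    (ht : Prime (Polynomial.aeval τ π)) (htP : ¬ Polynomial.aeval τ π ∣ P)
    (hP : Prime P) (hPt : ¬ P ∣ Polynomial.aeval τ π)
    (hunit : ∀ u : k[X], ¬ π ∣ u → IsUnit (Polynomial.aeval τ u))
    (hres : ∀ s : S, ∃ f u : k[X], ¬ π ∣ u ∧ P ∣ Polynomial.aeval τ u * s - Polynomial.aeval τ f)
    (V : ValuationSubring L) (hSV : ∀ s : S, algebraMap S L s ∈ V)
    (hVP : ∀ s : S, V.valuation (algebraMap S L s) < 1 ↔ P ∣ s)
    {K : IntermediateField k L} (hK : K = IntermediateField.adjoin k {algebraMap S L τ})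
    (hKV : ∀ c : K, (c : L) ∈ V) {y : L} (hy : IntermediateField.adjoin K {y} = ⊤)
    (hy1 : V.valuation (algebraMap S L P * y - 1) < 1)
    {σ : k[X]} (hσ : σ ≠ 0)
    (hmem : ∃ g : S, algebraMap S L (Polynomial.aeval τ σ * P) * y = algebraMap S L g)
    (β : K)
    (hβ : V.valuation (y - (algebraMap S L P)⁻¹ - β) < 1) (r : k[X]) :
    ∃ u : S, IsUnit u ∧
      algebraMap S L P * (y - β + algebraMap S L (Polynomial.aeval τ r)) = algebraMap S L u := by
  obtain ⟨c, s, hs⟩ := exists_mul_sub_mem hπ hτ ht htP hP hPt hunit hres V hSV hVP hK hKV hy hy1 hσ hmem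
  have hPV : V.valuation (algebraMap S L P) < 1 := (hVP P).2 dvd_rfl
  have hP0 : algebraMap S L P ≠ 0 := by simpa using hP.ne_zero
  obtain ⟨s', hs'⟩ : P ∣ s - 1 := by
    rw [← hVP, map_sub, ← hs, map_one]
    have : algebraMap S L P * (y - c) - 1 =
        (algebraMap S L P * y - 1 - algebraMap S L P * c) := by ring
    rw [this]
    refine Valuation.map_sub_lt _ hy1 ?_
    rw [map_mul]
    exact mul_lt_one_of_lt_of_le hPV ((V.valuation_le_one_iff _).2 (hKV _))
  obtain ⟨f, u, hu, g, hg⟩ := hres s'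
  obtain ⟨v, hv⟩ := hunit u hu
  have hvL : algebraMap S L (Polynomial.aeval τ u) * algebraMap S L (↑v⁻¹ : S) = 1 := by
    rw [← map_mul, ← hv, v.mul_inv, map_one]
  have hu0 : algebraMap S L (Polynomial.aeval τ u) ≠ 0 := left_ne_zero_of_mul_eq_one hvL
  let γ : K := ⟨_, hK ▸ aeval_mem_adjoin τ f⟩ / ⟨_, hK ▸ aeval_mem_adjoin τ u⟩
  have hγ : (γ : L) = algebraMap S L (↑v⁻¹ * Polynomial.aeval τ f) := by
    change algebraMap S L (Polynomial.aeval τ f) / algebraMap S L (Polynomial.aeval τ u) = _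
    rw [map_mul]; field_simp
    linear_combination -algebraMap S L (Polynomial.aeval τ f) * hvL
  have hsy : y - (algebraMap S L P)⁻¹ = algebraMap S L s' + c := by
    have h1 := congrArg (algebraMap S L) hs'
    rw [map_sub, ← hs, map_mul, map_one] at h1
    field_simp
    linear_combination h1
  have hsγ : s' - ↑v⁻¹ * Polynomial.aeval τ f = P * (↑v⁻¹ * g) := by
    rw [← hv] at hg
    linear_combination (↑v⁻¹ : S) * hg - s' * v.inv_mul
  have hβc : β = γ + c := by
    by_contra hne
    have h1 : γ + c - β ≠ 0 := sub_ne_zero.2 (Ne.symm hne)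
    have h2 := valuation_algebraMap_eq_one (K := K) V hKV h1
    have h3 : algebraMap K L (γ + c - β) = (y - (algebraMap S L P)⁻¹ - β) -
        algebraMap S L (s' - ↑v⁻¹ * Polynomial.aeval τ f) := by
      rw [hsy, map_sub (algebraMap S L), ← hγ]
      change (γ : L) + c - β = _
      ring
    rw [h3] at h2
    exact absurd h2 (Valuation.map_sub_lt _ hβ ((hVP _).2 (hsγ ▸ dvd_mul_right _ _))).ne
  refine ⟨P * (P * (↑v⁻¹ * g) + Polynomial.aeval τ r) + 1, (isUnit_mul_add hP.not_isUnit).2 isUnit_one, ?_⟩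
  have h1 : (β : L) = γ + c := by rw [hβc]; rfl
  rw [h1, hγ]
  have h2 : algebraMap S L P * (y - (algebraMap S L (↑v⁻¹ * Polynomial.aeval τ f) + c) +
      algebraMap S L (Polynomial.aeval τ r)) = algebraMap S L (s - P * (↑v⁻¹ * Polynomial.aeval τ f) +
        P * Polynomial.aeval τ r) := by
    rw [map_add, map_sub _ s, ← hs, map_mul _ P, map_mul _ P]; ring
  rw [h2]
  congr 1
  linear_combination hs' + P * hsγ

end

/-- The elements of `L` which are rational functions of `x` regular at the prime `π` of `k[X]`. -/
def regularAt {k L : Type*} [Field k] [Field L] [Algebra k L] (x : L) {π : k[X]} (hπ : Prime π) :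
    Subring L where
  carrier := {c | ∃ f g : k[X], ¬ π ∣ g ∧ c * Polynomial.aeval x g = Polynomial.aeval x f}
  mul_mem' := by
    rintro l m ⟨a, b, hb, h⟩ ⟨c, d, hd, h'⟩
    refine ⟨a * c, b * d, fun h => (hπ.dvd_or_dvd h).elim hb hd, ?_⟩
    rw [map_mul, map_mul, ← h, ← h']; ring
  one_mem' := ⟨1, 1, fun h => hπ.not_isUnit (isUnit_of_dvd_one h), by simp⟩
  add_mem' := by
    rintro l m ⟨a, b, hb, h⟩ ⟨c, d, hd, h'⟩
    refine ⟨a * d + c * b, b * d, fun h => (hπ.dvd_or_dvd h).elim hb hd, ?_⟩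
    rw [map_add, map_mul, map_mul, map_mul, ← h, ← h']; ring
  zero_mem' := ⟨0, 1, fun h => hπ.not_isUnit (isUnit_of_dvd_one h), by simp⟩
  neg_mem' := by
    rintro l ⟨a, b, hb, h⟩
    exact ⟨-a, b, hb, by rw [map_neg, ← h]; ring⟩

theorem coeff_mem_regularAt {k S L : Type*} [Field k] [CommRing S] [IsDomain S] [IsLocalRing S]
    [Field L] [Algebra S L] [FaithfulSMul S L] [Algebra k S] [Algebra k L] [IsScalarTower k S L]
    {τ : S} {π : k[X]} (hπ : Prime π)
    (hτ : Function.Injective (Polynomial.aeval (R := k) τ))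
    (ht : Prime (Polynomial.aeval τ π))
    (hunit : ∀ u : k[X], ¬ π ∣ u → IsUnit (Polynomial.aeval τ u)) {ξ : S} (hξ : ¬ IsUnit ξ)
    (htξ : ¬ Polynomial.aeval τ π ∣ ξ)
    {K : IntermediateField k L} (hK : K = IntermediateField.adjoin k {algebraMap S L τ})
    {a b : K[X]} (hab : IsCoprime a b) (ha : a.Monic)
    (hb : b.Monic) (hdeg : b.natDegree = a.natDegree + 1) {h : S} (hh : IsUnit h) {κ : K}
    (heq : Polynomial.aeval (algebraMap S L ξ)⁻¹ a =
      κ * algebraMap S L (ξ * h) * Polynomial.aeval (algebraMap S L ξ)⁻¹ b) (i : ℕ) :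
    (a.coeff i : L) ∈ regularAt (algebraMap S L τ) hπ ∧
      (b.coeff i : L) ∈ regularAt (algebraMap S L τ) hπ := by
  have hmem : algebraMap S L τ ∈ K := hK ▸ IntermediateField.mem_adjoin_simple_self k _
  let x : K := ⟨algebraMap S L τ, hmem⟩
  let : Algebra k[X] S := (Polynomial.aeval τ).toRingHom.toAlgebra
  let : Algebra k[X] L := (Polynomial.aeval (algebraMap S L τ)).toRingHom.toAlgebra
  let : Algebra k[X] K := (Polynomial.aeval x).toRingHom.toAlgebra
  have hS (f : k[X]) : algebraMap k[X] S f = Polynomial.aeval τ f := rfl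
  have hL (f : k[X]) : algebraMap k[X] L f = Polynomial.aeval (algebraMap S L τ) f := rfl
  have hKx (f : k[X]) : algebraMap k[X] K f = Polynomial.aeval x f := rfl
  have hcoe (f : k[X]) : ((Polynomial.aeval x f : K) : L) = Polynomial.aeval (algebraMap S L τ) f := by
    change algebraMap K L _ = _
    rw [← Polynomial.aeval_algebraMap_apply]; rfl
  have : IsScalarTower k[X] S L := IsScalarTower.of_algebraMap_eq fun f => by
    rw [hS, hL, Polynomial.aeval_algebraMap_apply]
  have : IsScalarTower k[X] K L := IsScalarTower.of_algebraMap_eq fun f => by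
    rw [hKx, hL, ← hcoe]; rfl
  have hinj : Function.Injective (algebraMap k[X] L) := by
    rw [IsScalarTower.algebraMap_eq k[X] S L]
    exact (FaithfulSMul.algebraMap_injective S L).comp hτ
  have hinjK : Function.Injective (algebraMap k[X] K) := fun f g h => hinj <| by
    rw [hL, hL, ← hcoe, ← hcoe, ← hKx, ← hKx, h]
  have : FaithfulSMul k[X] K := (faithfulSMul_iff_algebraMap_injective _ _).2 hinjK
  have : IsFractionRing k[X] K := IsFractionRing.of_field _ _ fun z => by
    obtain ⟨f, g, h⟩ := (IntermediateField.mem_adjoin_simple_iff k (z : L)).1 (hK.le z.2)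
    refine ⟨f, g, Subtype.ext ?_⟩
    rw [hKx, hKx]
    change _ = ((Polynomial.aeval x f : K) : L) / ((Polynomial.aeval x g : K) : L)
    rw [hcoe, hcoe, h]
  have key {c : K} (hc : c ∈ primeVal K π hπ) : (c : L) ∈ regularAt (algebraMap S L τ) hπ := by
    obtain ⟨f, g, hg, h⟩ := (mem_primeVal hπ).1 hc
    refine ⟨f, g, hg, ?_⟩
    rw [hKx, hKx] at h
    rw [← hcoe, ← hcoe, ← h]; rfl
  have := coeff_mem_primeVal_of_monic (D := k[X]) (K := K) (R := S) (L := L) hπ ht hunit hξ htξ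
    hab ha hb hdeg hh (κ := κ) heq i
  exact ⟨key this.1, key this.2⟩

section
variable {k R : Type*} [Field k] [CommRing R] [IsDomain R] [UniqueFactorizationMonoid R]
  [Algebra k R] {F P : R}

theorem mem_span_pair_iff (hres : ∀ f : R, ∃ q : k[X], P ∣ f - Polynomial.aeval F q)
    (hor : Horizontal k F P) {π : k[X]} {f : R} {q : k[X]} (hq : P ∣ f - Polynomial.aeval F q) :
    f ∈ Ideal.span {P, Polynomial.aeval F π} ↔ π ∣ q := by
  rw [Ideal.mem_span_pair]
  constructor
  · rintro ⟨a, b, rfl⟩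
    obtain ⟨b', hb'⟩ := hres b
    by_contra h
    refine hor (q - b' * π) (fun h' => h ⟨b', by linear_combination h'⟩) ?_
    rw [map_sub, map_mul]
    obtain ⟨c, hc⟩ := hq
    obtain ⟨d, hd⟩ := hb'
    exact ⟨a - c + d * Polynomial.aeval F π, by linear_combination -hc + Polynomial.aeval F π * hd⟩
  · rintro ⟨c, rfl⟩
    obtain ⟨d, hd⟩ := hq
    rw [map_mul] at hd
    exact ⟨d, Polynomial.aeval F c, by linear_combination -hd⟩

theorem isPrime_span_pair (hres : ∀ f : R, ∃ q : k[X], P ∣ f - Polynomial.aeval F q)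
    (hor : Horizontal k F P) {π : k[X]} (hπ : Prime π) :
    (Ideal.span {P, Polynomial.aeval F π}).IsPrime := by
  refine ⟨?_, fun {f g} h => ?_⟩
  · rw [Ideal.ne_top_iff_one, mem_span_pair_iff hres hor (q := 1) (by simp)]
    exact fun h => hπ.not_isUnit (isUnit_of_dvd_one h)
  · obtain ⟨q, hq⟩ := hres f
    obtain ⟨s, hs⟩ := hres g
    rw [mem_span_pair_iff hres hor hq, mem_span_pair_iff hres hor hs]
    refine hπ.dvd_or_dvd ((mem_span_pair_iff hres hor ?_).1 h)
    have : f * g - Polynomial.aeval F (q * s) = (f - Polynomial.aeval F q) * g +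
        Polynomial.aeval F q * (g - Polynomial.aeval F s) := by rw [map_mul]; ring
    rw [this]
    exact dvd_add (hq.mul_right _) (hs.mul_left _)

theorem coeff_mem_regularAt_of_isLocalization {S L : Type*} [CommRing S] [IsDomain S]
    [UniqueFactorizationMonoid S] [IsLocalRing S] [Algebra R S] [Algebra k S] [IsScalarTower k R S]
    [Field L] [Algebra R L] [IsFractionRing R L] [Algebra k L] [IsScalarTower k R L]
    [Algebra S L] [IsFractionRing S L] [IsScalarTower R S L] [IsScalarTower k S L]
    (hP : Prime P) (hres : ∀ f : R, ∃ q : k[X], P ∣ f - Polynomial.aeval F q)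
    (hor : Horizontal k F P) {π : k[X]} (hπ : Prime π)
    [hpp : (Ideal.span {P, Polynomial.aeval F π}).IsPrime]
    [IsLocalization.AtPrime S (Ideal.span {P, Polynomial.aeval F π})]
    {K : IntermediateField k L} (hK : K = IntermediateField.adjoin k {algebraMap R L F})
    {y : L} (hy : IntermediateField.adjoin K {y} = ⊤)
    (hy1 : (primeVal L P hP).valuation (algebraMap R L P * y - 1) < 1)
    {σ : k[X]} (hσ : σ ≠ 0)
    (hmem : ∃ g : R, algebraMap R L (Polynomial.aeval F σ * P) * y = algebraMap R L g)
    (β : K) (hβ : (primeVal L P hP).valuation (y - (algebraMap R L P)⁻¹ - β) < 1) (r : k[X])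
    {a b : K[X]} (hab : IsCoprime a b) (ha : a.Monic)
    (hb : b.Monic) (hdeg : b.natDegree = a.natDegree + 1)
    (heq : Polynomial.aeval (y - β + algebraMap R L (Polynomial.aeval F r)) a =
      algebraMap R L P * Polynomial.aeval (y - β + algebraMap R L (Polynomial.aeval F r)) b)
    (i : ℕ) : (a.coeff i : L) ∈ regularAt (algebraMap R L F) hπ ∧
      (b.coeff i : L) ∈ regularAt (algebraMap R L F) hπ := by
  set 𝔭 := Ideal.span {P, Polynomial.aeval F π} with h𝔭
  have hRS : Function.Injective (algebraMap R S) :=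
    IsLocalization.injective S 𝔭.primeCompl_le_nonZeroDivisors
  have hev (q : k[X]) : algebraMap R S (Polynomial.aeval F q) =
      Polynomial.aeval (algebraMap R S F) q := (Polynomial.aeval_algebraMap_apply S F q).symm
  have hunitR (f : R) : IsUnit (algebraMap R S f) ↔ f ∉ 𝔭 :=
    IsLocalization.AtPrime.isUnit_to_map_iff S 𝔭 f
  have hP𝔭 : P ∈ 𝔭 := Ideal.subset_span (by simp)
  have hπ𝔭 : Polynomial.aeval F π ∈ 𝔭 := Ideal.subset_span (by simp)
  have hdvd (f : R) : algebraMap R S P ∣ algebraMap R S f ↔ P ∣ f := by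
    refine ⟨?_, map_dvd _⟩
    rintro ⟨s, hs⟩
    obtain ⟨g, d, rfl⟩ := IsLocalization.exists_mk'_eq 𝔭.primeCompl s
    have h1 : algebraMap R S (f * d) = algebraMap R S (P * g) := by
      rw [map_mul, hs, map_mul, mul_assoc, IsLocalization.mk'_spec]
    have h2 : P ∣ f * d := ⟨g, hRS h1⟩
    refine (hP.dvd_or_dvd h2).resolve_right fun h => d.2 ?_
    exact Ideal.mem_of_dvd _ h hP𝔭
  have hSL (f : R) : algebraMap S L (algebraMap R S f) = algebraMap R L f :=
    (IsScalarTower.algebraMap_apply R S L f).symm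
  have hsurj (s : S) : ∃ g d : R, d ∉ 𝔭 ∧ s * algebraMap R S d = algebraMap R S g := by
    obtain ⟨g, d, rfl⟩ := IsLocalization.exists_mk'_eq 𝔭.primeCompl s
    exact ⟨g, d, d.2, IsLocalization.mk'_spec ..⟩
  have hPS : Prime (algebraMap R S P) := by
    rw [← Ideal.span_singleton_prime ((map_ne_zero_iff _ hRS).2 hP.ne_zero), ← Set.image_singleton,
      ← Ideal.map_span]
    refine IsLocalization.isPrime_of_isPrime_disjoint 𝔭.primeCompl S _
      ((Ideal.span_singleton_prime hP.ne_zero).2 hP) ?_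
    rw [Set.disjoint_left]
    exact fun f hf hf' => hf (Ideal.mem_of_dvd _ (Ideal.mem_span_singleton.1 hf') hP𝔭)
  have hPt : ¬ algebraMap R S P ∣ Polynomial.aeval (algebraMap R S F) π := by
    rw [← hev, hdvd]; exact hor π hπ.ne_zero
  have hspan (s : S) (hs : ¬ IsUnit s) :
      s ∈ Ideal.span {Polynomial.aeval (algebraMap R S F) π, algebraMap R S P} := by
    obtain ⟨g, d, hd, h⟩ := hsurj s
    have hg : g ∈ 𝔭 := by
      by_contra hg
      exact hs (isUnit_of_mul_isUnit_left (h ▸ (hunitR g).2 hg))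
    obtain ⟨c₁, c₂, rfl⟩ := Ideal.mem_span_pair.1 hg
    obtain ⟨d', hd'⟩ := (hunitR d).2 hd
    refine Ideal.mem_span_pair.2 ⟨algebraMap R S c₂ * ↑d'⁻¹, algebraMap R S c₁ * ↑d'⁻¹, ?_⟩
    rw [← hev]
    rw [map_add, map_mul, map_mul, ← hd'] at h
    linear_combination -(↑d'⁻¹ : S) * h + s * d'.mul_inv
  have htu : ¬ IsUnit (Polynomial.aeval (algebraMap R S F) π) := by
    rw [← hev, hunitR, not_not]; exact hπ𝔭
  have ht := prime_of_span_eq htu hspan hPt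
  have htP := not_dvd_of_prime_of_not_dvd ht hPS hPt
  have hunit (u : k[X]) (hu : ¬ π ∣ u) : IsUnit (Polynomial.aeval (algebraMap R S F) u) := by
    rw [← hev, hunitR, mem_span_pair_iff hres hor (q := u) (by simp)]; exact hu
  have hresS (s : S) : ∃ f u : k[X], ¬ π ∣ u ∧ algebraMap R S P ∣
      Polynomial.aeval (algebraMap R S F) u * s - Polynomial.aeval (algebraMap R S F) f := by
    obtain ⟨g, d, hd, h⟩ := hsurj s
    obtain ⟨u, hu⟩ := hres d
    obtain ⟨f, hf⟩ := hres g
    refine ⟨f, u, fun h => hd ((mem_span_pair_iff hres hor hu).2 h), ?_⟩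
    rw [← hev, ← hev]
    have := dvd_sub (map_dvd (algebraMap R S) hf) ((map_dvd (algebraMap R S) hu).mul_left s)
    rw [map_sub, map_sub] at this
    convert this using 1
    linear_combination h
  have hPd {d : R} (hd : d ∉ 𝔭) : ¬ P ∣ d := fun h => hd (Ideal.mem_of_dvd _ h hP𝔭)
  have hSV (s : S) : algebraMap S L s ∈ primeVal L P hP := by
    obtain ⟨g, d, hd, h⟩ := hsurj s
    exact ⟨g, d, hPd hd, by rw [← hSL, ← hSL, ← map_mul, h]⟩
  have hVP (s : S) : (primeVal L P hP).valuation (algebraMap S L s) < 1 ↔ algebraMap R S P ∣ s := by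
    obtain ⟨g, d, hd, h⟩ := hsurj s
    have h1 : (primeVal L P hP).valuation (algebraMap R L d) = 1 :=
      le_antisymm (((primeVal L P hP).valuation_le_one_iff _).2 (algebraMap_mem_primeVal hP d))
        (not_lt.1 fun h => hPd hd ((valuation_algebraMap_lt_one hP).1 h))
    rw [← ((hunitR d).2 hd).dvd_mul_right, h, hdvd, ← valuation_algebraMap_lt_one (L := L) hP, ← hSL g,
      ← h, map_mul, map_mul, hSL d, h1, mul_one]
  have hτ : Function.Injective (Polynomial.aeval (R := k) (algebraMap R S F)) := by
    rw [injective_iff_map_eq_zero]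
    intro q hq
    by_contra h
    refine hor q h ?_
    rw [← hdvd, hev, hq]; exact dvd_zero _
  have hKS : K = IntermediateField.adjoin k {algebraMap S L (algebraMap R S F)} := by rw [hSL, hK]
  obtain ⟨u, hu, hu'⟩ := exists_isUnit_mul_sub hπ.irreducible hτ ht htP hPS hPt hunit hresS
    (primeVal L P hP) hSV hVP hKS (fun c => adjoin_le_primeVal hP hor (hK.le c.2)) hy
    (by rwa [hSL]) hσ (by
      obtain ⟨g, hg⟩ := hmem
      exact ⟨algebraMap R S g, by rw [hSL, ← hg, ← hev, ← map_mul, hSL]⟩) β (by rwa [hSL]) r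
  rw [← hev, hSL, hSL] at hu'
  have hP0 : algebraMap R L P ≠ 0 := by simpa using hP.ne_zero
  obtain ⟨u, rfl⟩ := hu
  have hinv : (algebraMap S L (algebraMap R S P * ↑u⁻¹))⁻¹ =
      y - β + algebraMap R L (Polynomial.aeval F r) := by
    have h1 : algebraMap S L ↑u * algebraMap S L ↑u⁻¹ = 1 := by
      rw [← map_mul, u.mul_inv, map_one]
    rw [map_mul, hSL, eq_comm]
    refine eq_inv_of_mul_eq_one_left ?_
    rw [← h1, ← hu']; ring
  have := coeff_mem_regularAt hπ hτ ht hunit (ξ := algebraMap R S P * ↑u⁻¹)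
    (fun h => hPS.not_isUnit (isUnit_of_mul_isUnit_left h)) (by simpa using htP) hKS hab ha hb hdeg
    u.isUnit (κ := 1) (by
      rw [hinv, heq, mul_assoc (algebraMap R S P), u.inv_mul, mul_one, hSL]; simp) i
  rwa [hSL] at this

theorem coeff_mem_regularAt_of_prime {L : Type*} 
    [Field L] [Algebra R L] [IsFractionRing R L] [Algebra k L] [IsScalarTower k R L]
    (hP : Prime P) (hres : ∀ f : R, ∃ q : k[X], P ∣ f - Polynomial.aeval F q)
    (hor : Horizontal k F P) {π : k[X]} (hπ : Prime π)
    {K : IntermediateField k L} (hK : K = IntermediateField.adjoin k {algebraMap R L F})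
    {y : L} (hy : IntermediateField.adjoin K {y} = ⊤)
    (hy1 : (primeVal L P hP).valuation (algebraMap R L P * y - 1) < 1)
    {σ : k[X]} (hσ : σ ≠ 0)
    (hmem : ∃ g : R, algebraMap R L (Polynomial.aeval F σ * P) * y = algebraMap R L g)
    (β : K) (hβ : (primeVal L P hP).valuation (y - (algebraMap R L P)⁻¹ - β) < 1) (r : k[X])
    {a b : K[X]} (hab : IsCoprime a b) (ha : a.Monic)
    (hb : b.Monic) (hdeg : b.natDegree = a.natDegree + 1)
    (heq : Polynomial.aeval (y - β + algebraMap R L (Polynomial.aeval F r)) a =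
      algebraMap R L P * Polynomial.aeval (y - β + algebraMap R L (Polynomial.aeval F r)) b)
    (i : ℕ) : (a.coeff i : L) ∈ regularAt (algebraMap R L F) hπ ∧
      (b.coeff i : L) ∈ regularAt (algebraMap R L F) hπ := by
  have hpp := isPrime_span_pair hres hor hπ
  set 𝔭 := Ideal.span {P, Polynomial.aeval F π} with h𝔭
  have hle := 𝔭.primeCompl_le_nonZeroDivisors
  let : Algebra (Localization.AtPrime 𝔭) L :=
    IsLocalization.localizationAlgebraOfSubmonoidLe _ L 𝔭.primeCompl (nonZeroDivisors R) hle
  have : IsScalarTower R (Localization.AtPrime 𝔭) L :=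
    IsLocalization.localization_isScalarTower_of_submonoid_le ..
  have : IsFractionRing (Localization.AtPrime 𝔭) L :=
    IsFractionRing.isFractionRing_of_isDomain_of_isLocalization 𝔭.primeCompl _ _
  have : IsScalarTower k (Localization.AtPrime 𝔭) L := IsScalarTower.of_algebraMap_eq fun x => by
    rw [IsScalarTower.algebraMap_apply k R (Localization.AtPrime 𝔭),
      ← IsScalarTower.algebraMap_apply R _ L, ← IsScalarTower.algebraMap_apply]
  exact coeff_mem_regularAt_of_isLocalization (S := Localization.AtPrime 𝔭) hP hres hor hπ hK hy hy1
    hσ hmem β hβ r hab ha hb hdeg heq i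

end

section
variable {k L : Type*} [Field k] [Field L] [Algebra k L]

/-- If two algebraically independent elements lie in `k(a, b)`, then `a` and `b` are algebraically
independent. -/
theorem algebraicIndependent_of_mem_adjoin {a b c d : L} (h : AlgebraicIndependent k ![c, d])
    (hc : c ∈ IntermediateField.adjoin k {a, b}) (hd : d ∈ IntermediateField.adjoin k {a, b}) :
    AlgebraicIndependent k ![a, b] := by
  set N := IntermediateField.adjoin k {a, b} with hN
  have ha : a ∈ N := IntermediateField.subset_adjoin k _ (by simp)
  have hb : b ∈ N := IntermediateField.subset_adjoin k _ (by simp)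
  let x : Fin 2 → N := ![⟨a, ha⟩, ⟨b, hb⟩]
  let y : Fin 2 → N := ![⟨c, hc⟩, ⟨d, hd⟩]
  have hx : N.val ∘ x = ![a, b] := by ext i; fin_cases i <;> rfl
  have hy : N.val ∘ y = ![c, d] := by ext i; fin_cases i <;> rfl
  have hy' : AlgebraicIndependent k y := .of_comp N.val (hy ▸ h)
  have htop : IntermediateField.adjoin k (Set.range x) = ⊤ := by
    apply IntermediateField.map_injective N.val
    rw [IntermediateField.adjoin_map, ← Set.range_comp, hx, Matrix.range_cons, Matrix.range_cons]
    simp only [Matrix.range_empty, Set.union_empty, Set.singleton_union]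
    rw [← hN, ← AlgHom.fieldRange_eq_map, IntermediateField.fieldRange_val]
  have : Algebra.IsAlgebraic (Algebra.adjoin k (Set.range x)) N := by
    rw [← IntermediateField.isAlgebraic_adjoin_iff_top, htop, Algebra.isAlgebraic_iff_isIntegral]
    exact Algebra.isIntegral_of_surjective IntermediateField.topEquiv.surjective
  rw [← hx]
  exact (Algebra.IsAlgebraic.isTranscendenceBasis_of_lift_le_trdeg_of_finite k x
    hy'.lift_cardinalMk_le_trdeg).1.map' N.val.injective

theorem exists_algHom_of_adjoin_eq_top {M : Type*} [Field M] [Algebra k M] {u w : L}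
    (huw : AlgebraicIndependent k ![u, w]) (htop : IntermediateField.adjoin k {u, w} = ⊤)
    {a b : M} (hab : AlgebraicIndependent k ![a, b]) :
    ∃ χ : L →ₐ[k] M, χ u = a ∧ χ w = b := by
  have htop' : IntermediateField.adjoin k (Set.range ![u, w]) = ⊤ := by
    rw [← htop, Matrix.range_cons, Matrix.range_cons, Matrix.range_empty, Set.union_empty,
      Set.singleton_union]
  have hu (i : Fin 2) : (huw.aevalEquivField.symm ((IntermediateField.equivOfEq htop').symm
      (IntermediateField.topEquiv.symm (![u, w] i)))) =
        algebraMap (MvPolynomial (Fin 2) k) _ (X i) := by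
    rw [AlgEquiv.symm_apply_eq]
    apply Subtype.ext
    rw [AlgebraicIndependent.aevalEquivField_algebraMap_apply_coe, aeval_X]
    rfl
  have key (i : Fin 2) : ((hab.aevalEquivField (huw.aevalEquivField.symm
      ((IntermediateField.equivOfEq htop').symm
        (IntermediateField.topEquiv.symm (![u, w] i))))) : M) = ![a, b] i := by
    rw [hu, AlgebraicIndependent.aevalEquivField_algebraMap_apply_coe, aeval_X]
  exact ⟨(IntermediateField.val _).comp (hab.aevalEquivField.toAlgHom.comp
    (huw.aevalEquivField.symm.toAlgHom.comp ((IntermediateField.equivOfEq htop').symm.toAlgHom.comp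
      IntermediateField.topEquiv.symm.toAlgHom))), key 0, key 1⟩
end

section
variable {E : Type*} [Field E]

/-- `Lead m n e` says that the Laurent series `m` has no terms of degree below `n` and that its
coefficient of degree `n` is `e`. -/
def Lead (m : LaurentSeries E) (n : ℤ) (e : E) : Prop :=
  ∃ s : PowerSeries E, m = HahnSeries.single n 1 * HahnSeries.ofPowerSeries ℤ E s ∧
    PowerSeries.constantCoeff s = e

namespace Lead
variable {m m' : LaurentSeries E} {n n' : ℤ} {e e' : E}

theorem mul (h : Lead m n e) (h' : Lead m' n' e') : Lead (m * m') (n + n') (e * e') := by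
  obtain ⟨s, rfl, rfl⟩ := h
  obtain ⟨s', rfl, rfl⟩ := h'
  refine ⟨s * s', ?_, map_mul ..⟩
  have : HahnSeries.single (n + n') (1 : E) = HahnSeries.single n 1 * HahnSeries.single n' 1 := by
    rw [HahnSeries.single_mul_single, one_mul]
  rw [this, map_mul]; ring

theorem add (h : Lead m n e) (h' : Lead m' n e') : Lead (m + m') n (e + e') := by
  obtain ⟨s, rfl, rfl⟩ := h
  obtain ⟨s', rfl, rfl⟩ := h'
  exact ⟨s + s', by rw [map_add, mul_add], map_add ..⟩

theorem neg (h : Lead m n e) : Lead (-m) n (-e) := by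
  obtain ⟨s, rfl, rfl⟩ := h
  exact ⟨-s, by rw [map_neg, mul_neg], map_neg ..⟩

theorem sub (h : Lead m n e) (h' : Lead m' n e') : Lead (m - m') n (e - e') := by
  rw [sub_eq_add_neg, sub_eq_add_neg]; exact h.add h'.neg

theorem zero (n : ℤ) : Lead (0 : LaurentSeries E) n 0 := ⟨0, by simp, by simp⟩

theorem one : Lead (1 : LaurentSeries E) 0 1 := ⟨1, by simp, by simp⟩

theorem single (n : ℤ) (e : E) : Lead (HahnSeries.single n e) n e :=
  ⟨PowerSeries.C e, by simp, by simp⟩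

theorem pow (h : Lead m n e) (i : ℕ) : Lead (m ^ i) (i * n) (e ^ i) := by
  induction i with
  | zero => simpa using one
  | succ i ih => rw [pow_succ, pow_succ]; convert ih.mul h using 1; push_cast; ring

theorem sum {ι : Type*} (s : Finset ι) {f : ι → LaurentSeries E} {g : ι → E}
    (h : ∀ i ∈ s, Lead (f i) n (g i)) : Lead (∑ i ∈ s, f i) n (∑ i ∈ s, g i) := by
  classical
  induction s using Finset.induction_on with
  | empty => simpa using zero n
  | insert i s hi ih =>
    rw [Finset.sum_insert hi, Finset.sum_insert hi]
    exact (h i (by simp)).add (ih fun j hj => h j (by simp [hj]))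

theorem of_lt (h : Lead m n e) (hn : n' < n) : Lead m n' 0 := by
  obtain ⟨s, rfl, rfl⟩ := h
  obtain ⟨d, rfl⟩ : ∃ d : ℕ, n = n' + (d + 1 : ℕ) := ⟨(n - n' - 1).toNat, by omega⟩
  refine ⟨PowerSeries.X ^ (d + 1) * s, ?_, by simp⟩
  rw [map_mul, HahnSeries.ofPowerSeries_X_pow, ← mul_assoc, HahnSeries.single_mul_single, one_mul]

theorem unique (h : Lead m n e) (h' : Lead m n e') : e = e' := by
  obtain ⟨s, rfl, rfl⟩ := h
  obtain ⟨s', h, rfl⟩ := h'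
  rw [HahnSeries.ofPowerSeries_injective (mul_left_cancel₀ (by simp) h)]

theorem le_of_ne_zero (h : Lead m n e) (he : e ≠ 0) (h' : Lead m n' e') : n' ≤ n := by
  by_contra! hn
  exact he (h.unique (h'.of_lt hn))

theorem order_unique (h : Lead m n e) (he : e ≠ 0) (h' : Lead m n' e') (he' : e' ≠ 0) : n = n' :=
  le_antisymm (h'.le_of_ne_zero he' h) (h.le_of_ne_zero he h')

theorem ne_zero (h : Lead m n e) (he : e ≠ 0) : m ≠ 0 := by
  rintro rfl; exact he (h.unique (zero n))

theorem exists_of_ne_zero (hm : m ≠ 0) : ∃ n e, e ≠ 0 ∧ Lead m n e := by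
  refine ⟨m.order, _, ?_, m.powerSeriesPart, (LaurentSeries.single_order_mul_powerSeriesPart m).symm,
    rfl⟩
  rw [← PowerSeries.coeff_zero_eq_constantCoeff_apply, LaurentSeries.powerSeriesPart_coeff]
  simpa using hm

theorem inv (h : Lead m n e) (he : e ≠ 0) : Lead m⁻¹ (-n) e⁻¹ := by
  obtain ⟨n', e', he', h'⟩ := exists_of_ne_zero (inv_ne_zero (h.ne_zero he))
  have h1 := h.mul h'
  rw [mul_inv_cancel₀ (h.ne_zero he)] at h1
  have h2 := h1.order_unique (mul_ne_zero he he') one one_ne_zero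
  rw [h2] at h1
  have h3 := h1.unique one
  rwa [show -n = n' by omega, inv_eq_of_mul_eq_one_right h3]

theorem div (h : Lead m n e) (h' : Lead m' n' e') (he' : e' ≠ 0) :
    Lead (m / m') (n - n') (e / e') := by
  rw [div_eq_mul_inv, div_eq_mul_inv, sub_eq_add_neg]; exact h.mul (h'.inv he')

variable {k : Type*} [Field k] [Algebra k E]

theorem base (c : k) : Lead (algebraMap k (LaurentSeries E) c) 0 (algebraMap k E c) := by
  refine ⟨algebraMap k (PowerSeries E) c, ?_, ?_⟩
  · rw [HahnSeries.algebraMap_apply']; simp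
  · rw [PowerSeries.algebraMap_apply, PowerSeries.constantCoeff_C]

theorem polynomial_aeval (h : Lead m 0 e) (p : k[X]) :
    Lead (Polynomial.aeval m p) 0 (Polynomial.aeval e p) := by
  rw [Polynomial.aeval_eq_sum_range, Polynomial.aeval_eq_sum_range]
  refine sum _ fun i _ => ?_
  rw [Algebra.smul_def, Algebra.smul_def]
  simpa using (base (p.coeff i)).mul (h.pow i)

theorem mvPolynomial_aeval {u w : LaurentSeries E} {a b : ℤ} {eu ew : E} (hu : Lead u a eu)
    (hw : Lead w b ew) (U : MvPolynomial (Fin 2) k) (n : ℤ)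
    (hn : ∀ s ∈ U.support, n ≤ a * s 0 + b * s 1) :
    Lead (aeval ![u, w] U) n (∑ s ∈ U.support with a * s 0 + b * s 1 = n,
      algebraMap k E (U.coeff s) * (eu ^ s 0 * ew ^ s 1)) := by
  rw [aeval_def, eval₂_eq', Finset.sum_filter]
  refine sum _ fun s hs => ?_
  have h := (base (U.coeff s)).mul ((hu.pow (s 0)).mul (hw.pow (s 1)))
  rw [Fin.prod_univ_two]
  simp only [Matrix.cons_val_zero, Matrix.cons_val_one]
  split_ifs with heq
  · convert h using 1; rw [← heq]; ring
  · refine h.of_lt (lt_of_le_of_ne ((hn s hs).trans_eq (by ring)) fun h' => heq ?_)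
    rw [h']; ring

theorem mvPolynomial_aeval_zero {u w : LaurentSeries E} {eu ew : E} (hu : Lead u 0 eu)
    (hw : Lead w 0 ew) (U : MvPolynomial (Fin 2) k) :
    Lead (aeval ![u, w] U) 0 (aeval ![eu, ew] U) := by
  convert mvPolynomial_aeval hu hw U 0 (by simp) using 1
  rw [Finset.filter_true_of_mem (by simp), aeval_def, eval₂_eq']
  simp [Fin.prod_univ_two]

end Lead
end

section
variable {k E : Type*} [Field k] [Field E] [Algebra k E]

/-- The leading form of a nonzero polynomial does not vanish at a pair `(u, w)` with
`w ^ q / u ^ p` transcendental. -/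
theorem sum_filter_ne_zero {eu ew : E} {q p : ℕ} (hq : 0 < q) (hqp : q.Coprime p)
    (hu : eu ≠ 0) (hw : ew ≠ 0) (htr : Transcendental k (ew ^ q / eu ^ p))
    (U : MvPolynomial (Fin 2) k) {μ : ℕ} (hμ : ∃ s ∈ U.support, q * s 0 + p * s 1 = μ) :
    ∑ s ∈ U.support with q * s 0 + p * s 1 = μ,
      algebraMap k E (U.coeff s) * (eu ^ s 0 * ew ^ s 1) ≠ 0 := by
  classical
  set T := U.support.filter fun s => q * s 0 + p * s 1 = μ with hT
  obtain ⟨t, ht, htmin⟩ := T.exists_min_image (fun s => s 1)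
    (hμ.imp fun s hs => Finset.mem_filter.2 hs)
  have ht' := (Finset.mem_filter.1 ht).2
  have hdvd (s) (hs : s ∈ T) : ∃ l, s 1 = t 1 + q * l ∧ t 0 = s 0 + p * l := by
    have hs' := (Finset.mem_filter.1 hs).2
    obtain ⟨d, hd⟩ := Nat.exists_eq_add_of_le (htmin s hs)
    have h1 : q * t 0 = q * s 0 + p * d := by
      have : q * s 0 + p * s 1 = q * t 0 + p * t 1 := by rw [hs', ht']
      rw [hd] at this; nlinarith
    have h2 : q ∣ p * d := (Nat.dvd_add_right (dvd_mul_right q (s 0))).1 (h1 ▸ dvd_mul_right ..)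
    obtain ⟨l, rfl⟩ := hqp.dvd_of_dvd_mul_left h2
    refine ⟨l, hd, Nat.eq_of_mul_eq_mul_left hq ?_⟩
    rw [h1]; ring
  choose! l hl1 hl0 using hdvd
  let f : k[X] := ∑ s ∈ T, Polynomial.monomial (l s) (U.coeff s)
  have hf : f ≠ 0 := by
    intro h
    have h1 : f.coeff (l t) = U.coeff t := by
      rw [Polynomial.finsetSum_coeff, Finset.sum_eq_single t]
      · simp
      · intro s hs hst
        rw [Polynomial.coeff_monomial, if_neg]
        intro h'
        apply hst
        have e1 := hl1 s hs
        have e0 := hl0 s hs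
        have e1' := hl1 t ht
        have e0' := hl0 t ht
        rw [h'] at e1 e0
        ext i; fin_cases i
        · change s 0 = t 0; omega
        · change s 1 = t 1; omega
      · exact fun h => absurd ht h
    rw [h, Polynomial.coeff_zero] at h1
    exact (mem_support_iff.1 (Finset.mem_filter.1 ht).1) h1.symm
  have hsum : ∑ s ∈ T, algebraMap k E (U.coeff s) * (eu ^ s 0 * ew ^ s 1) =
      eu ^ t 0 * ew ^ t 1 * Polynomial.aeval (ew ^ q / eu ^ p) f := by
    rw [map_sum, Finset.mul_sum]
    refine Finset.sum_congr rfl fun s hs => ?_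
    rw [Polynomial.aeval_monomial, hl0 s hs, hl1 s hs, div_pow, ← pow_mul, ← pow_mul, pow_add,
      pow_add]
    field_simp
  rw [hsum]
  exact mul_ne_zero (mul_ne_zero (pow_ne_zero _ hu) (pow_ne_zero _ hw))
    (fun h => hf (by_contra fun hf => htr ⟨f, hf, h⟩))

theorem Lead.exists_of_toric {u w : LaurentSeries E} {eu ew : E} {g q p : ℕ} (hg : 0 < g)
    (hq : 0 < q) (hqp : q.Coprime p)
    (hu : eu ≠ 0) (hw : ew ≠ 0) (htr : Transcendental k (ew ^ q / eu ^ p))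
    (hLu : Lead u (g * q : ℕ) eu) (hLw : Lead w (g * p : ℕ) ew)
    (U : MvPolynomial (Fin 2) k) (hU : U ≠ 0) :
    ∃ μ : ℕ, (∃ s ∈ U.support, q * s 0 + p * s 1 = μ) ∧ (∀ s ∈ U.support, μ ≤ q * s 0 + p * s 1) ∧
      ∃ e ≠ 0, Lead (aeval ![u, w] U) (g * μ : ℕ) e := by
  obtain ⟨t, ht, htmin⟩ := U.support.exists_min_image (fun s => q * s 0 + p * s 1)
    (support_nonempty.2 hU)
  refine ⟨_, ⟨t, ht, rfl⟩, htmin, _, ?_, Lead.mvPolynomial_aeval hLu hLw U _ ?_⟩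
  · convert sum_filter_ne_zero hq hqp hu hw htr U ⟨t, ht, rfl⟩ using 3 with s
    constructor
    · intro h
      have : g * (q * s 0 + p * s 1) = g * (q * t 0 + p * t 1) := by
        zify; push_cast at h; linarith
      exact Nat.eq_of_mul_eq_mul_left hg this
    · intro h; rw [← h]; push_cast; ring
  · intro s hs
    have := Nat.mul_le_mul_left g (htmin s hs)
    zify at this; push_cast; linarith

theorem Lead.algebraicIndependent {u w : LaurentSeries E} {eu ew : E} {g q p : ℕ} (hg : 0 < g)
    (hq : 0 < q) (hqp : q.Coprime p)
    (hu : eu ≠ 0) (hw : ew ≠ 0) (htr : Transcendental k (ew ^ q / eu ^ p))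
    (hLu : Lead u (g * q : ℕ) eu) (hLw : Lead w (g * p : ℕ) ew) :
    AlgebraicIndependent k ![u, w] := by
  rw [algebraicIndependent_iff]
  intro U hU
  by_contra hU0
  obtain ⟨μ, -, -, e, he, hL⟩ := exists_of_toric hg hq hqp hu hw htr hLu hLw U hU0
  exact hL.ne_zero he hU

theorem algebraicIndependent_single {ζ : E} (hζ : Transcendental k ζ) :
    AlgebraicIndependent k
      ![(HahnSeries.single 1 1 : LaurentSeries E), HahnSeries.single 0 ζ] := by
  have h0 : ζ ≠ 0 := by rintro rfl; exact hζ isAlgebraic_zero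
  exact Lead.algebraicIndependent (g := 1) (q := 1) (p := 0) one_pos one_pos (by simp) one_ne_zero
    h0 (by simpa using hζ) (by simpa using Lead.single 1 (1 : E)) (by simpa using Lead.single 0 ζ)

variable {L : Type*} [Field L] [Algebra k L]

/-- The valuation subring of `L` obtained by pulling back power series along an embedding of `L`
into Laurent series. -/
def leadVal (χ : L →ₐ[k] LaurentSeries E) : ValuationSubring L where
  carrier := {l | ∃ e, Lead (χ l) 0 e}
  mul_mem' := by
    rintro a b ⟨e, h⟩ ⟨e', h'⟩
    exact ⟨e * e', by simpa using h.mul h'⟩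
  one_mem' := ⟨1, by simpa using Lead.one⟩
  add_mem' := by
    rintro a b ⟨e, h⟩ ⟨e', h'⟩
    exact ⟨e + e', by simpa using h.add h'⟩
  zero_mem' := ⟨0, by simpa using Lead.zero 0⟩
  neg_mem' := by
    rintro a ⟨e, h⟩
    exact ⟨-e, by simpa using h.neg⟩
  mem_or_inv_mem' := by
    intro a
    by_cases ha : a = 0
    · left; exact ⟨0, by simpa [ha] using Lead.zero 0⟩
    obtain ⟨n, e, he, h⟩ := Lead.exists_of_ne_zero ((map_ne_zero χ).2 ha)
    rcases lt_trichotomy n 0 with hn | rfl | hn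
    · right; exact ⟨0, by simpa using (h.inv he).of_lt (n' := 0) (by omega)⟩
    · left; exact ⟨e, h⟩
    · left; exact ⟨0, h.of_lt hn⟩

theorem leadVal_valuation_lt_one {χ : L →ₐ[k] LaurentSeries E} {l : L} (h : Lead (χ l) 0 0) :
    (leadVal χ).valuation l < 1 := by
  by_cases hl : l = 0
  · simp [hl]
  obtain ⟨n, e, he, h'⟩ := Lead.exists_of_ne_zero ((map_ne_zero χ).2 hl)
  refine lt_of_le_of_ne (((leadVal χ).valuation_le_one_iff l).2 ⟨0, h⟩) fun h1 => ?_
  have h2 : l⁻¹ ∈ leadVal χ := by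
    rw [← ValuationSubring.valuation_le_one_iff, map_inv₀, h1, inv_one]
  obtain ⟨e', h2⟩ := h2
  have h3 := h2.mul h
  rw [← map_mul, inv_mul_cancel₀ hl, map_one] at h3
  simpa using h3.unique Lead.one

theorem not_mem_leadVal {χ : L →ₐ[k] LaurentSeries E} {l : L} {n : ℤ} {e : E}
    (h : Lead (χ l) n e) (hn : n < 0) (he : e ≠ 0) : l ∉ leadVal χ := by
  rintro ⟨e', h'⟩
  exact absurd (h.le_of_ne_zero he h') (by omega)

end

section
variable {k R L E : Type*} [Field k] [CommRing R] [IsDomain R] [UniqueFactorizationMonoid R]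
  [Algebra k R] [Field L] [Algebra R L] [IsFractionRing R L] [Algebra k L] [IsScalarTower k R L]
  [Field E] [Algebra k E]

theorem exists_adjoin_eq_top_of_lead {χ : L →ₐ[k] LaurentSeries E} {F : R} {ε : E}
    (hF : Lead (χ (algebraMap R L F)) 0 ε) (hε : Transcendental k ε)
    (htop : IntermediateField.adjoin k {ε} = ⊤) {f₀ : R} {n : ℤ} {e : E}
    (hf₀ : Lead (χ (algebraMap R L f₀)) n e) (hn : n < 0) (he : e ≠ 0) {x : L}
    (hx : IntermediateField.adjoin (IntermediateField.adjoin k {algebraMap R L F}) {x} = ⊤) :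
    ∃ G : R, IntermediateField.adjoin (IntermediateField.adjoin k {algebraMap R L F})
      {algebraMap R L G} = ⊤ := by
  have hne (b : k[X]) (hb : b ≠ 0) : Polynomial.aeval ε b ≠ 0 := fun h => hε ⟨b, hb, h⟩
  have hdiv (a b : k[X]) (hb : b ≠ 0) :
      Lead (χ (Polynomial.aeval (algebraMap R L F) a / Polynomial.aeval (algebraMap R L F) b)) 0
        (Polynomial.aeval ε a / Polynomial.aeval ε b) := by
    rw [map_div₀, ← Polynomial.aeval_algHom_apply, ← Polynomial.aeval_algHom_apply]
    simpa using (hF.polynomial_aeval a).div (hF.polynomial_aeval b) (hne b hb)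
  have hinj : Function.Injective (Polynomial.aeval (R := k) F) := by
    rw [injective_iff_map_eq_zero]
    intro a ha
    by_contra h0
    refine (hF.polynomial_aeval a).ne_zero (hne a h0) ?_
    rw [Polynomial.aeval_algHom_apply, Polynomial.aeval_algebraMap_apply, ha, map_zero, map_zero]
  refine adjoin_good F hinj (leadVal χ) ?_ f₀ (not_mem_leadVal hf₀ hn he) ?_ hx
  · rintro ⟨c, hc⟩
    obtain ⟨a, b, rfl⟩ := (IntermediateField.mem_adjoin_simple_iff k c).1 hc
    by_cases hb : b = 0
    · simp only [hb, map_zero, div_zero]; exact zero_mem _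
    · exact ⟨_, hdiv a b hb⟩
  · rintro l ⟨e, hl⟩
    have he : e ∈ IntermediateField.adjoin k {ε} := htop ▸ IntermediateField.mem_top
    obtain ⟨a, b, rfl⟩ := (IntermediateField.mem_adjoin_simple_iff k e).1 he
    by_cases hb : b = 0
    · refine ⟨0, leadVal_valuation_lt_one ?_⟩
      simpa [hb] using hl
    refine ⟨⟨_, (IntermediateField.mem_adjoin_simple_iff k _).2 ⟨a, b, rfl⟩⟩,
      leadVal_valuation_lt_one ?_⟩
    simpa using hl.sub (hdiv a b hb)
end

section
variable {k R L E : Type*} [Field k] [CommRing R] [Algebra k R] [Field L] [Algebra R L]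
  [Algebra k L] [Field E] [Algebra k E]

/-- Two generators `u`, `w` of `L` form a chart if near `u = w = 0` the elements of `R` have poles
at most along `u = 0`, and some element of `R` does have a pole. -/
structure IsChart (k R : Type*) {L : Type*} [Field k] [CommRing R] [Field L] [Algebra R L]
    [Algebra k L] (u w : L) : Prop where
  adjoin_eq_top : IntermediateField.adjoin k {u, w} = ⊤
  exists_mul (f : R) : ∃ (n : ℕ) (h p : MvPolynomial (Fin 2) k), constantCoeff h ≠ 0 ∧
    algebraMap R L f * u ^ n * aeval ![u, w] h = aeval ![u, w] p
  exists_pole : ∃ (f : R) (h p : MvPolynomial (Fin 2) k), constantCoeff h ≠ 0 ∧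
    constantCoeff p = 0 ∧ algebraMap R L f * aeval ![u, w] p = aeval ![u, w] h

/-- Two `k`-linearly fractional expressions in a transcendental generator generate again. -/
theorem transcendental_and_adjoin_eq_top {ζ ε : E} (hζ : Transcendental k ζ)
    (htop : IntermediateField.adjoin k {ζ} = ⊤) {a b c : k} (hb : b ≠ 0)
    (hε : algebraMap k E c * ε = algebraMap k E a + algebraMap k E b * ζ⁻¹) :
    Transcendental k ε ∧ IntermediateField.adjoin k {ε} = ⊤ := by
  have h0 : ζ ≠ 0 := by rintro rfl; exact hζ isAlgebraic_zero
  have hb' : algebraMap k E b ≠ 0 := by simpa using hb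
  have hζε : ζ = algebraMap k E b * (algebraMap k E c * ε - algebraMap k E a)⁻¹ := by
    rw [hε, add_sub_cancel_left, mul_inv, inv_inv, mul_inv_cancel_left₀ hb']
  constructor
  · intro h
    apply hζ
    rw [hζε]
    exact (isAlgebraic_algebraMap b).mul
      (((isAlgebraic_algebraMap c).mul h).sub (isAlgebraic_algebraMap a)).inv
  · refine adjoin_eq_top_of_mem htop ?_
    rw [hζε]
    exact mul_mem (IntermediateField.algebraMap_mem _ b) (inv_mem (sub_mem (mul_mem
      (IntermediateField.algebraMap_mem _ c) (IntermediateField.mem_adjoin_simple_self k ε))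
      (IntermediateField.algebraMap_mem _ a)))

/-- The weights of an edge of the Newton polygon of `U` along which the leading form of `U` has only
two terms. -/
theorem exists_edge (U : MvPolynomial (Fin 2) k) {m q p : ℕ}
    (hle : ∀ s ∈ U.support, m * q ≤ q * s 0 + p * s 1 + 1)
    (heq : ∃ s ∈ U.support, q * s 0 + p * s 1 + 1 = m * q)
    (hno : ∀ s ∈ U.support, s 1 = 0 → m ≤ s 0) :
    ∃ t ∈ U.support, ∃ d, m = t 0 + d ∧ 0 < d ∧ 0 < t 1 ∧ q * d = p * t 1 + 1 ∧
      (∀ s ∈ U.support, t 1 * m ≤ t 1 * s 0 + d * s 1) ∧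
      ∀ s ∈ U.support, t 1 * s 0 + d * s 1 = t 1 * m → s = t ∨ s = Finsupp.single 0 m := by
  classical
  obtain ⟨r, hr, hrm⟩ := heq
  have hr0 : r 0 < m := by
    by_contra! h
    have := Nat.mul_le_mul_left q h
    nlinarith
  obtain ⟨t, ht, htmax⟩ := (U.support.filter fun s => s 0 < m).exists_max_image
    (fun s => ((m : ℚ) - s 0) / s 1) ⟨r, Finset.mem_filter.2 ⟨hr, hr0⟩⟩
  obtain ⟨ht, htm⟩ := Finset.mem_filter.1 ht
  have hpos (s) (hs : s ∈ U.support) (hsm : s 0 < m) : 0 < s 1 := by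
    by_contra! h
    exact absurd (hno s hs (by omega)) (by omega)
  have ht1 := hpos t ht htm
  obtain ⟨d, hd⟩ := Nat.exists_eq_add_of_lt htm
  have hmin (s) (hs : s ∈ U.support) : t 1 * m ≤ t 1 * s 0 + (d + 1) * s 1 := by
    rcases le_or_gt m (s 0) with h | h
    · nlinarith [Nat.mul_le_mul_left (t 1) h]
    · have h1 := htmax s (Finset.mem_filter.2 ⟨hs, h⟩)
      have h2 := hpos s hs h
      rw [div_le_div_iff₀ (by exact_mod_cast h2) (by exact_mod_cast ht1)] at h1
      have h3 : (m : ℚ) - t 0 = d + 1 := by rw [hd]; push_cast; ring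
      rw [h3] at h1
      have h4 : (t 1 * m : ℚ) ≤ t 1 * s 0 + (d + 1) * s 1 := by linarith
      exact_mod_cast h4
  have hdet : q * (d + 1) = p * t 1 + 1 := by
    apply le_antisymm
    · have := hle t ht
      rw [hd] at this
      nlinarith
    · have h1 := hmin r hr
      have h2 := hpos r hr hr0
      have h3 : q * (t 1 * m) ≤ q * (t 1 * r 0 + (d + 1) * r 1) := Nat.mul_le_mul_left q h1
      have h4 : t 1 * (q * r 0 + p * r 1 + 1) = t 1 * (m * q) := by rw [hrm]
      have h5 : r 1 * (p * t 1) + t 1 ≤ r 1 * (q * (d + 1)) := by nlinarith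
      by_contra! h
      have h6 : q * (d + 1) ≤ p * t 1 := by omega
      have := Nat.mul_le_mul_left (r 1) h6
      omega
  refine ⟨t, ht, d + 1, by omega, by omega, ht1, hdet, hmin, fun s hs hst => ?_⟩
  have h1 : s 1 ≤ t 1 := by
    have h1 := Nat.mul_le_mul_left (t 1) (hle s hs)
    have h2 : q * (t 1 * s 0 + (d + 1) * s 1) = q * (t 1 * m) := by rw [hst]
    have h3 : q * (d + 1) * s 1 = (p * t 1 + 1) * s 1 := by rw [hdet]
    nlinarith
  have hcop : (t 1).Coprime (d + 1) := by
    rw [Nat.coprime_iff_gcd_eq_one]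
    apply Nat.dvd_one.1
    have e1 : (t 1).gcd (d + 1) ∣ p * t 1 + 1 := hdet ▸ (Nat.gcd_dvd_right ..).mul_left q
    exact (Nat.dvd_add_right ((Nat.gcd_dvd_left ..).mul_left p)).1 e1
  have h2 : t 1 ∣ s 1 := by
    refine hcop.dvd_of_dvd_mul_left ?_
    exact (Nat.dvd_add_right (dvd_mul_right ..)).1 (hst ▸ dvd_mul_right ..)
  rcases Nat.eq_zero_or_pos (s 1) with h3 | h3
  · right
    rw [h3, mul_zero, add_zero] at hst
    have h4 := Nat.eq_of_mul_eq_mul_left ht1 hst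
    ext i; fin_cases i
    · simpa using h4
    · simpa using h3
  · left
    have h4 : s 1 = t 1 := le_antisymm h1 (Nat.le_of_dvd h3 h2)
    have h5 : t 1 * (s 0 + (d + 1)) = t 1 * m := by rw [← hst, h4]; ring
    have h6 := Nat.eq_of_mul_eq_mul_left ht1 h5
    ext i; fin_cases i
    · change s 0 = t 0; omega
    · exact h4

variable [IsDomain R] [UniqueFactorizationMonoid R] [IsFractionRing R L] [IsScalarTower k R L]

theorem IsChart.exists_adjoin_eq_top {u w : L} (hc : IsChart k R u w) {F : R} {m : ℕ}
    (huw : AlgebraicIndependent k ![u, w])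
    {h U : MvPolynomial (Fin 2) k} (hh : constantCoeff h ≠ 0)
    (hU : algebraMap R L F * u ^ m * aeval ![u, w] h = aeval ![u, w] U)
    {ζ : E} (hζ : Transcendental k ζ) (hζtop : IntermediateField.adjoin k {ζ} = ⊤) {q p : ℕ}
    (hle : ∀ s ∈ U.support, m * q ≤ q * s 0 + p * s 1 + 1)
    (heq : ∃ s ∈ U.support, q * s 0 + p * s 1 + 1 = m * q)
    (hno : ∀ s ∈ U.support, s 1 = 0 → m ≤ s 0) {x : L}
    (hx : IntermediateField.adjoin (IntermediateField.adjoin k {algebraMap R L F}) {x} = ⊤) :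
    ∃ G : R, IntermediateField.adjoin (IntermediateField.adjoin k {algebraMap R L F})
      {algebraMap R L G} = ⊤ := by
  classical
  obtain ⟨t, ht, d, hd, hd0, hj0, hdet, hmin, hties⟩ := exists_edge U hle heq hno
  have h0 : ζ ≠ 0 := by rintro rfl; exact hζ isAlgebraic_zero
  set j := t 1 with hj
  set a : LaurentSeries E := HahnSeries.single (j : ℤ) (ζ ^ q) with ha
  set b : LaurentSeries E := HahnSeries.single (d : ℤ) (ζ ^ p) with hb
  have hLa : Lead a j (ζ ^ q) := Lead.single ..
  have hLb : Lead b d (ζ ^ p) := Lead.single ..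
  have hab : AlgebraicIndependent k ![a, b] := by
    have ha' : a ∈ IntermediateField.adjoin k {a, b} :=
      IntermediateField.subset_adjoin k _ (by simp)
    have hb' : b ∈ IntermediateField.adjoin k {a, b} :=
      IntermediateField.subset_adjoin k _ (by simp)
    have ha0 : a ≠ 0 := hLa.ne_zero (pow_ne_zero _ h0)
    have hb0 : b ≠ 0 := hLb.ne_zero (pow_ne_zero _ h0)
    refine algebraicIndependent_of_mem_adjoin (algebraicIndependent_single hζ) ?_ ?_
    · have : (HahnSeries.single 1 1 : LaurentSeries E) = b ^ q / a ^ p := by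
        rw [eq_div_iff (pow_ne_zero _ ha0), ha, hb, HahnSeries.single_pow, HahnSeries.single_pow,
          HahnSeries.single_mul_single, one_mul, ← pow_mul, ← pow_mul, mul_comm p q]
        congr 1
        simp only [nsmul_eq_mul]
        zify at hdet; rw [hdet, add_comm]
      rw [this]; exact div_mem (pow_mem hb' _) (pow_mem ha' _)
    · have : (HahnSeries.single 0 ζ : LaurentSeries E) = a ^ d / b ^ j := by
        rw [eq_div_iff (pow_ne_zero _ hb0), ha, hb, HahnSeries.single_pow, HahnSeries.single_pow,
          HahnSeries.single_mul_single, ← pow_mul, ← pow_mul, hdet]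
        congr 1
        · simp only [nsmul_eq_mul]; rw [mul_comm, zero_add]
        · ring
      rw [this]; exact div_mem (pow_mem ha' _) (pow_mem hb' _)
  obtain ⟨χ, hχu, hχw⟩ := exists_algHom_of_adjoin_eq_top huw hc.adjoin_eq_top hab
  have hχ (f : MvPolynomial (Fin 2) k) : χ (aeval ![u, w] f) = aeval ![a, b] f := by
    rw [← hχu, ← hχw, ← AlgHom.comp_apply, comp_aeval]
    congr 2; ext i; fin_cases i <;> rfl
  have hLh (f : MvPolynomial (Fin 2) k) :
      Lead (χ (aeval ![u, w] f)) 0 (algebraMap k E (constantCoeff f)) := by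
    rw [hχ]
    convert Lead.mvPolynomial_aeval hLa hLb f 0 (fun s _ => by positivity) using 1
    rw [Finset.sum_filter, Finset.sum_eq_single 0]
    · simp [constantCoeff_eq]
    · intro s _ hs
      rw [if_neg]
      intro h'
      apply hs
      have : j * s 0 + d * s 1 = 0 := by exact_mod_cast h'
      have h1 : s 0 = 0 := by
        rcases Nat.mul_eq_zero.1 (Nat.eq_zero_of_add_eq_zero_right this) with h | h <;> omega
      have h2 : s 1 = 0 := by
        rcases Nat.mul_eq_zero.1 (Nat.eq_zero_of_add_eq_zero_left this) with h | h <;> omega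
      ext i; fin_cases i
      · exact h1
      · exact h2
    · intro h; simp [notMem_support_iff.1 h]
  have hm0 : t 0 < m := by omega
  have hts : t ≠ Finsupp.single 0 m := by
    intro h
    have : t 0 = m := by rw [h]; simp
    omega
  have hLU : Lead (χ (aeval ![u, w] U)) (j * m : ℕ)
      (algebraMap k E (U.coeff (Finsupp.single 0 m)) * ζ ^ (q * m) +
        algebraMap k E (U.coeff t) * (ζ ^ (q * m) * ζ⁻¹)) := by
    rw [hχ]
    convert Lead.mvPolynomial_aeval hLa hLb U (j * m : ℕ) (fun s hs => by exact_mod_cast hmin s hs)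
      using 1
    have hsub : (U.support.filter fun s => (j : ℤ) * s 0 + d * s 1 = (j * m : ℕ)) ⊆
        {t, Finsupp.single 0 m} := by
      intro s hs
      obtain ⟨hs, hs'⟩ := Finset.mem_filter.1 hs
      simpa using hties s hs (by exact_mod_cast hs')
    rw [Finset.sum_subset hsub, Finset.sum_pair hts, add_comm]
    · congr 2
      · have : q * m = (q * t 0 + p * j) + 1 := by rw [hd, mul_add, hdet]; ring
        rw [this, pow_succ, mul_assoc, mul_inv_cancel₀ h0, mul_one, ← pow_mul, ← pow_mul, pow_add]
      · simp [← pow_mul]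
    · intro s hs hs'
      have h1 : s ∉ U.support := by
        intro hsU
        apply hs'
        refine Finset.mem_filter.2 ⟨hsU, ?_⟩
        rcases Finset.mem_insert.1 hs with rfl | hs
        · rw [hd]; push_cast; ring
        · rw [Finset.mem_singleton.1 hs]; simp
      simp [notMem_support_iff.1 h1]
  have hhE : algebraMap k E (constantCoeff h) ≠ 0 := by simpa using hh
  have hLF : Lead (χ (algebraMap R L F)) 0
      ((algebraMap k E (U.coeff (Finsupp.single 0 m)) + algebraMap k E (U.coeff t) * ζ⁻¹) /
        algebraMap k E (constantCoeff h)) := by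
    have h1 : χ (algebraMap R L F) = χ (aeval ![u, w] U) / (a ^ m * χ (aeval ![u, w] h)) := by
      rw [eq_div_iff (mul_ne_zero (pow_ne_zero _ (hLa.ne_zero (pow_ne_zero _ h0)))
        ((hLh h).ne_zero hhE)), ← hU, map_mul, map_mul, map_pow, hχu, mul_assoc]
    rw [h1]
    convert hLU.div ((hLa.pow m).mul (hLh h)) (mul_ne_zero (pow_ne_zero _ (pow_ne_zero _ h0)) hhE)
      using 1
    · push_cast; ring
    · rw [← pow_mul]; field_simp
  obtain ⟨h1, h2⟩ := transcendental_and_adjoin_eq_top (c := constantCoeff h)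
    (ε := (algebraMap k E (U.coeff (Finsupp.single 0 m)) + algebraMap k E (U.coeff t) * ζ⁻¹) /
        algebraMap k E (constantCoeff h)) hζ hζtop (mem_support_iff.1 ht) (mul_div_cancel₀ _ hhE)
  obtain ⟨f₀, h', p', hh', hp', hf⟩ := hc.exists_pole
  have hh'E : algebraMap k E (constantCoeff h') ≠ 0 := by simpa using hh'
  have hne : χ (aeval ![u, w] p') ≠ 0 := by
    intro h0
    refine (hLh h').ne_zero hh'E ?_
    rw [← hf, map_mul, h0, mul_zero]
  obtain ⟨n, e, he, hn⟩ := Lead.exists_of_ne_zero hne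
  have hpos : 0 < n := by
    have h3 := hLh p'
    rw [hp', map_zero] at h3
    refine lt_of_le_of_ne (hn.le_of_ne_zero he h3) ?_
    rintro rfl
    exact he (hn.unique h3)
  have hLf : Lead (χ (algebraMap R L f₀)) (0 - n) (algebraMap k E (constantCoeff h') / e) := by
    have h3 : χ (algebraMap R L f₀) = χ (aeval ![u, w] h') / χ (aeval ![u, w] p') := by
      rw [eq_div_iff hne, ← hf, map_mul]
    rw [h3]; exact (hLh h').div hn he
  exact exists_adjoin_eq_top_of_lead hLF h1 h2 hLf (by omega) (div_ne_zero hh'E he) hx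

end

section
variable {k : Type*} [Field k]

theorem exists_X_mul_add (p : MvPolynomial (Fin 2) k) :
    ∃ (a : MvPolynomial (Fin 2) k) (g : k[X]), p = X 0 * a + Polynomial.aeval (X 1) g := by
  induction p using MvPolynomial.induction_on with
  | C c => exact ⟨0, Polynomial.C c, by simp [algebraMap_eq]⟩
  | add p q hp hq =>
    obtain ⟨a, g, hp⟩ := hp
    obtain ⟨a', g', hq⟩ := hq
    exact ⟨a + a', g + g', by rw [map_add]; linear_combination hp + hq⟩
  | mul_X p i hp =>
    obtain ⟨a, g, hp⟩ := hp
    fin_cases i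
    · exact ⟨p, 0, by simp [mul_comm]⟩
    · refine ⟨a * X 1, g * Polynomial.X, ?_⟩
      rw [map_mul, Polynomial.aeval_X]
      change p * X 1 = _
      linear_combination X 1 * hp

theorem constantCoeff_aeval_X (g : k[X]) :
    constantCoeff (Polynomial.aeval (X 1 : MvPolynomial (Fin 2) k) g) = g.coeff 0 := by
  rw [← Polynomial.divX_mul_X_add g]
  simp [algebraMap_eq]

theorem exists_of_constantCoeff_eq_zero {p : MvPolynomial (Fin 2) k} (hp : constantCoeff p = 0) :
    ∃ a b, p = X 0 * a + X 1 * b := by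
  obtain ⟨a, g, rfl⟩ := exists_X_mul_add p
  rw [map_add, constantCoeff_aeval_X, map_mul, constantCoeff_X, zero_mul, zero_add] at hp
  refine ⟨a, Polynomial.aeval (X 1) g.divX, ?_⟩
  conv_lhs => rw [← Polynomial.divX_mul_X_add g]
  simp [hp, mul_comm]

theorem exists_apply_zero_eq_zero {p : MvPolynomial (Fin 2) k} (hp : ¬ X 0 ∣ p) :
    ∃ s ∈ p.support, s 0 = 0 := by
  rw [X_dvd_iff_modMonomial_eq_zero] at hp
  obtain ⟨s, hs⟩ := exists_coeff_ne_zero hp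
  by_cases h : Finsupp.single 0 1 ≤ s
  · rw [coeff_modMonomial_of_le _ h] at hs
    exact absurd rfl hs
  · rw [coeff_modMonomial_of_not_le _ h] at hs
    refine ⟨s, mem_support_iff.2 hs, ?_⟩
    by_contra h0
    exact h (Finsupp.single_le_iff.2 (by omega))

end

section
variable {k R L : Type*} [Field k] [CommRing R] [Field L] [Algebra R L]
  [Algebra k L]

theorem exists_fraction_of_adjoin_pair_eq_top {u w : L}
    (htop : IntermediateField.adjoin k {u, w} = ⊤) (l : L) :
    ∃ N M : MvPolynomial (Fin 2) k, aeval ![u, w] M ≠ 0 ∧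
      l * aeval ![u, w] M = aeval ![u, w] N := by
  have hl : l ∈ IntermediateField.adjoin k (Set.range ![u, w]) := by
    have : Set.range ![u, w] = {u, w} := by
      rw [Matrix.range_cons, Matrix.range_cons, Matrix.range_empty, Set.union_empty,
        Set.singleton_union]
    rw [this, htop]; exact IntermediateField.mem_top
  obtain ⟨N, M, rfl⟩ := (IntermediateField.mem_adjoin_range_iff k ![u, w] l).1 hl
  by_cases hM : aeval ![u, w] M = 0
  · exact ⟨0, 1, by simp, by simp [hM]⟩
  · exact ⟨N, M, hM, div_mul_cancel₀ _ hM⟩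

theorem IsChart.substitution {u w z θ : L} (hc : IsChart k R u w) {q p α β : ℕ} (hq : 0 < q)
    (hp : 0 < p) (c : k) (hu : u = z ^ q * θ ^ α) (hw : w = z ^ p * θ ^ β) (hcα : c ≠ 0 ∨ α = 0) :
    IsChart k R z (θ - algebraMap k L c) := by
  let σ : MvPolynomial (Fin 2) k →ₐ[k] MvPolynomial (Fin 2) k :=
    aeval ![X 0 ^ q * (X 1 + C c) ^ α, X 0 ^ p * (X 1 + C c) ^ β]
  have hσ (f : MvPolynomial (Fin 2) k) :
      aeval ![z, θ - algebraMap k L c] (σ f) = aeval ![u, w] f := by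
    rw [← AlgHom.comp_apply, comp_aeval]
    congr 2
    ext i; fin_cases i
    · simp [hu]
    · simp [hw]
  have hσ0 (f : MvPolynomial (Fin 2) k) : constantCoeff (σ f) = constantCoeff f := by
    have : (constantCoeff.comp σ.toRingHom) = constantCoeff (R := k) (σ := Fin 2) := by
      ext i
      · simp [σ]
      · fin_cases i <;> simp [σ, hq.ne', hp.ne']
    exact RingHom.congr_fun this f
  have hz : z ∈ IntermediateField.adjoin k {z, θ - algebraMap k L c} :=
    IntermediateField.subset_adjoin k _ (by simp)
  have hθ : θ ∈ IntermediateField.adjoin k {z, θ - algebraMap k L c} := by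
    have h1 : θ - algebraMap k L c ∈ IntermediateField.adjoin k {z, θ - algebraMap k L c} :=
      IntermediateField.subset_adjoin k _ (by simp)
    simpa using add_mem h1 (IntermediateField.algebraMap_mem _ c)
  refine ⟨?_, fun f => ?_, ?_⟩
  · rw [eq_top_iff, ← hc.adjoin_eq_top, IntermediateField.adjoin_le_iff]
    rintro l (rfl | rfl)
    · rw [hu]; exact mul_mem (pow_mem hz _) (pow_mem hθ _)
    · rw [hw]; exact mul_mem (pow_mem hz _) (pow_mem hθ _)
  · obtain ⟨n, h, g, hh, hf⟩ := hc.exists_mul f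
    refine ⟨q * n, (X 1 + C c) ^ (α * n) * σ h, σ g, ?_, ?_⟩
    · rw [map_mul, hσ0, map_pow, map_add, constantCoeff_X, constantCoeff_C, zero_add]
      refine mul_ne_zero ?_ hh
      rcases hcα with hc | rfl
      · exact pow_ne_zero _ hc
      · simp
    · rw [map_mul, hσ, hσ, ← hf, hu]
      simp
      ring
  · obtain ⟨f, h, g, hh, hg, hf⟩ := hc.exists_pole
    exact ⟨f, σ h, σ g, by rwa [hσ0], by rwa [hσ0], by rw [hσ, hσ, hf]⟩

end

section
variable {k L : Type*} [Field k] [Field L] [Algebra (MvPolynomial (Fin 2) k) L]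
  [IsFractionRing (MvPolynomial (Fin 2) k) L] [Algebra k L]
  [IsScalarTower k (MvPolynomial (Fin 2) k) L]

theorem eq_top_of_X_mem {N : IntermediateField k L}
    (hN : ∀ i, algebraMap (MvPolynomial (Fin 2) k) L (X i) ∈ N) : N = ⊤ := by
  have h (f : MvPolynomial (Fin 2) k) : algebraMap (MvPolynomial (Fin 2) k) L f ∈ N := by
    induction f using MvPolynomial.induction_on with
    | C c =>
      rw [← algebraMap_eq, ← IsScalarTower.algebraMap_apply]
      exact N.algebraMap_mem c
    | add p q hp hq => rw [map_add]; exact add_mem hp hq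
    | mul_X p i hp => rw [map_mul]; exact mul_mem hp (hN i)
  rw [eq_top_iff]
  rintro l -
  obtain ⟨a, b, -, rfl⟩ := IsFractionRing.div_surjective (A := MvPolynomial (Fin 2) k) l
  exact div_mem (h a) (h b)

theorem isChart_inv_X {i j : Fin 2} (hij : i ≠ j) (c : k) :
    IsChart k (MvPolynomial (Fin 2) k) (algebraMap (MvPolynomial (Fin 2) k) L (X i))⁻¹
      (algebraMap (MvPolynomial (Fin 2) k) L (X j) / algebraMap (MvPolynomial (Fin 2) k) L (X i) -
        algebraMap k L c) := by
  set x := algebraMap (MvPolynomial (Fin 2) k) L (X i) with hx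
  set y := algebraMap (MvPolynomial (Fin 2) k) L (X j) with hy
  have hx0 : x ≠ 0 := by
    rw [hx, Ne, FaithfulSMul.algebraMap_eq_zero_iff]; exact X_ne_zero i
  refine ⟨eq_top_of_X_mem fun l => ?_, fun f => ?_, X i, 1, X 0, by simp, by simp, ?_⟩
  · have h1 : x ∈ IntermediateField.adjoin k {x⁻¹, y / x - algebraMap k L c} := by
      have : x⁻¹ ∈ IntermediateField.adjoin k {x⁻¹, y / x - algebraMap k L c} :=
        IntermediateField.subset_adjoin k _ (by simp)
      simpa using inv_mem this
    have h2 : y ∈ IntermediateField.adjoin k {x⁻¹, y / x - algebraMap k L c} := by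
      have : y / x - algebraMap k L c ∈
          IntermediateField.adjoin k {x⁻¹, y / x - algebraMap k L c} :=
        IntermediateField.subset_adjoin k _ (by simp)
      have := mul_mem (add_mem this (IntermediateField.algebraMap_mem _ c)) h1
      rwa [sub_add_cancel, div_mul_cancel₀ _ hx0] at this
    obtain rfl | rfl : l = i ∨ l = j := by omega
    · exact h1
    · exact h2
  · suffices ∃ (n : ℕ) (p : MvPolynomial (Fin 2) k), algebraMap (MvPolynomial (Fin 2) k) L f *
        x⁻¹ ^ n = aeval ![x⁻¹, y / x - algebraMap k L c] p by
      obtain ⟨n, p, h⟩ := this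
      exact ⟨n, 1, p, by simp, by simpa using h⟩
    induction f using MvPolynomial.induction_on with
    | C a =>
      refine ⟨0, C a, ?_⟩
      rw [← algebraMap_eq, ← IsScalarTower.algebraMap_apply, AlgHom.commutes, pow_zero, mul_one]
    | add p q hp hq =>
      obtain ⟨n, p', hp⟩ := hp
      obtain ⟨n', q', hq⟩ := hq
      refine ⟨n + n', X 0 ^ n' * p' + X 0 ^ n * q', ?_⟩
      rw [map_add, map_add, map_mul, map_mul, ← hp, ← hq]
      simp
      ring
    | mul_X p l hp =>
      obtain ⟨n, p', hp⟩ := hp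
      obtain rfl | rfl : l = i ∨ l = j := by omega
      · refine ⟨n + 1, p', ?_⟩
        rw [← hp, map_mul, pow_succ, ← hx]
        field_simp
      · refine ⟨n + 1, p' * (X 1 + C c), ?_⟩
        rw [map_mul (aeval _), ← hp, map_mul, ← hy]
        simp
        ring
  · simp [← hx, hx0]
end

section
variable {k R L E : Type*} [Field k] [CommRing R] [Field L] [Algebra R L]
  [Algebra k L] [Field E] [Algebra k E]

/-- Two Laurent series of orders `g * q` and `g * p` whose leading coefficients satisfy no algebraic
relation homogeneous for the weights `q` and `p`. -/
def IsToric (k : Type*) {E : Type*} [Field k] [Field E] [Algebra k E] (u w : LaurentSeries E)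
    (g q p : ℕ) : Prop :=
  0 < g ∧ 0 < q ∧ q.Coprime p ∧ ∃ eu ew : E, eu ≠ 0 ∧ ew ≠ 0 ∧
    Transcendental k (ew ^ q / eu ^ p) ∧ Lead u (g * q : ℕ) eu ∧ Lead w (g * p : ℕ) ew

theorem AlgebraicIndependent.ne_zero_right {u w : L} (h : AlgebraicIndependent k ![u, w]) :
    w ≠ 0 := by
  have := h.ne_zero 1
  exact this

theorem IsToric.algebraicIndependent {u w : L} {ψ : L →ₐ[k] LaurentSeries E} {g q p : ℕ}
    (h : IsToric k (ψ u) (ψ w) g q p) : AlgebraicIndependent k ![u, w] := by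
  obtain ⟨hg, hq, hqp, eu, ew, hu, hw, htr, hLu, hLw⟩ := h
  refine .of_comp ψ ?_
  have : ψ ∘ ![u, w] = ![ψ u, ψ w] := by ext i; fin_cases i <;> rfl
  exact this ▸ Lead.algebraicIndependent hg hq hqp hu hw htr hLu hLw

theorem map_aeval_pair {B : Type*} [CommRing B] [Algebra k B] (ψ : L →ₐ[k] B) (u w : L)
    (f : MvPolynomial (Fin 2) k) : ψ (aeval ![u, w] f) = aeval ![ψ u, ψ w] f := by
  rw [← AlgHom.comp_apply, comp_aeval]
  congr 2; ext i; fin_cases i <;> rfl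

theorem IsChart.exists_normal_form {u w : L} (hc : IsChart k R u w) {ψ : L →ₐ[k] LaurentSeries E}
    {g q p : ℕ} (h : IsToric k (ψ u) (ψ w) g q p) {F : R} {e : E} (he : e ≠ 0)
    (hF : Lead (ψ (algebraMap R L F)) (-1) e) :
    g = 1 ∧ ∃ (m : ℕ) (h U : MvPolynomial (Fin 2) k), constantCoeff h ≠ 0 ∧
      algebraMap R L F * u ^ m * aeval ![u, w] h = aeval ![u, w] U ∧ ¬ X 0 ∣ U ∧
      (∀ s ∈ U.support, m * q ≤ q * s 0 + p * s 1 + 1) ∧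
      ∃ s ∈ U.support, q * s 0 + p * s 1 + 1 = m * q := by
  have hind := h.algebraicIndependent
  obtain ⟨hg, hq, hqp, eu, ew, hu, hw, htr, hLu, hLw⟩ := h
  have key (f : MvPolynomial (Fin 2) k) (hf : f ≠ 0) := Lead.exists_of_toric (k := k) hg hq hqp
    hu hw htr hLu hLw f hf
  obtain ⟨n, h, f, hh, hf⟩ := hc.exists_mul F
  have hu0 : u ≠ 0 := fun h0 => hLu.ne_zero hu (by rw [h0, map_zero])
  have hF0 : algebraMap R L F ≠ 0 := fun h0 => hF.ne_zero he (by rw [h0, map_zero])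
  have hh0 : h ≠ 0 := by rintro rfl; simp at hh
  have hha : aeval ![u, w] h ≠ 0 := fun h0 => hh0 (hind.eq_zero_of_aeval_eq_zero _ h0)
  have hf0 : f ≠ 0 := by
    rintro rfl
    rw [map_zero] at hf
    exact mul_ne_zero (mul_ne_zero hF0 (pow_ne_zero _ hu0)) hha hf
  obtain ⟨d, U, hU, rfl⟩ := WfDvdMonoid.max_power_factor hf0 (X_prime (i := (0 : Fin 2))).irreducible
  have hU0 : U ≠ 0 := by rintro rfl; simp at hU
  obtain ⟨μ, hμ, hμle, e', he', hLU⟩ := key U hU0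
  obtain ⟨ν, -, hνle, e'', he'', hLh⟩ := key h hh0
  have hν : ν = 0 := by
    have := hνle 0 (mem_support_iff.2 (by rwa [← constantCoeff_eq]))
    simpa using this
  subst hν
  rw [← map_aeval_pair] at hLU hLh
  have h1 := (hF.mul (hLu.pow n)).mul hLh
  have h2 := (hLu.pow d).mul hLU
  rw [← map_pow, ← map_mul, ← map_mul, hf, map_mul (aeval _), map_pow (aeval _), aeval_X,
    Matrix.cons_val_zero] at h1
  rw [← map_pow, ← map_mul] at h2
  have h3 := h1.order_unique (mul_ne_zero (mul_ne_zero he (pow_ne_zero _ hu)) he'') h2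
    (mul_ne_zero (pow_ne_zero _ hu) he')
  have h4 : (g : ℤ) * (n * q - d * q - μ) = 1 := by push_cast at h3; linarith
  have h5 : (g : ℤ) = 1 := Int.eq_one_of_mul_eq_one_right (by omega) h4
  rw [h5, one_mul] at h4
  have h6 : n * q = d * q + μ + 1 := by zify; linarith
  have h7 : d ≤ n := by
    by_contra! h
    nlinarith [Nat.mul_le_mul_right q h.le]
  obtain ⟨m, rfl⟩ := Nat.exists_eq_add_of_le h7
  have h8 : m * q = μ + 1 := by nlinarith
  refine ⟨by exact_mod_cast h5, m, h, U, hh, ?_, hU, ?_, ?_⟩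
  · apply mul_left_cancel₀ (pow_ne_zero d hu0)
    rw [map_mul, map_pow, aeval_X, Matrix.cons_val_zero] at hf
    rw [← hf]; ring
  · intro s hs
    rw [h8]
    exact Nat.succ_le_succ (hμle s hs)
  · obtain ⟨s, hs, hs'⟩ := hμ
    exact ⟨s, hs, by rw [hs', h8]⟩

theorem exists_nat_mul_eq_mul_add_one {q p : ℕ} (hq : 0 < q) (hp : 0 < p) (h : q.Coprime p) :
    ∃ α β : ℕ, q * β = p * α + 1 := by
  rcases Nat.lt_or_ge 1 p with h1 | h1
  · obtain ⟨β, -, hβ⟩ := Nat.exists_mul_mod_eq_one_of_coprime h h1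
    exact ⟨q * β / p, β, by rw [← hβ, Nat.div_add_mod]⟩
  · exact ⟨q - 1, 1, by rw [le_antisymm h1 hp]; omega⟩

theorem exists_toric_chart {ψ : L →ₐ[k] LaurentSeries E}
    (hE : ∀ e : E, e ∉ Set.range (algebraMap k E) → Transcendental k e)
    (hind : ∀ u w : L, IntermediateField.adjoin k {u, w} = ⊤ → AlgebraicIndependent k ![u, w])
    {x : L} {ζ : E} (hζ : ζ ∉ Set.range (algebraMap k E)) (hx : Lead (ψ x) 0 ζ) (n : ℕ)
    {u w : L} (hc : IsChart k R u w) {a b : ℕ} (ha : 0 < a) (hb : 0 < b) {eu ew : E} (hu : eu ≠ 0)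
    (hw : ew ≠ 0) (hLu : Lead (ψ u) a eu) (hLw : Lead (ψ w) b ew) {N M : MvPolynomial (Fin 2) k}
    (hNM : x * aeval ![u, w] M = aeval ![u, w] N) {d : ℕ} {e : E} (he : e ≠ 0)
    (hM : Lead (ψ (aeval ![u, w] M)) d e) (hd : d < n) :
    ∃ (u w : L) (g q p : ℕ), IsChart k R u w ∧ IsToric k (ψ u) (ψ w) g q p ∧ 0 < p := by
  induction n generalizing u w a b eu ew N M d e with
  | zero => omega
  | succ n ih =>
  set g := a.gcd b with hg
  have hg0 : 0 < g := Nat.gcd_pos_of_pos_left _ ha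
  obtain ⟨q, hq⟩ : g ∣ a := Nat.gcd_dvd_left ..
  obtain ⟨p, hp⟩ : g ∣ b := Nat.gcd_dvd_right ..
  have hq0 : 0 < q := Nat.pos_of_ne_zero fun h => by rw [h, mul_zero] at hq; omega
  have hp0 : 0 < p := Nat.pos_of_ne_zero fun h => by rw [h, mul_zero] at hp; omega
  have hqp : q.Coprime p := by
    have h1 : g * q.gcd p = g * 1 := by rw [← Nat.gcd_mul_left, ← hq, ← hp, mul_one]
    exact Nat.eq_of_mul_eq_mul_left hg0 h1
  by_cases hθ : ew ^ q / eu ^ p ∈ Set.range (algebraMap k E)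
  swap
  · exact ⟨u, w, g, q, p, hc, ⟨hg0, hq0, hqp, eu, ew, hu, hw, hE _ hθ, hq ▸ hLu, hp ▸ hLw⟩, hp0⟩
  obtain ⟨c, hθ⟩ := hθ
  have hu0 : u ≠ 0 := fun h0 => hLu.ne_zero hu (by rw [h0, map_zero])
  have hw0 : w ≠ 0 := fun h0 => hLw.ne_zero hw (by rw [h0, map_zero])
  have hc0 : c ≠ 0 := by
    rintro rfl
    rw [map_zero] at hθ
    exact div_ne_zero (pow_ne_zero _ hw) (pow_ne_zero _ hu) hθ.symm
  obtain ⟨α, β, hαβ⟩ := exists_nat_mul_eq_mul_add_one hq0 hp0 hqp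
  set z := u ^ β / w ^ α with hz
  set θ := w ^ q / u ^ p with hθ'
  have hu' : u = z ^ q * θ ^ α := by
    rw [hz, hθ', div_pow, div_pow, ← pow_mul, ← pow_mul, ← pow_mul, ← pow_mul, mul_comm β, hαβ,
      mul_comm q α]
    field_simp
    ring
  have hw' : w = z ^ p * θ ^ β := by
    rw [hz, hθ', div_pow, div_pow, ← pow_mul, ← pow_mul, ← pow_mul, ← pow_mul, hαβ,
      mul_comm p β, mul_comm p α]
    field_simp
    ring
  have hc' := hc.substitution hq0 hp0 c hu' hw' (.inl hc0)
  have hLz : Lead (ψ z) g (eu ^ β / ew ^ α) := by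
    rw [hz, map_div₀, map_pow, map_pow]
    convert (hLu.pow β).div (hLw.pow α) (pow_ne_zero _ hw) using 1
    rw [hq, hp]; push_cast
    have : (q : ℤ) * β = p * α + 1 := by exact_mod_cast hαβ
    linear_combination (-g : ℤ) * this
  have hez : eu ^ β / ew ^ α ≠ 0 := div_ne_zero (pow_ne_zero _ hu) (pow_ne_zero _ hw)
  have hLθ : Lead (ψ (θ - algebraMap k L c)) 0 0 := by
    rw [map_sub, hθ', map_div₀, map_pow, map_pow, AlgHom.commutes, ← sub_self (algebraMap k E c)]
    refine Lead.sub ?_ (Lead.base c)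
    rw [hθ]
    convert (hLw.pow q).div (hLu.pow p) (pow_ne_zero _ hu) using 1
    rw [hq, hp]; push_cast; ring
  have hne := AlgebraicIndependent.ne_zero_right (hind _ _ hc'.adjoin_eq_top)
  obtain ⟨b', e', he', hLθ'⟩ := Lead.exists_of_ne_zero ((map_ne_zero ψ).2 hne)
  have hb' : 0 < b' := by
    refine lt_of_le_of_ne (hLθ'.le_of_ne_zero he' hLθ) ?_
    rintro rfl
    exact he' (hLθ'.unique hLθ)
  lift b' to ℕ using hb'.le
  have hconst (f : MvPolynomial (Fin 2) k) :
      Lead (ψ (aeval ![u, w] f)) 0 (algebraMap k E (constantCoeff f)) := by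
    obtain ⟨f₁, f₂, hf⟩ := exists_of_constantCoeff_eq_zero (p := f - C (constantCoeff f))
      (by simp)
    rw [map_aeval_pair, sub_eq_iff_eq_add.1 hf]
    have := Lead.mvPolynomial_aeval_zero (hLu.of_lt (n' := 0) (by exact_mod_cast ha))
      (hLw.of_lt (n' := 0) (by exact_mod_cast hb)) (X 0 * f₁ + X 1 * f₂ + C (constantCoeff f))
    simpa using this
  have hM0 : constantCoeff M = 0 ∧ constantCoeff N = 0 := by
    have h1 := hx.mul (hconst M)
    rw [← map_mul, hNM, add_zero] at h1
    have h2 := h1.unique (hconst N)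
    have h3 : constantCoeff M = 0 := by
      by_contra h3
      apply hζ
      refine ⟨constantCoeff N / constantCoeff M, ?_⟩
      rw [map_div₀, ← h2, mul_div_cancel_right₀ _ (by simpa using h3)]
    refine ⟨h3, ?_⟩
    rw [h3, map_zero, mul_zero] at h2
    simpa using h2.symm
  have hfac (f : MvPolynomial (Fin 2) k) (hf : constantCoeff f = 0) :
      ∃ f' : MvPolynomial (Fin 2) k, aeval ![u, w] f = z * aeval ![z, θ - algebraMap k L c] f' := by
    obtain ⟨f₁, f₂, hf⟩ := exists_of_constantCoeff_eq_zero hf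
    let σ : MvPolynomial (Fin 2) k →ₐ[k] MvPolynomial (Fin 2) k :=
      aeval ![X 0 ^ q * (X 1 + C c) ^ α, X 0 ^ p * (X 1 + C c) ^ β]
    have hσ (f : MvPolynomial (Fin 2) k) :
        aeval ![z, θ - algebraMap k L c] (σ f) = aeval ![u, w] f := by
      rw [← AlgHom.comp_apply, comp_aeval]
      congr 2
      ext i; fin_cases i
      · simp [← hu']
      · simp [← hw']
    obtain ⟨q', rfl⟩ := Nat.exists_eq_add_of_lt hq0
    obtain ⟨p', rfl⟩ := Nat.exists_eq_add_of_lt hp0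
    refine ⟨X 0 ^ q' * (X 1 + C c) ^ α * σ f₁ + X 0 ^ p' * (X 1 + C c) ^ β * σ f₂, ?_⟩
    rw [← hσ, hf]
    simp [σ]
    ring
  obtain ⟨M', hM'⟩ := hfac M hM0.1
  obtain ⟨N', hN'⟩ := hfac N hM0.2
  have hz0 : z ≠ 0 := fun h0 => hLz.ne_zero hez (by rw [h0, map_zero])
  have hLM' : Lead (ψ (aeval ![z, θ - algebraMap k L c] M')) (d - g) (e / (eu ^ β / ew ^ α)) := by
    have : aeval ![z, θ - algebraMap k L c] M' = aeval ![u, w] M / z := by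
      rw [hM', mul_div_cancel_left₀ _ hz0]
    rw [this, map_div₀]
    exact hM.div hLz hez
  have hdg : g ≤ d := by
    have h1 := Lead.mvPolynomial_aeval_zero (hLz.of_lt (n' := 0) (by exact_mod_cast hg0)) hLθ M'
    rw [← map_aeval_pair] at h1
    have := hLM'.le_of_ne_zero (div_ne_zero he hez) h1
    omega
  refine ih hc' hg0 (by exact_mod_cast hb') hez he' hLz hLθ' (N := N') (M := M') ?_
    (d := d - g) (div_ne_zero he hez) ?_ (by omega)
  · apply mul_left_cancel₀ hz0
    rw [← hN', ← hNM, hM']; ring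
  · convert hLM' using 1
    push_cast [hdg]; ring

end

section
variable {k R L E : Type*} [Field k] [CommRing R] [IsDomain R] [UniqueFactorizationMonoid R]
  [Algebra k R] [Field L] [Algebra R L] [IsFractionRing R L] [Algebra k L] [IsScalarTower k R L]
  [Field E] [Algebra k E]

theorem transcendental_sub_algebraMap {e : E} (he : Transcendental k e) (c : k) :
    Transcendental k (e - algebraMap k E c) := fun h =>
  he (by simpa using h.add (isAlgebraic_algebraMap c))

theorem IsChart.exists_ruled {u w : L} (hc : IsChart k R u w) {ψ : L →ₐ[k] LaurentSeries E}
    {g q p : ℕ} (hp : 0 < p) (h : IsToric k (ψ u) (ψ w) g q p) {F : R} {e : E} (he : e ≠ 0)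
    (hF : Lead (ψ (algebraMap R L F)) (-1) e)
    {ζ : E} (hζ : Transcendental k ζ) (hζtop : IntermediateField.adjoin k {ζ} = ⊤) {x : L}
    (hx : IntermediateField.adjoin (IntermediateField.adjoin k {algebraMap R L F}) {x} = ⊤)
    (hbad : ¬ ∃ G : R, IntermediateField.adjoin (IntermediateField.adjoin k {algebraMap R L F})
      {algebraMap R L G} = ⊤) :
    ∃ (z θ : L) (n : ℕ) (e ε : E), 0 < n ∧ e ≠ 0 ∧ Transcendental k ε ∧ Lead (ψ z) n e ∧
      Lead (ψ θ) 0 ε ∧ ∀ c : k, IsChart k R z (θ - algebraMap k L c) := by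
  obtain ⟨rfl, m, f, U, hf, hFU, -, hle, heq⟩ := hc.exists_normal_form h he hF
  have hno : ¬ ∀ s ∈ U.support, s 1 = 0 → m ≤ s 0 := fun hno =>
    hbad (hc.exists_adjoin_eq_top h.algebraicIndependent hf hFU hζ hζtop hle heq hno hx)
  obtain ⟨-, hq, -, eu, ew, hu, hw, htr, hLu, hLw⟩ := h
  push Not at hno
  obtain ⟨s, hs, hs1, hs0⟩ := hno
  have hq1 : q = 1 := by
    have h1 := hle s hs
    rw [hs1] at h1
    have h2 : (s 0 + 1) * q ≤ m * q := Nat.mul_le_mul_right q hs0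
    nlinarith
  subst hq1
  have hu0 : u ≠ 0 := fun h0 => hLu.ne_zero hu (by rw [h0, map_zero])
  refine ⟨u, w / u ^ p, 1, eu, ew / eu ^ p, one_pos, hu, by simpa using htr, by simpa using hLu, ?_,
    fun c => hc.substitution (q := 1) (p := p) (α := 0) (β := 1) one_pos hp c (by simp)
      (by field_simp) (.inr rfl)⟩
  rw [map_div₀, map_pow]
  convert hLw.div (hLu.pow p) (pow_ne_zero _ hu) using 1
  push_cast; ring

theorem IsChart.exists_eq_one_of_ruled {z θ : L} {c : k}
    (hc : IsChart k R z (θ - algebraMap k L c))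
    {ψ : L →ₐ[k] LaurentSeries E} {n : ℕ} (hn : 0 < n) {ez ε : E} (hez : ez ≠ 0)
    (hε : Transcendental k ε) (hLz : Lead (ψ z) n ez) (hLθ : Lead (ψ θ) 0 ε)
    {F : R} {e : E} (he : e ≠ 0) (hF : Lead (ψ (algebraMap R L F)) (-1) e)
    {ζ : E} (hζ : Transcendental k ζ) (hζtop : IntermediateField.adjoin k {ζ} = ⊤) {x : L}
    (hx : IntermediateField.adjoin (IntermediateField.adjoin k {algebraMap R L F}) {x} = ⊤)
    (hbad : ¬ ∃ G : R, IntermediateField.adjoin (IntermediateField.adjoin k {algebraMap R L F})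
      {algebraMap R L G} = ⊤) :
    n = 1 ∧ ∃ h U : MvPolynomial (Fin 2) k, constantCoeff h ≠ 0 ∧ constantCoeff U ≠ 0 ∧
      algebraMap R L F * z * aeval ![z, θ - algebraMap k L c] h =
        aeval ![z, θ - algebraMap k L c] U := by
  have hLθ' : Lead (ψ (θ - algebraMap k L c)) 0 (ε - algebraMap k E c) := by
    rw [map_sub, AlgHom.commutes]; exact hLθ.sub (Lead.base c)
  have htr := transcendental_sub_algebraMap hε c
  have h : IsToric k (ψ z) (ψ (θ - algebraMap k L c)) n 1 0 :=
    ⟨hn, one_pos, by simp, ez, _, hez, fun (h : ε - algebraMap k E c = 0) => htr (by rw [h]; exact isAlgebraic_zero),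
      by simpa using htr,
      by simpa using hLz, by simpa using hLθ'⟩
  obtain ⟨rfl, m, f, U, hf, hFU, hdvd, hle, heq⟩ := hc.exists_normal_form h he hF
  have hno : ¬ ∀ s ∈ U.support, s 1 = 0 → m ≤ s 0 := fun hno =>
    hbad (hc.exists_adjoin_eq_top h.algebraicIndependent hf hFU hζ hζtop hle heq hno hx)
  push Not at hno
  obtain ⟨s, hs, hs1, hs0⟩ := hno
  obtain ⟨r, hr, hr0⟩ := exists_apply_zero_eq_zero hdvd
  have hm := hle r hr
  rw [hr0] at hm
  obtain rfl : m = 1 := by omega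
  refine ⟨rfl, f, U, hf, ?_, by simpa using hFU⟩
  have hs' : s = 0 := by
    ext i; fin_cases i
    · change s 0 = 0; omega
    · exact hs1
  rw [constantCoeff_eq]
  exact mem_support_iff.1 (hs' ▸ hs)

end

section
variable {k L E : Type*} [Field k] [Field L] [Algebra (MvPolynomial (Fin 2) k) L]
  [IsFractionRing (MvPolynomial (Fin 2) k) L] [Algebra k L]
  [IsScalarTower k (MvPolynomial (Fin 2) k) L] [Field E] [Algebra k E]

theorem algebraicIndependent_of_adjoin_eq_top (u w : L)
    (h : IntermediateField.adjoin k {u, w} = ⊤) : AlgebraicIndependent k ![u, w] := by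
  have h1 : AlgebraicIndependent k fun i => algebraMap (MvPolynomial (Fin 2) k) L (X i) :=
    (MvPolynomial.algebraicIndependent_X (Fin 2) k).map'
      (f := IsScalarTower.toAlgHom k (MvPolynomial (Fin 2) k) L)
      (IsFractionRing.injective (MvPolynomial (Fin 2) k) L)
  have h2 : (fun i => algebraMap (MvPolynomial (Fin 2) k) L (X i)) =
      ![algebraMap (MvPolynomial (Fin 2) k) L (X 0),
        algebraMap (MvPolynomial (Fin 2) k) L (X 1)] := by
    ext i; fin_cases i <;> rfl
  rw [h2] at h1
  exact algebraicIndependent_of_mem_adjoin h1 (h ▸ IntermediateField.mem_top)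
    (h ▸ IntermediateField.mem_top)

theorem exists_sections {ψ : L →ₐ[k] LaurentSeries E}
    (hE : ∀ e : E, e ∉ Set.range (algebraMap k E) → Transcendental k e)
    {F : MvPolynomial (Fin 2) k} {e : E} (he : e ≠ 0)
    (hF : Lead (ψ (algebraMap (MvPolynomial (Fin 2) k) L F)) (-1) e)
    {ζ : E} (hζ : Transcendental k ζ) (hζtop : IntermediateField.adjoin k {ζ} = ⊤) {x : L}
    (hLx : Lead (ψ x) 0 ζ)
    (hx : IntermediateField.adjoin
      (IntermediateField.adjoin k {algebraMap (MvPolynomial (Fin 2) k) L F}) {x} = ⊤)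
    (hbad : ¬ ∃ G : MvPolynomial (Fin 2) k, IntermediateField.adjoin
      (IntermediateField.adjoin k {algebraMap (MvPolynomial (Fin 2) k) L F})
      {algebraMap (MvPolynomial (Fin 2) k) L G} = ⊤) :
    ∃ (z θ : L) (e ε : E), e ≠ 0 ∧ Transcendental k ε ∧ Lead (ψ z) 1 e ∧ Lead (ψ θ) 0 ε ∧
      ∀ c : k, IsChart k (MvPolynomial (Fin 2) k) z (θ - algebraMap k L c) ∧
        ∃ h U : MvPolynomial (Fin 2) k, constantCoeff h ≠ 0 ∧ constantCoeff U ≠ 0 ∧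
          algebraMap _ L F * z * aeval ![z, θ - algebraMap k L c] h =
            aeval ![z, θ - algebraMap k L c] U := by
  suffices ∃ (z θ : L) (n : ℕ) (e ε : E), 0 < n ∧ e ≠ 0 ∧ Transcendental k ε ∧ Lead (ψ z) n e ∧
      Lead (ψ θ) 0 ε ∧ ∀ c : k, IsChart k (MvPolynomial (Fin 2) k) z (θ - algebraMap k L c) by
    obtain ⟨z, θ, n, ez, ε, hn, hez, hε, hLz, hLθ, hc⟩ := this
    have h (c : k) := (hc c).exists_eq_one_of_ruled hn hez hε hLz hLθ he hF hζ hζtop hx hbad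
    obtain ⟨rfl, -⟩ := h 0
    exact ⟨z, θ, ez, ε, hez, hε, by simpa using hLz, hLθ, fun c => ⟨hc c, (h c).2⟩⟩
  have hX (i : Fin 2) : algebraMap (MvPolynomial (Fin 2) k) L (X i) ≠ 0 := by
    rw [Ne, FaithfulSMul.algebraMap_eq_zero_iff]; exact X_ne_zero i
  have hord (i : Fin 2) := Lead.exists_of_ne_zero ((map_ne_zero ψ).2 (hX i))
  choose ν ε hε hL using hord
  obtain ⟨i, j, hij, hνij⟩ : ∃ i j : Fin 2, i ≠ j ∧ ν i ≤ ν j := by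
    rcases le_total (ν 0) (ν 1) with h | h
    · exact ⟨0, 1, by simp, h⟩
    · exact ⟨1, 0, by simp, h⟩
  have hνi : ν i < 0 := by
    by_contra! h0
    have h1 (l : Fin 2) : 0 ≤ ν l := by
      obtain rfl | rfl : l = i ∨ l = j := by omega
      · exact h0
      · exact h0.trans hνij
    have h2 (l : Fin 2) : ∃ e, Lead (ψ (algebraMap (MvPolynomial (Fin 2) k) L (X l))) 0 e := by
      rcases (h1 l).eq_or_lt with h | h
      · exact ⟨_, h ▸ hL l⟩
      · exact ⟨0, (hL l).of_lt h⟩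
    obtain ⟨e0, h20⟩ := h2 0
    obtain ⟨e1, h21⟩ := h2 1
    have h3 := Lead.mvPolynomial_aeval_zero h20 h21 F
    rw [← map_aeval_pair] at h3
    have h4 : aeval ![algebraMap (MvPolynomial (Fin 2) k) L (X 0),
        algebraMap (MvPolynomial (Fin 2) k) L (X 1)] F =
        algebraMap (MvPolynomial (Fin 2) k) L F := by
      have : (aeval ![algebraMap (MvPolynomial (Fin 2) k) L (X 0),
          algebraMap (MvPolynomial (Fin 2) k) L (X 1)] : MvPolynomial (Fin 2) k →ₐ[k] L)
          = IsScalarTower.toAlgHom k (MvPolynomial (Fin 2) k) L := by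
        ext l; fin_cases l <;> simp
      rw [this]; rfl
    rw [h4] at h3
    exact absurd (hF.le_of_ne_zero he h3) (by norm_num)
  obtain ⟨a, ha⟩ : ∃ a : ℕ, ν i = -a := ⟨(-ν i).toNat, by omega⟩
  have ha0 : 0 < a := by omega
  set u := (algebraMap (MvPolynomial (Fin 2) k) L (X i))⁻¹ with hu
  set θ := algebraMap (MvPolynomial (Fin 2) k) L (X j) /
    algebraMap (MvPolynomial (Fin 2) k) L (X i) with hθ
  have hchart (c : k) : IsChart k (MvPolynomial (Fin 2) k) u (θ - algebraMap k L c) :=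
    isChart_inv_X hij c
  have hLu : Lead (ψ u) a (ε i)⁻¹ := by
    rw [hu, map_inv₀]; convert (hL i).inv (hε i) using 1; omega
  have hεi := inv_ne_zero (hε i)
  obtain ⟨ε', hLθ⟩ : ∃ ε', Lead (ψ θ) 0 ε' := by
    have h1 := (hL j).div (hL i) (hε i)
    rw [← map_div₀, ← hθ] at h1
    rcases hνij.eq_or_lt with h | h
    · rw [h, sub_self] at h1; exact ⟨_, h1⟩
    · exact ⟨0, h1.of_lt (by omega)⟩
  by_cases hε' : ε' ∈ Set.range (algebraMap k E)
  swap
  · exact ⟨u, θ, a, _, ε', ha0, hεi, hE _ hε', hLu, hLθ, hchart⟩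
  obtain ⟨c, rfl⟩ := hε'
  have hLw : Lead (ψ (θ - algebraMap k L c)) 0 0 := by
    rw [map_sub, AlgHom.commutes, ← sub_self (algebraMap k E c)]
    exact hLθ.sub (Lead.base c)
  have hne := AlgebraicIndependent.ne_zero_right
    (algebraicIndependent_of_adjoin_eq_top _ _ (hchart c).adjoin_eq_top)
  obtain ⟨b, e', he', hLw'⟩ := Lead.exists_of_ne_zero ((map_ne_zero ψ).2 hne)
  have hb : 0 < b := by
    refine lt_of_le_of_ne (hLw'.le_of_ne_zero he' hLw) ?_
    rintro rfl
    exact he' (hLw'.unique hLw)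
  lift b to ℕ using hb.le
  obtain ⟨N, M, hM, hNM⟩ := exists_fraction_of_adjoin_pair_eq_top (hchart c).adjoin_eq_top x
  obtain ⟨d, eM, heM, hLM⟩ := Lead.exists_of_ne_zero ((map_ne_zero ψ).2 hM)
  have hd : 0 ≤ d := by
    have h1 := Lead.mvPolynomial_aeval_zero (hLu.of_lt (n' := 0) (by exact_mod_cast ha0)) hLw M
    rw [← map_aeval_pair] at h1
    exact hLM.le_of_ne_zero heM h1
  lift d to ℕ using hd
  have hζ' : ζ ∉ Set.range (algebraMap k E) := by
    rintro ⟨c, rfl⟩; exact hζ (isAlgebraic_algebraMap c)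
  obtain ⟨u', w', g, q, p, hc', ht, hp⟩ := exists_toric_chart hE
    algebraicIndependent_of_adjoin_eq_top hζ' hLx (d + 1) (hchart c) ha0 (by exact_mod_cast hb)
    hεi he' hLu hLw' hNM heM hLM (Nat.lt_succ_self d)
  exact hc'.exists_ruled hp ht he hF hζ hζtop hx hbad
end

section
variable {k R S L E : Type*} [Field k] [CommRing R] [CommRing S] [IsDomain S]
    [UniqueFactorizationMonoid S] [IsLocalRing S] [Field L] [Algebra R L] [Algebra S L]
    [IsFractionRing S L] [Algebra k S] [Algebra k L] [IsScalarTower k S L]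
    [Field E] [Algebra k E]

/-- The local ring `S` is the ring of a point lying on a dicritical component `t = 0` of `F` on
which the polar parts of `F` have a simple pole, where `e` is a second parameter. -/
structure IsSection (F : R) (ψ : L →ₐ[k] LaurentSeries E) (t e : S) (et ϑ : E) : Prop where
  not_isUnit_left : ¬ IsUnit t
  not_isUnit_right : ¬ IsUnit e
  exists_decomposition : ∀ s : S, ∃ h a b : S, ∃ g u : k[X], IsUnit h ∧
    s * h = t * a + Polynomial.aeval e g ∧ h = t * b + Polynomial.aeval e u
  mul_eq_one : algebraMap R L F * algebraMap S L t = 1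
  lead_left : Lead (ψ (algebraMap S L t)) 1 et
  left_ne_zero : et ≠ 0
  lead_right : Lead (ψ (algebraMap S L e)) 0 ϑ
  transcendental : Transcendental k ϑ
  exists_lead : ∀ s : S, ∃ e', Lead (ψ (algebraMap S L s)) 0 e'
  exists_pole : ∀ f : R, ∃ (n : ℕ) (s : S), algebraMap R L f * algebraMap S L t ^ n = algebraMap S L s

theorem Lead.zpow {m : LaurentSeries E} {n : ℤ} {e : E} (h : Lead m n e) (he : e ≠ 0) (i : ℤ) :
    Lead (m ^ i) (i * n) (e ^ i) := by
  cases i with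
  | ofNat i => simpa using h.pow i
  | negSucc i =>
    rw [zpow_negSucc, zpow_negSucc]
    convert (h.pow (i + 1)).inv (pow_ne_zero _ he) using 1
    rw [Int.negSucc_eq]; push_cast; ring

theorem valuation_eq_one_of_not_dvd {p a : S} (hp : Prime p) (ha : ¬ p ∣ a) :
    (primeVal L p hp).valuation (algebraMap S L a) = 1 :=
  le_antisymm (((primeVal L p hp).valuation_le_one_iff _).2 (algebraMap_mem_primeVal hp a))
    (not_lt.1 fun h => ha ((valuation_algebraMap_lt_one hp).1 h))

namespace IsSection
variable {F : R} {ψ : L →ₐ[k] LaurentSeries E} {t e : S} {et ϑ : E}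

theorem lead_zero_of_dvd (hs : IsSection F ψ t e et ϑ) {s : S}
    (h : t ∣ s) : Lead (ψ (algebraMap S L s)) 0 0 := by
  obtain ⟨a, rfl⟩ := h
  obtain ⟨a', ha⟩ := hs.exists_lead a
  rw [map_mul, map_mul]
  exact (hs.lead_left.mul ha).of_lt (by norm_num)

theorem lead_eq (hs : IsSection F ψ t e et ϑ) {s h a b : S} {g u : k[X]} {e' : E}
    (hse : Lead (ψ (algebraMap S L s)) 0 e')
    (h1 : s * h = t * a + Polynomial.aeval e g) (h2 : h = t * b + Polynomial.aeval e u) :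
    e' * Polynomial.aeval ϑ u = Polynomial.aeval ϑ g := by
  have hl (s : S) (a : S) (g : k[X]) (hs' : s = t * a + Polynomial.aeval e g) :
      Lead (ψ (algebraMap S L s)) 0 (Polynomial.aeval ϑ g) := by
    have := (hs.lead_zero_of_dvd (dvd_mul_right t a)).add (hs.lead_right.polynomial_aeval g)
    rw [zero_add] at this
    rwa [hs', map_add, map_add, ← Polynomial.aeval_algebraMap_apply, ← Polynomial.aeval_algHom_apply]
  have h3 := hse.mul (hl _ _ _ h2)
  rw [← map_mul, ← map_mul] at h3
  exact h3.unique (hl _ _ _ h1)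

theorem right_ne_zero (hs : IsSection F ψ t e et ϑ) : ϑ ≠ 0 := by
  intro h
  exact hs.transcendental (h ▸ isAlgebraic_zero)

theorem aeval_ne_zero (hs : IsSection F ψ t e et ϑ) {g : k[X]}
    (hg : g ≠ 0) : Polynomial.aeval ϑ g ≠ 0 := fun h =>
  hg (transcendental_iff.1 hs.transcendental g h)

theorem dvd_of_lead_zero (hs : IsSection F ψ t e et ϑ) {s : S}
    (h : Lead (ψ (algebraMap S L s)) 0 0) : t ∣ s := by
  obtain ⟨u, a, b, g, v, hu, h1, h2⟩ := hs.exists_decomposition s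
  have h3 := hs.lead_eq h h1 h2
  rw [zero_mul] at h3
  have h4 : g = 0 := by
    by_contra hg
    exact hs.aeval_ne_zero hg h3.symm
  rw [h4, map_zero, add_zero] at h1
  exact hu.dvd_mul_right.1 ⟨a, h1⟩

theorem left_mem_ne_zero (hs : IsSection F ψ t e et ϑ) : t ≠ 0 := by
  rintro h
  have := hs.mul_eq_one
  rw [h, map_zero, mul_zero] at this
  exact zero_ne_one this

theorem not_right_dvd (hs : IsSection F ψ t e et ϑ) : ¬ e ∣ t := by
  rintro ⟨b, hb⟩
  obtain ⟨b', hb'⟩ := hs.exists_lead b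
  have h1 := hs.lead_right.mul hb'
  rw [← map_mul, ← map_mul, ← hb] at h1
  have h2 := h1.unique (hs.lead_zero_of_dvd dvd_rfl)
  rw [mul_eq_zero, or_iff_right hs.right_ne_zero] at h2
  subst h2
  obtain ⟨c, rfl⟩ := hs.dvd_of_lead_zero hb'
  refine hs.not_isUnit_right (IsUnit.of_mul_eq_one c (mul_left_cancel₀ hs.left_mem_ne_zero ?_))
  linear_combination -hb

theorem not_left_dvd (hs : IsSection F ψ t e et ϑ) : ¬ t ∣ e := fun h =>
  hs.right_ne_zero (hs.lead_right.unique (hs.lead_zero_of_dvd h))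

theorem isUnit_aeval {s : S} (hs' : ¬ IsUnit s) {u : k[X]}
    (hu : ¬ Polynomial.X ∣ u) :
    IsUnit (Polynomial.aeval s u) := by
  rw [Polynomial.X_dvd_iff] at hu
  rw [aeval_eq_mul_divX, isUnit_mul_add hs']
  exact (isUnit_iff_ne_zero.2 hu).map _

theorem isUnit_iff (hs : IsSection F ψ t e et ϑ) {h a : S} {u : k[X]}
    (h2 : h = t * a + Polynomial.aeval e u) :
    IsUnit h ↔ ¬ Polynomial.X ∣ u := by
  rw [h2, isUnit_mul_add hs.not_isUnit_left, aeval_eq_mul_divX, isUnit_mul_add hs.not_isUnit_right,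
    Polynomial.X_dvd_iff]
  refine ⟨fun h h0 => ?_, fun h => (isUnit_iff_ne_zero.2 h).map _⟩
  rw [h0, map_zero] at h
  exact not_isUnit_zero h

theorem mem_span (hs : IsSection F ψ t e et ϑ) {s : S} (h : ¬ IsUnit s) : s ∈ Ideal.span {t, e} := by
  obtain ⟨u, a, b, g, v, hu, h1, h2⟩ := hs.exists_decomposition s
  have h3 : Polynomial.X ∣ g := by
    by_contra h3
    rw [← hs.isUnit_iff h1] at h3
    exact h (isUnit_of_mul_isUnit_left h3)
  obtain ⟨g, rfl⟩ := h3
  obtain ⟨w, rfl⟩ := hu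
  refine Ideal.mem_span_pair.2 ⟨↑w⁻¹ * a, ↑w⁻¹ * Polynomial.aeval e g, ?_⟩
  rw [map_mul, Polynomial.aeval_X] at h1
  linear_combination -(↑w⁻¹ : S) * h1 + s * w.inv_mul

theorem prime (hs : IsSection F ψ t e et ϑ) : Prime t := prime_of_span_eq hs.not_isUnit_left (fun _ => hs.mem_span)
  hs.not_right_dvd

theorem injective (hs : IsSection F ψ t e et ϑ) : Function.Injective (Polynomial.aeval (R := k) t) := by
  rw [injective_iff_map_eq_zero]
  intro a ha
  by_contra h
  obtain ⟨n, v, hv, rfl⟩ := WfDvdMonoid.max_power_factor h Polynomial.irreducible_X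
  rw [map_mul, map_pow, Polynomial.aeval_X, mul_eq_zero] at ha
  rcases ha with ha | ha
  · exact hs.left_mem_ne_zero (eq_zero_of_pow_eq_zero ha)
  · have := IsSection.isUnit_aeval hs.not_isUnit_left hv
    rw [ha] at this
    exact not_isUnit_zero this

theorem horizontal (hs : IsSection F ψ t e et ϑ) {p : S} (hp : Prime p)
    (hpt : ¬ p ∣ t) : Horizontal k t p := by
  intro b hb hd
  obtain ⟨n, v, hv, rfl⟩ := WfDvdMonoid.max_power_factor hb Polynomial.irreducible_X
  rw [map_mul, map_pow, Polynomial.aeval_X] at hd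
  rcases hp.dvd_or_dvd hd with h | h
  · exact hpt (hp.dvd_of_dvd_pow h)
  · exact hp.not_isUnit (isUnit_of_dvd_unit h (IsSection.isUnit_aeval hs.not_isUnit_left hv))

theorem eq_inv (hs : IsSection F ψ t e et ϑ) : algebraMap S L t = (algebraMap R L F)⁻¹ :=
  eq_inv_of_mul_eq_one_right hs.mul_eq_one

theorem adjoin_eq (hs : IsSection F ψ t e et ϑ) : IntermediateField.adjoin k {algebraMap R L F} =
    IntermediateField.adjoin k {algebraMap S L t} := by
  apply le_antisymm <;> rw [IntermediateField.adjoin_simple_le_iff]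
  · rw [← inv_inv (algebraMap R L F), ← hs.eq_inv]
    exact inv_mem (IntermediateField.mem_adjoin_simple_self k _)
  · rw [hs.eq_inv]
    exact inv_mem (IntermediateField.mem_adjoin_simple_self k _)

theorem exists_zpow_mul (hs : IsSection F ψ t e et ϑ) {f : R}
    (hf : algebraMap R L f ≠ 0) : ∃ (n : ℤ) (s : S), ¬ t ∣ s ∧
    algebraMap R L f = algebraMap S L t ^ n * algebraMap S L s := by
  have ht0 : algebraMap S L t ≠ 0 := by simpa using hs.left_mem_ne_zero
  obtain ⟨m, s, h⟩ := hs.exists_pole f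
  have hs0 : s ≠ 0 := by
    rintro rfl
    rw [map_zero, mul_eq_zero] at h
    exact h.elim hf (pow_ne_zero _ ht0)
  obtain ⟨j, s', hs', rfl⟩ := WfDvdMonoid.max_power_factor hs0 hs.prime.irreducible
  refine ⟨j - m, s', hs', ?_⟩
  rw [zpow_sub₀ ht0, zpow_natCast, zpow_natCast, div_mul_eq_mul_div, eq_div_iff (pow_ne_zero _ ht0),
    h, map_mul, map_pow]

theorem lead_ne_zero (hs : IsSection F ψ t e et ϑ) {s : S} {e' : E}
    (hse : Lead (ψ (algebraMap S L s)) 0 e') (h : ¬ t ∣ s) :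
    e' ≠ 0 := by
  rintro rfl
  exact h (hs.dvd_of_lead_zero hse)

theorem exists_eq_algebraMap (hs : IsSection F ψ t e et ϑ) {K : IntermediateField k L}
    (hK : K = IntermediateField.adjoin k {algebraMap R L F}) {y : L}
    (hy : IntermediateField.adjoin K {y} = ⊤) {l : E} (hl : l ≠ 0) (hyl : Lead (ψ y) 0 l)
    (O : ValuationSubring E) (hO : ∀ c : k, algebraMap k E c ∈ O) (hϑ : O.valuation ϑ < 1)
    (hlO : O.valuation l < 1) : ∃ ξ : S, y = algebraMap S L ξ ∧ ¬ t ∣ ξ ∧ Prime ξ := by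
  obtain ⟨N, M, hNM, hyNM⟩ : ∃ N M : S, IsRelPrime N M ∧
      algebraMap S L N = y * algebraMap S L M := by
    obtain ⟨N, M, hNM, hyNM⟩ := IsFractionRing.exists_reduced_fraction (A := S) y
    exact ⟨N, M, hNM, IsLocalization.eq_mk'_iff_mul_eq.1 hyNM.symm |>.symm⟩
  obtain ⟨n, hn⟩ := hs.exists_lead N
  obtain ⟨m, hm⟩ := hs.exists_lead M
  have hnm : n = l * m := by
    have h1 := hyl.mul hm
    rw [← map_mul, ← hyNM, zero_add] at h1
    exact hn.unique h1
  have hm0 : m ≠ 0 := by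
    rintro rfl
    rw [mul_zero] at hnm
    subst hnm
    exact hs.not_isUnit_left (hNM (hs.dvd_of_lead_zero hn) (hs.dvd_of_lead_zero hm))
  have hn0 : n ≠ 0 := hnm ▸ mul_ne_zero hl hm0
  have htN : ¬ t ∣ N := fun h => hn0 (hn.unique (hs.lead_zero_of_dvd h))
  obtain ⟨h, a, b, g, u, hh, h1, h2⟩ := hs.exists_decomposition N
  obtain ⟨h', a', b', g', u', hh', h1', h2'⟩ := hs.exists_decomposition M
  have hϑO := valuation_lt_one_mem O hϑ
  have hv {h a : S} {u : k[X]} (hu : IsUnit h) (hh : h = t * a + Polynomial.aeval e u) :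
      O.valuation (Polynomial.aeval ϑ u) = 1 := by
    rw [hs.isUnit_iff hh, Polynomial.X_dvd_iff] at hu
    exact valuation_aeval_eq_one O hO hϑ hu
  have hgn : O.valuation n = O.valuation (Polynomial.aeval ϑ g) := by
    rw [← hs.lead_eq hn h1 h2, map_mul, hv hh h2, mul_one]
  have hgm : O.valuation m = O.valuation (Polynomial.aeval ϑ g') := by
    rw [← hs.lead_eq hm h1' h2', map_mul, hv hh' h2', mul_one]
  have hm1 : O.valuation m ≤ 1 := by
    rw [hgm]
    exact (O.valuation_le_one_iff _).2 (valuation_aeval_le_one O hO hϑO g')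
  have hnm' : O.valuation n < O.valuation m := by
    rw [hnm, map_mul]
    exact mul_lt_of_lt_one_left (zero_lt_iff.2 ((map_ne_zero _).2 hm0)) hlO
  have hXg : Polynomial.X ∣ g := by
    by_contra hg
    rw [Polynomial.X_dvd_iff] at hg
    rw [hgn, valuation_aeval_eq_one O hO hϑ hg] at hnm'
    exact absurd hnm' (not_lt.2 hm1)
  obtain ⟨g, rfl⟩ := hXg
  obtain ⟨w, rfl⟩ := hh
  have htan : N ∉ Ideal.span {t, e ^ 2} := by
    have := not_tangent (k := k) (L := L) (τ := t) (e := e) (N := N) (y := y)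
      (π := Polynomial.X) Polynomial.irreducible_X hs.injective
      (by simpa using hs.prime) (by simpa using hs.not_left_dvd) (by
        intro f hf
        by_contra hX
        have h3 := IsSection.isUnit_aeval hs.not_isUnit_left hX
        rw [Polynomial.aeval_X] at hf
        have h4 : Ideal.span {t, e} ≤ IsLocalRing.maximalIdeal S := by
          rw [Ideal.span_le]
          rintro x (rfl | rfl)
          · exact (IsLocalRing.mem_maximalIdeal _).2 hs.not_isUnit_left
          · exact (IsLocalRing.mem_maximalIdeal _).2 hs.not_isUnit_right
        exact (IsLocalRing.mem_maximalIdeal _).1 (h4 hf) h3) (by simpa using htN)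
      (by subst hK; rw [← hs.adjoin_eq]; exact hy) (by
        intro p hp _ hpN
        have hpM : ¬ p ∣ M := fun hpM => hp.not_isUnit (hNM hpN hpM)
        rw [hyNM, map_mul, valuation_eq_one_of_not_dvd hp hpM, mul_one])
    simpa using this
  have hXg2 : ¬ Polynomial.X ∣ g := by
    rintro ⟨g, rfl⟩
    apply htan
    refine Ideal.mem_span_pair.2 ⟨↑w⁻¹ * a, ↑w⁻¹ * Polynomial.aeval e g, ?_⟩
    rw [map_mul, map_mul, Polynomial.aeval_X] at h1
    linear_combination -(↑w⁻¹ : S) * h1 + N * w.inv_mul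
  have hXg' : ¬ Polynomial.X ∣ g' := by
    rintro ⟨g', rfl⟩
    rw [map_mul, Polynomial.aeval_X, map_mul] at hgm hgn
    rw [Polynomial.X_dvd_iff] at hXg2
    rw [valuation_aeval_eq_one O hO hϑ hXg2, mul_one] at hgn
    rw [hgm, hgn] at hnm'
    exact absurd hnm' (not_lt.2 (mul_le_of_le_one_right' 
      ((O.valuation_le_one_iff _).2 (valuation_aeval_le_one O hO hϑO g'))))
  have hM : IsUnit M := isUnit_of_mul_isUnit_left ((hs.isUnit_iff h1').2 hXg')
  obtain ⟨M, rfl⟩ := hM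
  have hNp : Prime N := by
    refine prime_of_span_eq (e := t) ?_ ?_ htN
    · intro hN
      have := (hs.isUnit_iff h1).1 (hN.mul w.isUnit)
      exact this (dvd_mul_right _ _)
    · intro s hs'
      obtain ⟨c, d, rfl⟩ := Ideal.mem_span_pair.1 (hs.mem_span hs')
      obtain ⟨v, hv⟩ := IsSection.isUnit_aeval hs.not_isUnit_right hXg2
      rw [map_mul, Polynomial.aeval_X, ← hv] at h1
      refine Ideal.mem_span_pair.2 ⟨d * ↑v⁻¹ * w, c - d * ↑v⁻¹ * a, ?_⟩
      linear_combination d * (↑v⁻¹ : S) * h1 + d * e * v.mul_inv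
  have hass : Associated N (N * ↑M⁻¹) := ⟨M⁻¹, rfl⟩
  refine ⟨N * ↑M⁻¹, ?_, fun h => htN (h.trans hass.symm.dvd), hass.prime hNp⟩
  rw [map_mul, hyNM, mul_assoc, ← map_mul, M.mul_inv, map_one, mul_one]
end IsSection
end

section
variable {k R S L E : Type*} [Field k] [CommRing R] [IsDomain R] [UniqueFactorizationMonoid R]
    [CommRing S] [IsDomain S]
    [UniqueFactorizationMonoid S] [IsLocalRing S] [Field L] [Algebra R L] [Algebra S L]
    [IsFractionRing R L] [IsFractionRing S L] [Algebra k S] [Algebra k R] [Algebra k L]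
    [IsScalarTower k S L] [IsScalarTower k R L]
    [Field E] [Algebra k E]

namespace IsSection
variable {F : R} {ψ : L →ₐ[k] LaurentSeries E} {t e : S} {et ϑ : E}

theorem adjoin_le (hs : IsSection F ψ t e et ϑ) {p : S} (hp : Prime p) (hpt : ¬ p ∣ t)
    {c : L} (hc : c ∈ IntermediateField.adjoin k {algebraMap R L F}) : c ∈ primeVal L p hp :=
  adjoin_le_primeVal hp (hs.horizontal hp hpt) (hs.adjoin_eq ▸ hc)

theorem algebraMap_mem (hs : IsSection F ψ t e et ϑ) {p : S} (hp : Prime p) (hpt : ¬ p ∣ t)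
    (f : R) :
    algebraMap R L f ∈ primeVal L p hp := by
  have ht0 : algebraMap S L t ≠ 0 := by simpa using hs.left_mem_ne_zero
  obtain ⟨n, s, h⟩ := hs.exists_pole f
  rw [← eq_div_iff (pow_ne_zero _ ht0)] at h
  rw [h, div_eq_mul_inv, ← inv_pow]
  exact mul_mem (algebraMap_mem_primeVal hp _) (pow_mem (inv_algebraMap_mem_primeVal hp hpt) _)

theorem valuation_lt_one (hs : IsSection F ψ t e et ϑ) {P : R} (hP : Prime P)
    (hres : ∀ f : R, ∃ q : k[X], P ∣ f - Polynomial.aeval F q) {p : S} (hp : Prime p)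
    (hpt : ¬ p ∣ t) (hpP : (primeVal L p hp).valuation (algebraMap R L P) < 1) {l : L}
    (hl : (primeVal L P hP).valuation l < 1) : (primeVal L p hp).valuation l < 1 := by
  have hmul (c : R) : (primeVal L p hp).valuation (algebraMap R L (P * c)) < 1 := by
    rw [map_mul, map_mul]
    exact mul_lt_one_of_lt_of_le hpP
      (((primeVal L p hp).valuation_le_one_iff _).2 (hs.algebraMap_mem hp hpt c))
  obtain ⟨a, b, hb, h⟩ := (mem_primeVal hP).1 (valuation_lt_one_mem _ hl)
  have hPa : P ∣ a := by
    rw [← valuation_algebraMap_lt_one (L := L) hP, ← h, map_mul]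
    exact mul_lt_one_of_lt_of_le hl (((primeVal L P hP).valuation_le_one_iff _).2
      (algebraMap_mem_primeVal hP b))
  obtain ⟨a, rfl⟩ := hPa
  obtain ⟨q, c, hc⟩ := hres b
  have hq : algebraMap R L (Polynomial.aeval F q) ≠ 0 := by
    rw [Ne, map_eq_zero_iff _ (IsFractionRing.injective R L)]
    intro h0
    rw [h0, sub_zero] at hc
    exact hb ⟨c, hc⟩
  have hq1 : (primeVal L p hp).valuation (algebraMap R L (Polynomial.aeval F q)) = 1 :=
    valuation_algebraMap_eq_one (K := IntermediateField.adjoin k {algebraMap R L F}) _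
      (fun c => hs.adjoin_le hp hpt c.2) (c := ⟨_, aeval_mem_adjoin F q⟩)
      (fun h0 => hq (congrArg Subtype.val h0))
  have hb1 : (primeVal L p hp).valuation (algebraMap R L b) = 1 := by
    have h1 := (hmul c).trans_eq hq1.symm
    rw [← sub_add_cancel b (Polynomial.aeval F q), hc, map_add, Valuation.map_add_eq_of_lt_right _ h1,
      hq1]
  have h1 := hmul a
  rwa [← h, map_mul, hb1, mul_one] at h1

theorem primeVal_eq (hs : IsSection F ψ t e et ϑ) {K : IntermediateField k L}
    (hK : K = IntermediateField.adjoin k {algebraMap R L F}) {y : L}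
    (hy : IntermediateField.adjoin K {y} = ⊤) {P : R} (hP : Prime P) (hor : Horizontal k F P)
    (hyP : (primeVal L P hP).valuation y < 1) {ξ : S} (hξ : Prime ξ) (htξ : ¬ t ∣ ξ)
    (hyξ : y = algebraMap S L ξ) : primeVal L P hP = primeVal L ξ hξ := by
  refine eq_of_valuation_lt_one (K := K) (y := y) _ _ (fun c => ?_) (fun c => ?_) hyP ?_ hy
  · exact adjoin_le_primeVal hP hor (hK ▸ c.2)
  · exact hs.adjoin_le hξ (fun h => htξ (hξ.irreducible.associated_of_dvd hs.prime.irreducible h).symm.dvd)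
      (hK ▸ c.2)
  · rw [hyξ, valuation_algebraMap_lt_one]

theorem not_dvd_left (hs : IsSection F ψ t e et ϑ) {p : S} (hp : Prime p)
    (hpt : ¬ t ∣ p) : ¬ p ∣ t :=
  fun h => hpt (hp.irreducible.associated_of_dvd hs.prime.irreducible h).symm.dvd

theorem valuation_left_eq_one (hs : IsSection F ψ t e et ϑ) {p : S} (hp : Prime p) (hpt : ¬ t ∣ p) :
    (primeVal L p hp).valuation (algebraMap S L t) = 1 :=
  valuation_eq_one_of_not_dvd hp (hs.not_dvd_left hp hpt)

theorem exists_isUnit_of_zero (hs : IsSection F ψ t e et ϑ) {K : IntermediateField k L}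
    (hK : K = IntermediateField.adjoin k {algebraMap R L F}) {x : L}
    (hx : IntermediateField.adjoin K {x} = ⊤) {P : R} (hP : Prime P)
    (hres : ∀ f : R, ∃ q : k[X], P ∣ f - Polynomial.aeval F q) (hor : Horizontal k F P)
    (hxP : (primeVal L P hP).valuation x < 1) {ξ : S} (hξ : Prime ξ) (htξ : ¬ t ∣ ξ)
    (hxξ : x = algebraMap S L ξ) : ∃ (n : ℤ) (h : S), IsUnit h ∧
      algebraMap R L P = algebraMap S L t ^ n * (x * algebraMap S L h) := by
  have hP0 : algebraMap R L P ≠ 0 := by simpa using hP.ne_zero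
  have ht0 : algebraMap S L t ≠ 0 := by simpa using hs.left_mem_ne_zero
  have hξ0 : algebraMap S L ξ ≠ 0 := by simpa using hξ.ne_zero
  obtain ⟨n, s, hts, h⟩ := hs.exists_zpow_mul hP0
  have hV := hs.primeVal_eq hK hx hP hor hxP hξ htξ hxξ
  have hvt (p : S) (hp : Prime p) (hpt : ¬ t ∣ p) :
      (primeVal L p hp).valuation (algebraMap R L P) =
      (primeVal L p hp).valuation (algebraMap S L s) := by
    rw [h, map_mul, map_zpow₀, hs.valuation_left_eq_one hp hpt, one_zpow, one_mul]
  have hξs : ξ ∣ s := by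
    rw [← valuation_algebraMap_lt_one (L := L) hξ, ← hvt ξ hξ htξ, ← hV,
      valuation_algebraMap_lt_one]
  obtain ⟨s, rfl⟩ := hξs
  refine ⟨n, s, ?_, by rw [h, map_mul, hxξ]⟩
  have hξs : ¬ ξ ∣ s := by
    intro hξs
    obtain ⟨a, b, hb, hab⟩ := (mem_primeVal hP).1 (valuation_lt_one_mem _ hxP)
    have hPa : P ∣ a := by
      rw [← valuation_algebraMap_lt_one (L := L) hP, ← hab, map_mul]
      exact mul_lt_one_of_lt_of_le hxP (((primeVal L P hP).valuation_le_one_iff _).2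
        (algebraMap_mem_primeVal hP b))
    obtain ⟨a, rfl⟩ := hPa
    have h1 : algebraMap R L b = algebraMap S L t ^ n * algebraMap S L s * algebraMap R L a := by
      apply mul_left_cancel₀ hξ0
      rw [← hxξ, hab, map_mul, h, map_mul, hxξ]; ring
    apply hb
    rw [← valuation_algebraMap_lt_one (L := L) hP, h1, hV]
    rw [map_mul, map_mul, map_zpow₀, hs.valuation_left_eq_one hξ htξ, one_zpow, one_mul]
    exact mul_lt_one_of_lt_of_le ((valuation_algebraMap_lt_one hξ).2 hξs)
      (((primeVal L ξ hξ).valuation_le_one_iff _).2 (hV ▸ algebraMap_mem_primeVal hP a))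
  by_contra hu
  have hs0 : s ≠ 0 := by rintro rfl; exact hξs (dvd_zero _)
  obtain ⟨p, hpi, hps⟩ := WfDvdMonoid.exists_irreducible_factor hu hs0
  have hp := UniqueFactorizationMonoid.irreducible_iff_prime.1 hpi
  have htp : ¬ t ∣ p := fun h => hts ((h.trans hps).mul_left _)
  have h2 := hs.valuation_lt_one hP hres hp (hs.not_dvd_left hp htp) (by
    rw [hvt p hp htp, valuation_algebraMap_lt_one]
    exact hps.mul_left _) hxP
  rw [hxξ, valuation_algebraMap_lt_one] at h2
  exact hξs ((hp.irreducible.associated_of_dvd hξ.irreducible h2).symm.dvd.trans hps)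

theorem exists_isUnit_of_pole (hs : IsSection F ψ t e et ϑ) {x : L} {P : R} (hP : Prime P)
    (hres : ∀ f : R, ∃ q : k[X], P ∣ f - Polynomial.aeval F q)
    (hxP : (primeVal L P hP).valuation x < 1) (hx0 : x ≠ 0) {ξ : S}
    (hxξ : x⁻¹ = algebraMap S L ξ) : ∃ (n : ℤ) (h : S), IsUnit h ∧
      algebraMap R L P = algebraMap S L t ^ n * algebraMap S L h := by
  have hP0 : algebraMap R L P ≠ 0 := by simpa using hP.ne_zero
  obtain ⟨n, s, hts, h⟩ := hs.exists_zpow_mul hP0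
  refine ⟨n, s, ?_, h⟩
  have hs0 : s ≠ 0 := by rintro rfl; exact hts (dvd_zero _)
  by_contra hu
  obtain ⟨p, hpi, hps⟩ := WfDvdMonoid.exists_irreducible_factor hu hs0
  have hp := UniqueFactorizationMonoid.irreducible_iff_prime.1 hpi
  have htp : ¬ t ∣ p := fun h => hts (h.trans hps)
  have h2 := hs.valuation_lt_one hP hres hp (hs.not_dvd_left hp htp) (by
    rw [h, map_mul, map_zpow₀, hs.valuation_left_eq_one hp htp, one_zpow, one_mul,
      valuation_algebraMap_lt_one]
    exact hps) hxP
  have h3 : (primeVal L p hp).valuation x⁻¹ ≤ 1 := by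
    rw [hxξ]
    exact ((primeVal L p hp).valuation_le_one_iff _).2 (algebraMap_mem_primeVal hp ξ)
  have h4 := mul_lt_one_of_lt_of_le h2 h3
  rw [← map_mul, mul_inv_cancel₀ hx0, map_one] at h4
  exact lt_irrefl _ h4

theorem nonpos_of_pole (hs : IsSection F ψ t e et ϑ) {K : IntermediateField k L}
    (hK : K = IntermediateField.adjoin k {algebraMap R L F}) {y : L}
    (hy : IntermediateField.adjoin K {y} = ⊤) {P Q : R} (hQ : Prime Q)
    (hres : ∀ f : R, ∃ q : k[X], Q ∣ f - Polynomial.aeval F q) (hor : Horizontal k F Q)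
    (hQP : ¬ Q ∣ P)
    (hyQ : (primeVal L Q hQ).valuation y < 1) {ξ : S} (hξ : Prime ξ) (htξ : ¬ t ∣ ξ)
    (hyξ : y = algebraMap S L ξ) {n : ℤ} {h : S}
    (hP : algebraMap R L P = algebraMap S L t ^ n * algebraMap S L h) : n ≤ 0 := by
  by_contra! hn
  lift n to ℕ using hn.le
  have ht0 : algebraMap S L t ≠ 0 := by simpa using hs.left_mem_ne_zero
  obtain ⟨a, ha⟩ := hres P
  have ha0 : a ≠ 0 := by
    rintro rfl
    rw [map_zero, sub_zero] at ha
    exact hQP ha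
  have h1 : ξ ∣ t ^ (n + a.natDegree) * h - Polynomial.aeval t a.reverse := by
    rw [← valuation_algebraMap_lt_one (L := L) hξ]
    have h2 : algebraMap S L (t ^ (n + a.natDegree) * h - Polynomial.aeval t a.reverse) =
        algebraMap R L (P - Polynomial.aeval F a) * algebraMap S L t ^ a.natDegree := by
      rw [map_sub, map_sub, hP, ← Polynomial.aeval_algebraMap_apply,
        ← Polynomial.aeval_algebraMap_apply, ← aeval_eq_reverse ht0, hs.eq_inv, inv_inv,
        ← hs.eq_inv, map_mul, map_pow, zpow_natCast]
      ring
    rw [h2, map_mul, map_pow, hs.valuation_left_eq_one hξ htξ, one_pow, mul_one,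
      ← hs.primeVal_eq hK hy hQ hor hyQ hξ htξ hyξ, valuation_algebraMap_lt_one]
    exact ha
  obtain ⟨m, hm⟩ : ∃ m, n + a.natDegree = m + 1 := ⟨n + a.natDegree - 1, by omega⟩
  have h3 : IsUnit (Polynomial.aeval t a.reverse) := IsSection.isUnit_aeval hs.not_isUnit_left (by
    rw [Polynomial.X_dvd_iff, Polynomial.coeff_zero_reverse]
    simpa using ha0)
  have h4 : IsUnit (t ^ (n + a.natDegree) * h - Polynomial.aeval t a.reverse) := by
    have : t ^ (n + a.natDegree) * h - Polynomial.aeval t a.reverse =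
      t * (t ^ m * h) + -Polynomial.aeval t a.reverse := by rw [hm]; ring
    rw [this, isUnit_mul_add hs.not_isUnit_left]
    exact h3.neg
  exact hξ.not_isUnit (isUnit_of_dvd_unit h1 h4)

theorem mul_mem_regularAt (hs : IsSection F ψ t e et ϑ) {P : R} (hP : Prime P) {x : L} {ξ : S}
    (hξ : Prime ξ)
    (htξ : ¬ t ∣ ξ)
    (hV : primeVal L P hP = primeVal L ξ hξ) {n : ℤ} {h : S} (hh : IsUnit h)
    (hxP : algebraMap R L P = algebraMap S L t ^ n * (x * algebraMap S L h)) {ε : L}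
    (hε : ε ∈ IntermediateField.adjoin k {algebraMap R L F})
    (hxε : (primeVal L P hP).valuation (x / algebraMap R L P - ε) < 1) :
    algebraMap S L t ^ n * ε ∈ regularAt (algebraMap S L t) (Polynomial.prime_X (R := k)) := by
  have ht0 : algebraMap S L t ≠ 0 := by simpa using hs.left_mem_ne_zero
  have hP0 : algebraMap R L P ≠ 0 := by simpa using hP.ne_zero
  have hmem : algebraMap S L t ^ n * ε ∈ IntermediateField.adjoin k {algebraMap S L t} :=
    mul_mem (zpow_mem (IntermediateField.mem_adjoin_simple_self k _) _) (hs.adjoin_eq ▸ hε)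
  obtain ⟨f, g, hfg⟩ := (IntermediateField.mem_adjoin_simple_iff k _).1 hmem
  rw [hfg]
  by_cases hf : f = 0
  · rw [hf, map_zero, zero_div]; exact zero_mem _
  by_cases hg : g = 0
  · rw [hg, map_zero, div_zero]; exact zero_mem _
  obtain ⟨i, f, hXf, rfl⟩ := WfDvdMonoid.max_power_factor hf Polynomial.irreducible_X
  obtain ⟨j, g, hXg, rfl⟩ := WfDvdMonoid.max_power_factor hg Polynomial.irreducible_X
  have hug := IsSection.isUnit_aeval hs.not_isUnit_left hXg
  have hg0 : Polynomial.aeval (algebraMap S L t) g ≠ 0 := by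
    rw [Polynomial.aeval_algebraMap_apply]
    simpa using hug.ne_zero
  simp only [map_mul, map_pow, Polynomial.aeval_X] at hfg ⊢
  rcases le_or_gt j i with hij | hij
  · obtain ⟨m, rfl⟩ := Nat.exists_eq_add_of_le hij
    refine ⟨Polynomial.X ^ m * f, g, hXg, ?_⟩
    simp only [map_mul, map_pow, Polynomial.aeval_X]
    field_simp
    ring
  exfalso
  obtain ⟨m, rfl⟩ := Nat.exists_eq_add_of_lt hij
  have h1 : ξ ∣ t * (t ^ m * Polynomial.aeval t g) + -(Polynomial.aeval t f * h) := by
    rw [← valuation_algebraMap_lt_one (L := L) hξ]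
    have h2 : algebraMap S L (t * (t ^ m * Polynomial.aeval t g) + -(Polynomial.aeval t f * h)) =
        (x / algebraMap R L P - ε) * (algebraMap S L t ^ n * algebraMap S L h) *
          algebraMap S L (t * (t ^ m * Polynomial.aeval t g)) := by
      have h3 : x / algebraMap R L P * (algebraMap S L t ^ n * algebraMap S L h) = 1 := by
        rw [div_mul_eq_mul_div, div_eq_one_iff_eq hP0, hxP]; ring
      have h4 : algebraMap S L t ^ n * ε * algebraMap S L (t * (t ^ m * Polynomial.aeval t g)) =
          algebraMap S L (Polynomial.aeval t f) := by
        rw [hfg, map_mul, map_mul, map_pow, ← Polynomial.aeval_algebraMap_apply,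
          ← Polynomial.aeval_algebraMap_apply]
        field_simp
        ring
      rw [sub_mul, sub_mul, h3, one_mul, map_add, map_neg, map_mul _ (Polynomial.aeval t f), ← h4]
      ring
    rw [h2, map_mul, map_mul, map_mul, map_zpow₀, hs.valuation_left_eq_one hξ htξ, one_zpow, one_mul,
      ← hV]
    refine mul_lt_one_of_lt_of_le (mul_lt_one_of_lt_of_le hxε ?_) ?_ <;>
    rw [hV] <;> exact ((primeVal L ξ hξ).valuation_le_one_iff _).2 (algebraMap_mem_primeVal hξ _)
  refine hξ.not_isUnit (isUnit_of_dvd_unit h1 ?_)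
  rw [isUnit_mul_add hs.not_isUnit_left]
  exact ((IsSection.isUnit_aeval hs.not_isUnit_left hXf).mul hh).neg

theorem lead_of_eq (hs : IsSection F ψ t e et ϑ) {P : L} {n : ℤ} {x : L} {l : E} (hl : l ≠ 0)
    (hx : Lead (ψ x) 0 l) {h : S}
    (hh : IsUnit h) (hP : P = algebraMap S L t ^ n * (x * algebraMap S L h)) :
    ∃ c, c ≠ 0 ∧ Lead (ψ P) n c := by
  obtain ⟨l', hl'⟩ := hs.exists_lead h
  have hl'0 := hs.lead_ne_zero hl' fun h0 => hs.not_isUnit_left (isUnit_of_dvd_unit h0 hh)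
  have h1 := (hs.lead_left.zpow hs.left_ne_zero n).mul (hx.mul hl')
  rw [← map_zpow₀, ← map_mul, ← map_mul, ← hP, mul_one, add_zero, add_zero] at h1
  exact ⟨_, mul_ne_zero (zpow_ne_zero _ hs.left_ne_zero) (mul_ne_zero hl hl'0), h1⟩
end IsSection
end

theorem exists_isSection.{v} {k : Type v} {R L E : Type*} [Field k] [CommRing R] [Field L] [Algebra R L]
    [Algebra k L] [Field E] [Algebra k E] {F : R} {ψ : L →ₐ[k] LaurentSeries E} {u w : L} {eu ϑ : E}
    (hc : IsChart k R u w) (huw : AlgebraicIndependent k ![u, w]) (hu : Lead (ψ u) 1 eu)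
    (heu : eu ≠ 0) (hw : Lead (ψ w) 0 ϑ) (hϑ : Transcendental k ϑ) {h U : MvPolynomial (Fin 2) k}
    (hh : constantCoeff h ≠ 0) (hU : constantCoeff U ≠ 0)
    (hF : algebraMap R L F * u * aeval ![u, w] h = aeval ![u, w] U) :
    ∃ (S : Type v) (_ : CommRing S) (_ : IsDomain S) (_ : UniqueFactorizationMonoid S)
      (_ : IsLocalRing S) (_ : Algebra S L) (_ : IsFractionRing S L) (_ : Algebra k S)
      (_ : IsScalarTower k S L) (t e : S) (et : E), IsSection F ψ t e et ϑ := by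
  let : Algebra (MvPolynomial (Fin 2) k) L := (aeval ![u, w]).toAlgebra
  have hQL (f : MvPolynomial (Fin 2) k) : algebraMap (MvPolynomial (Fin 2) k) L f =
    aeval ![u, w] f := rfl
  have hinj : Function.Injective (algebraMap (MvPolynomial (Fin 2) k) L) := huw
  have : FaithfulSMul (MvPolynomial (Fin 2) k) L := (faithfulSMul_iff_algebraMap_injective _ _).2 hinj
  have : IsScalarTower k (MvPolynomial (Fin 2) k) L := IsScalarTower.of_algebraMap_eq fun c => by
    rw [hQL, algebraMap_eq, aeval_C]
  have : IsFractionRing (MvPolynomial (Fin 2) k) L := IsFractionRing.of_field _ _ fun l => by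
    obtain ⟨N, M, hM, hl⟩ := exists_fraction_of_adjoin_pair_eq_top hc.adjoin_eq_top l
    exact ⟨N, M, eq_div_of_mul_eq hM hl⟩
  let 𝔪 : Ideal (MvPolynomial (Fin 2) k) := RingHom.ker constantCoeff
  have h𝔪 : 𝔪.IsPrime := RingHom.ker_isPrime _
  have hmem (f : MvPolynomial (Fin 2) k) : f ∈ 𝔪.primeCompl ↔ constantCoeff f ≠ 0 := Iff.rfl
  have hle := 𝔪.primeCompl_le_nonZeroDivisors
  let S := Localization.AtPrime 𝔪
  let : Algebra S L :=
    IsLocalization.localizationAlgebraOfSubmonoidLe _ L 𝔪.primeCompl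
      (nonZeroDivisors (MvPolynomial (Fin 2) k)) hle
  have : IsScalarTower (MvPolynomial (Fin 2) k) S L :=
    IsLocalization.localization_isScalarTower_of_submonoid_le ..
  have : IsFractionRing S L :=
    IsFractionRing.isFractionRing_of_isDomain_of_isLocalization 𝔪.primeCompl _ _
  have : IsScalarTower k S L := IsScalarTower.of_algebraMap_eq fun x => by
    rw [IsScalarTower.algebraMap_apply k (MvPolynomial (Fin 2) k) S,
      ← IsScalarTower.algebraMap_apply (MvPolynomial (Fin 2) k) _ L, ← IsScalarTower.algebraMap_apply]
  have : UniqueFactorizationMonoid S :=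
    inferInstance
  have hSL (f : MvPolynomial (Fin 2) k) : algebraMap S L (algebraMap (MvPolynomial (Fin 2) k) S f) =
      aeval ![u, w] f := by rw [← IsScalarTower.algebraMap_apply, hQL]
  have hunit (f : MvPolynomial (Fin 2) k) : IsUnit (algebraMap (MvPolynomial (Fin 2) k) S f) ↔ constantCoeff f ≠ 0 :=
    (IsLocalization.AtPrime.isUnit_to_map_iff S 𝔪 f).trans (hmem f)
  have hfrac (s : S) : ∃ p q : MvPolynomial (Fin 2) k, constantCoeff q ≠ 0 ∧
      s * algebraMap (MvPolynomial (Fin 2) k) S q = algebraMap (MvPolynomial (Fin 2) k) S p := by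
    obtain ⟨p, q, rfl⟩ := IsLocalization.exists_mk'_eq 𝔪.primeCompl s
    exact ⟨p, q, (hmem _).1 q.2, IsLocalization.mk'_spec _ _ _⟩
  have hlead (f : MvPolynomial (Fin 2) k) : Lead (ψ (aeval ![u, w] f)) 0 (aeval ![0, ϑ] f) := by
    rw [map_aeval_pair]
    exact Lead.mvPolynomial_aeval_zero (hu.of_lt (by norm_num)) hw f
  have hlead0 (f : MvPolynomial (Fin 2) k) (hf : constantCoeff f ≠ 0) :
      (aeval ![0, ϑ] f : E) ≠ 0 := by
    obtain ⟨a, g, rfl⟩ := exists_X_mul_add f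
    simp only [map_add, map_mul, constantCoeff_X, zero_mul, zero_add, constantCoeff_aeval_X] at hf
    simp only [map_add, map_mul, aeval_X, Matrix.cons_val_zero, zero_mul, zero_add]
    rw [← Polynomial.aeval_algHom_apply, aeval_X]
    intro h0
    have := transcendental_iff.1 hϑ g (by simpa using h0)
    rw [this] at hf
    simp at hf
  have hne (f : MvPolynomial (Fin 2) k) (hf : constantCoeff f ≠ 0) : (aeval ![u, w] f : L) ≠ 0 := by
    rw [← hQL, Ne, map_eq_zero_iff _ hinj]
    rintro rfl
    simp at hf
  obtain ⟨U', hU'⟩ := (hunit U).2 hU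
  obtain ⟨h', hh'⟩ := (hunit h).2 hh
  let t : S := algebraMap (MvPolynomial (Fin 2) k) S (X 0) * h' * ↑U'⁻¹
  let e : S := algebraMap (MvPolynomial (Fin 2) k) S (X 1)
  have htX : algebraMap (MvPolynomial (Fin 2) k) S (X 0) = t * (U' * ↑h'⁻¹) := by
    have : t * (U' * ↑h'⁻¹) = algebraMap (MvPolynomial (Fin 2) k) S (X 0) * (h' * ↑h'⁻¹) * (↑U'⁻¹ * U') := by ring
    rw [this, Units.mul_inv, Units.inv_mul, mul_one, mul_one]
  have htL : algebraMap S L t * aeval ![u, w] U = u * aeval ![u, w] h := by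
    rw [← hSL, ← hSL, ← map_mul, ← hU', ← hh']
    have : t * U' = algebraMap (MvPolynomial (Fin 2) k) S (X 0) * h' := by
      have : t * U' = algebraMap (MvPolynomial (Fin 2) k) S (X 0) * h' * (↑U'⁻¹ * U') := by ring
      rw [this, Units.inv_mul, mul_one]
    rw [this, map_mul, hSL, aeval_X]; rfl
  have he (g : k[X]) : algebraMap (MvPolynomial (Fin 2) k) S (Polynomial.aeval (X 1 : MvPolynomial (Fin 2) k) g) =
    Polynomial.aeval e g := (Polynomial.aeval_algebraMap_apply _ _ _).symm
  have hdec (f : MvPolynomial (Fin 2) k) : ∃ (a : S) (g : k[X]),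
      algebraMap (MvPolynomial (Fin 2) k) S f = t * a + Polynomial.aeval e g := by
    obtain ⟨a, g, rfl⟩ := exists_X_mul_add f
    exact ⟨U' * ↑h'⁻¹ * algebraMap (MvPolynomial (Fin 2) k) S a, g, by rw [map_add, map_mul, he, htX]; ring⟩
  have htF : algebraMap R L F * algebraMap S L t = 1 := by
    apply mul_right_cancel₀ (hne U hU)
    rw [mul_assoc, htL, ← mul_assoc, hF, one_mul]
  have htne := right_ne_zero_of_mul_eq_one htF
  refine ⟨S, inferInstance, inferInstance, inferInstance, inferInstance, inferInstance, inferInstance,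
    inferInstance, inferInstance, t, e, eu * aeval ![0, ϑ] h / aeval ![0, ϑ] U,
    ⟨?_, ?_, ?_, htF, ?_, ?_, ?_, hϑ, ?_, ?_⟩⟩
  · intro ht
    have := isUnit_of_mul_isUnit_left (isUnit_of_mul_isUnit_left ht)
    rw [hunit] at this
    simp at this
  · intro he
    rw [hunit] at he
    simp at he
  · intro s
    obtain ⟨p, q, hq, hs⟩ := hfrac s
    obtain ⟨a, g, ha⟩ := hdec p
    obtain ⟨b, u, hb⟩ := hdec q
    exact ⟨_, a, b, g, u, (hunit q).2 hq, by rw [hs, ha], hb⟩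
  · have h1 : algebraMap S L t = u * aeval ![u, w] h / aeval ![u, w] U :=
      eq_div_of_mul_eq (hne U hU) htL
    rw [h1, map_div₀, map_mul]
    have h2 := (hu.mul (hlead h)).div (hlead U) (hlead0 U hU)
    rwa [add_zero, sub_zero] at h2
  · exact div_ne_zero (mul_ne_zero heu (hlead0 h hh)) (hlead0 U hU)
  · rw [hSL, aeval_X]; exact hw
  · intro s
    obtain ⟨p, q, hq, hs⟩ := hfrac s
    refine ⟨aeval ![0, ϑ] p / aeval ![0, ϑ] q, ?_⟩
    have h1 : algebraMap S L s = aeval ![u, w] p / aeval ![u, w] q := by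
      apply eq_div_of_mul_eq (hne q hq)
      rw [← hSL, ← hSL, ← map_mul, hs]
    rw [h1, map_div₀]
    have h2 := (hlead p).div (hlead q) (hlead0 q hq)
    rwa [sub_zero] at h2
  · intro f
    obtain ⟨n, q, p, hq, hp⟩ := hc.exists_mul f
    obtain ⟨q', hq'⟩ := (hunit q).2 hq
    refine ⟨n, algebraMap (MvPolynomial (Fin 2) k) S p * ↑q'⁻¹ * (h' * ↑U'⁻¹) ^ n, ?_⟩
    apply mul_right_cancel₀ (mul_ne_zero (hne q hq) (pow_ne_zero n (hne U hU)))
    have h1 : algebraMap S L (algebraMap (MvPolynomial (Fin 2) k) S p * ↑q'⁻¹ * (h' * ↑U'⁻¹) ^ n) *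
        (aeval ![u, w] q * aeval ![u, w] U ^ n) = aeval ![u, w] p * aeval ![u, w] h ^ n := by
      rw [← hSL, ← hSL, ← hSL, ← hSL, ← hq', ← hU', ← hh']
      simp only [← map_pow, ← map_mul]
      congr 1
      have : algebraMap (MvPolynomial (Fin 2) k) S p * ↑q'⁻¹ * (h' * ↑U'⁻¹) ^ n * (q' * U' ^ n) =
        algebraMap (MvPolynomial (Fin 2) k) S p * (↑q'⁻¹ * q') * (h' * (↑U'⁻¹ * U')) ^ n := by ring
      rw [this, Units.inv_mul, Units.inv_mul, mul_one, mul_one]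
    rw [h1]
    have h2 : algebraMap R L f * algebraMap S L t ^ n * (aeval ![u, w] q * aeval ![u, w] U ^ n) =
      algebraMap R L f * aeval ![u, w] q * (algebraMap S L t * aeval ![u, w] U) ^ n := by ring
    rw [h2, htL, ← hp]
    ring

section
variable {k R L E : Type*} [Field k] [CommRing R] [IsDomain R] [UniqueFactorizationMonoid R]
    [Field L] [Algebra R L] [IsFractionRing R L] [Algebra k R] [Algebra k L]
    [IsScalarTower k R L] [Field E] [Algebra k E]
    {S S' : Type*} [CommRing S] [IsDomain S]
    [UniqueFactorizationMonoid S] [IsLocalRing S] [Algebra S L]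
    [IsFractionRing S L] [Algebra k S] [IsScalarTower k S L]
    [CommRing S'] [IsDomain S']
    [UniqueFactorizationMonoid S'] [IsLocalRing S'] [Algebra S' L]
    [IsFractionRing S' L] [Algebra k S'] [IsScalarTower k S' L]

theorem mem_regularAt_of_isSection {F : R} {ψ : L →ₐ[k] LaurentSeries E}
    {t e : S} {et ϑ : E} (hs : IsSection F ψ t e et ϑ)
    {t' e' : S'} {et' ϑ' : E} (hs' : IsSection F ψ t' e' et' ϑ')
    {K : IntermediateField k L} (hK : K = IntermediateField.adjoin k {algebraMap R L F})
    {P Q : R} (hP : Prime P) (hresP : ∀ f : R, ∃ q : k[X], P ∣ f - Polynomial.aeval F q)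
    (horP : Horizontal k F P) (hQ : Prime Q)
    (hresQ : ∀ f : R, ∃ q : k[X], Q ∣ f - Polynomial.aeval F q) (horQ : Horizontal k F Q)
    (hQP : ¬ Q ∣ P) {x : L} (hx : IntermediateField.adjoin K {x} = ⊤)
    (hxP : (primeVal L P hP).valuation x < 1) (hxQ : (primeVal L Q hQ).valuation x⁻¹ < 1)
    {l : E} (hl : l ≠ 0) (hxl : Lead (ψ x) 0 l)
    (O : ValuationSubring E) (hO : ∀ c : k, algebraMap k E c ∈ O) (hϑ : O.valuation ϑ < 1)
    (hlO : O.valuation l < 1)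
    (O' : ValuationSubring E) (hO' : ∀ c : k, algebraMap k E c ∈ O') (hϑ' : O'.valuation ϑ' < 1)
    (hlO' : O'.valuation l⁻¹ < 1) :
    (∀ ε : K, (primeVal L P hP).valuation (x / algebraMap R L P - ε) < 1 →
      (ε : L) ∈ regularAt (algebraMap R L F)⁻¹ (Polynomial.prime_X (R := k))) ∧
    ∀ (κ : K) (a b : K[X]), IsCoprime a b → a.Monic → b.Monic → b.natDegree = a.natDegree + 1 →
      Polynomial.aeval x⁻¹ a = κ * algebraMap R L P * Polynomial.aeval x⁻¹ b →
      ∀ i, (a.coeff i : L) ∈ regularAt (algebraMap R L F)⁻¹ (Polynomial.prime_X (R := k)) ∧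
        (b.coeff i : L) ∈ regularAt (algebraMap R L F)⁻¹ (Polynomial.prime_X (R := k)) := by
  have hx0 : x ≠ 0 := by
    rintro rfl
    rw [map_zero] at hxl
    exact hl (hxl.unique (Lead.zero 0))
  have ht0 : algebraMap S L t ≠ 0 := by simpa using hs.left_mem_ne_zero
  have htt : algebraMap S L t = algebraMap S' L t' := by rw [hs.eq_inv, hs'.eq_inv]
  have hxinv : IntermediateField.adjoin K {x⁻¹} = ⊤ := by
    refine adjoin_eq_top_of_mem hx ?_
    rw [← inv_inv x]
    exact inv_mem (by simpa using IntermediateField.mem_adjoin_simple_self K x⁻¹)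
  obtain ⟨ξ, hxξ, htξ, hξ⟩ := hs.exists_eq_algebraMap hK hx hl hxl O hO hϑ hlO
  obtain ⟨ξ', hxξ', htξ', hξ'⟩ := hs'.exists_eq_algebraMap hK hxinv (inv_ne_zero hl) (by
    simpa using hxl.inv hl) O' hO' hϑ' hlO'
  obtain ⟨n, h, hh, hPn⟩ := hs.exists_isUnit_of_zero hK hx hP hresP horP hxP hξ htξ hxξ
  obtain ⟨n', h', hh', hPn'⟩ := hs'.exists_isUnit_of_pole hP hresP hxP hx0 hxξ'
  have hV := hs.primeVal_eq hK hx hP horP hxP hξ htξ hxξ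
  have hn0 : n ≤ 0 := by
    obtain ⟨c, hc0, hc⟩ := hs.lead_of_eq hl hxl hh hPn
    have hPn'' : algebraMap R L P = algebraMap S' L t' ^ n' * (1 * algebraMap S' L h') := by
      rw [one_mul, hPn']
    obtain ⟨c', hc0', hc'⟩ := hs'.lead_of_eq (x := 1) (l := 1) one_ne_zero (by
      rw [map_one]; exact Lead.one) hh' hPn''
    rw [hc.order_unique hc0 hc' hc0']
    exact hs'.nonpos_of_pole hK hxinv hQ hresQ horQ hQP hxQ hξ' htξ' hxξ' hPn'
  rw [← hs.eq_inv]
  refine ⟨fun ε hε => ?_, fun κ a b hab ha hb hdeg heq => ?_⟩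
  · have h1 := hs.mul_mem_regularAt hP hξ htξ hV hh hPn (hK ▸ ε.2) hε
    obtain ⟨m, rfl⟩ : ∃ m : ℕ, n = -m := ⟨(-n).toNat, by omega⟩
    have h2 : (ε : L) = algebraMap S L t ^ m * (algebraMap S L t ^ (-m : ℤ) * ε) := by
      rw [zpow_neg, zpow_natCast]; field_simp
    rw [h2]
    refine mul_mem (pow_mem ?_ m) h1
    exact ⟨Polynomial.X, 1, fun h => Polynomial.prime_X.not_isUnit (isUnit_of_dvd_one h), by simp⟩
  · have htK : algebraMap S L t ∈ K := by
      rw [hK, hs.adjoin_eq]; exact IntermediateField.mem_adjoin_simple_self k _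
    refine coeff_mem_regularAt (S := S) (L := L) (K := K) Polynomial.prime_X hs.injective
      (by simpa using hs.prime) (fun u => IsSection.isUnit_aeval hs.not_isUnit_left) hξ.not_isUnit
      (by simpa using htξ) (hK.trans hs.adjoin_eq) hab ha hb hdeg hh
      (κ := κ * ⟨_, htK⟩ ^ n) ?_
    rw [← hxξ, heq, hPn, map_mul, ← hxξ]
    have hz : (((κ * ⟨_, htK⟩ ^ n : K)) : L) = κ * algebraMap S L t ^ n := by
      rw [IntermediateField.coe_mul]
      exact congrArg _ (map_zpow₀ (algebraMap K L) _ n)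
    rw [hz]
    ring

end

namespace IsSection
variable {k R S L E : Type*} [Field k] [CommRing R] [CommRing S] [IsDomain S]
    [UniqueFactorizationMonoid S] [IsLocalRing S] [Field L] [Algebra R L] [Algebra S L]
    [IsFractionRing S L] [Algebra k S] [Algebra k L] [IsScalarTower k S L]
    [Field E] [Algebra k E] {F : R} {ψ : L →ₐ[k] LaurentSeries E} {t e : S} {et ϑ : E}

theorem lead_mem_adjoin (hs : IsSection F ψ t e et ϑ) {s : S} {e' : E}
    (hse : Lead (ψ (algebraMap S L s)) 0 e') :
    e' ∈ IntermediateField.adjoin k {ϑ} := by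
  obtain ⟨h, a, b, g, u, hh, h1, h2⟩ := hs.exists_decomposition s
  have hu : Polynomial.aeval ϑ u ≠ 0 := by
    refine hs.aeval_ne_zero ?_
    rintro rfl
    exact (hs.isUnit_iff h2).1 hh (dvd_zero _)
  rw [eq_div_of_mul_eq hu (hs.lead_eq hse h1 h2)]
  have hmem (p : k[X]) : Polynomial.aeval ϑ p ∈ IntermediateField.adjoin k {ϑ} :=
    IntermediateField.algebra_adjoin_le_adjoin _ _ (Polynomial.aeval_mem_adjoin_singleton k ϑ)
  exact div_mem (hmem g) (hmem u)

theorem lead_mem_adjoin_of_field (hs : IsSection F ψ t e et ϑ) {l : L} {e' : E}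
    (hle : Lead (ψ l) 0 e') :
    e' ∈ IntermediateField.adjoin k {ϑ} := by
  by_cases he' : e' = 0
  · rw [he']; exact zero_mem _
  obtain ⟨a, b, hb, rfl⟩ := IsFractionRing.div_surjective (A := S) l
  have hb0 : b ≠ 0 := nonZeroDivisors.ne_zero hb
  have ha0 : a ≠ 0 := by
    rintro rfl
    rw [map_zero, zero_div, map_zero] at hle
    exact he' (hle.unique (Lead.zero 0))
  obtain ⟨m, a', ha', rfl⟩ := WfDvdMonoid.max_power_factor ha0 hs.prime.irreducible
  obtain ⟨n, b', hb', rfl⟩ := WfDvdMonoid.max_power_factor hb0 hs.prime.irreducible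
  obtain ⟨α, hα⟩ := hs.exists_lead a'
  obtain ⟨β, hβ⟩ := hs.exists_lead b'
  have hα0 := hs.lead_ne_zero hα ha'
  have hβ0 := hs.lead_ne_zero hβ hb'
  have h1 := (hs.lead_left.pow m).mul hα
  have h2 := hle.mul ((hs.lead_left.pow n).mul hβ)
  have h3 : algebraMap S L (t ^ n * b') ≠ 0 := by simpa using hb0
  rw [← map_pow, ← map_pow, ← map_mul, ← map_mul, ← map_mul, div_mul_cancel₀ _ h3, zero_add,
    add_zero, mul_one] at h2
  rw [← map_pow, ← map_pow, ← map_mul, ← map_mul, add_zero, mul_one] at h1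
  have hmn := h1.order_unique (mul_ne_zero (pow_ne_zero _ hs.left_ne_zero) hα0) h2
    (mul_ne_zero he' (mul_ne_zero (pow_ne_zero _ hs.left_ne_zero) hβ0))
  rw [← hmn] at h2
  have h4 := h1.unique h2
  have hmn' : m = n := by exact_mod_cast hmn
  subst hmn'
  have h5 : e' = α / β := by
    rw [eq_div_iff hβ0]
    apply mul_left_cancel₀ (pow_ne_zero m hs.left_ne_zero)
    rw [h4]; ring
  rw [h5]
  exact div_mem (hs.lead_mem_adjoin hα) (hs.lead_mem_adjoin hβ)

end IsSection

/-- Among three distinct places of `k(ε)`, two have a finite value of `ε`. -/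
theorem exists_valuation_sub_lt_one {k E : Type*} [Field k] [Field E] [Algebra k E]
    (O O' : ValuationSubring E) (hO : ∀ c : k, algebraMap k E c ∈ O)
    (hO' : ∀ c : k, algebraMap k E c ∈ O') (hne : O ≠ O') {y y' : E} (hy : O.valuation y < 1)
    (htop : IntermediateField.adjoin k {y} = ⊤) (hy' : O'.valuation y' < 1)
    (htop' : IntermediateField.adjoin k {y'} = ⊤) {ε : E}
    (hε : IntermediateField.adjoin k {ε} = ⊤) :
    (∃ c : k, O.valuation (ε - algebraMap k E c) < 1) ∨
      ∃ c : k, O'.valuation (ε - algebraMap k E c) < 1 := by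
  have key (V : ValuationSubring E) (hV : ∀ c : k, algebraMap k E c ∈ V) {y : E}
      (hy : V.valuation y < 1) (htop : IntermediateField.adjoin k {y} = ⊤) (h : ε ∈ V) :
      ∃ c : k, V.valuation (ε - algebraMap k E c) < 1 := by
    obtain ⟨c, v, hv, hc⟩ := exists_sub_eq_mul V hV hy htop h
    refine ⟨c, ?_⟩
    rw [hc, map_mul]
    exact mul_lt_one_of_lt_of_le hy ((V.valuation_le_one_iff v).2 hv)
  by_cases h : ε ∈ O
  · exact Or.inl (key O hO hy htop h)
  by_cases h' : ε ∈ O'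
  · exact Or.inr (key O' hO' hy' htop' h')
  have hinv (V : ValuationSubring E) (hV : ε ∉ V) : V.valuation ε⁻¹ < 1 := by
    rw [← V.valuation_le_one_iff, not_le] at hV
    rw [map_inv₀]
    exact inv_lt_one_of_one_lt₀ hV
  refine absurd (eq_of_valuation_lt_one O O' hO hO' (hinv O h) (hinv O' h') ?_) hne
  refine adjoin_eq_top_of_mem hε ?_
  rw [← inv_inv ε]
  exact inv_mem (by simpa using IntermediateField.mem_adjoin_simple_self k ε⁻¹)

open Classical in
/-- The places `0`, `1` and `∞` of the rational function field. -/
theorem exists_places (k : Type*) [Field k] : ∃ O O' O'' : ValuationSubring (RatFunc k),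
    (∀ c : k, algebraMap k (RatFunc k) c ∈ O) ∧ (∀ c : k, algebraMap k (RatFunc k) c ∈ O') ∧
    (∀ c : k, algebraMap k (RatFunc k) c ∈ O'') ∧ O.valuation RatFunc.X < 1 ∧
    O'.valuation (RatFunc.X - 1) < 1 ∧ O''.valuation (RatFunc.X)⁻¹ < 1 := by
  have hp : Prime (Polynomial.X - Polynomial.C 1 : k[X]) := Polynomial.prime_X_sub_C 1
  refine ⟨primeVal _ (Polynomial.X : k[X]) Polynomial.prime_X, primeVal _ _ hp,
    (RatFunc.inftyValuation k).valuationSubring, fun c => ?_, fun c => ?_, fun c => ?_,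
    ?_, ?_, ?_⟩
  · rw [IsScalarTower.algebraMap_apply k k[X] (RatFunc k)]
    exact algebraMap_mem_primeVal _ _
  · rw [IsScalarTower.algebraMap_apply k k[X] (RatFunc k)]
    exact algebraMap_mem_primeVal _ _
  · rw [Valuation.mem_valuationSubring_iff]
    by_cases hc : c = 0
    · simp [hc]
    · rw [show algebraMap k (RatFunc k) c = RatFunc.C c from rfl, RatFunc.inftyValuation.C k hc]
  · rw [← RatFunc.algebraMap_X, valuation_algebraMap_lt_one]
  · have h : (RatFunc.X - 1 : RatFunc k) =
        algebraMap k[X] (RatFunc k) (Polynomial.X - Polynomial.C 1) := by simp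
    rw [h, valuation_algebraMap_lt_one]
  · rw [← (Valuation.isEquiv_valuation_valuationSubring _).lt_one_iff_lt_one, ← one_div,
      RatFunc.inftyValuation.X_inv]
    exact WithZero.exp_lt_exp.2 (by norm_num)

/-- The coefficients occurring in an expression of `P` in terms of `x⁻¹` have no pole at the
place `F = ∞` of `k(F)`. -/
def RegularAtInfinity {k R L : Type*} [Field k] [CommRing R] [IsDomain R]
    [UniqueFactorizationMonoid R] [Field L] [Algebra R L] [IsFractionRing R L] [Algebra k L]
    (F : R) (K : IntermediateField k L) {P : R} (hP : Prime P)
    (x : L) : Prop :=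
  (∀ ε : K, (primeVal L P hP).valuation (x / algebraMap R L P - ε) < 1 →
      (ε : L) ∈ regularAt (algebraMap R L F)⁻¹ (Polynomial.prime_X (R := k))) ∧
    ∀ (κ : K) (a b : K[X]), IsCoprime a b → a.Monic → b.Monic → b.natDegree = a.natDegree + 1 →
      Polynomial.aeval x⁻¹ a = κ * algebraMap R L P * Polynomial.aeval x⁻¹ b →
      ∀ i, (a.coeff i : L) ∈ regularAt (algebraMap R L F)⁻¹ (Polynomial.prime_X (R := k)) ∧
        (b.coeff i : L) ∈ regularAt (algebraMap R L F)⁻¹ (Polynomial.prime_X (R := k))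

section
variable {k L E : Type*} [Field k] [Field L] [Algebra (MvPolynomial (Fin 2) k) L]
  [IsFractionRing (MvPolynomial (Fin 2) k) L] [Algebra k L]
  [IsScalarTower k (MvPolynomial (Fin 2) k) L] [Field E] [Algebra k E]

theorem regularAtInfinity_of_isChart {F : MvPolynomial (Fin 2) k} {ψ : L →ₐ[k] LaurentSeries E}
    {z θ : L} {ez ε : E} (hez : ez ≠ 0) (hε : Transcendental k ε) (hz : Lead (ψ z) 1 ez)
    (hθ : Lead (ψ θ) 0 ε) (hc : ∀ c : k, IsChart k (MvPolynomial (Fin 2) k) z (θ - algebraMap k L c) ∧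
      ∃ h U : MvPolynomial (Fin 2) k, constantCoeff h ≠ 0 ∧ constantCoeff U ≠ 0 ∧
        algebraMap _ L F * z * aeval ![z, θ - algebraMap k L c] h =
          aeval ![z, θ - algebraMap k L c] U)
    {K : IntermediateField k L}
    (hK : K = IntermediateField.adjoin k {algebraMap (MvPolynomial (Fin 2) k) L F})
    {P Q : MvPolynomial (Fin 2) k} (hP : Prime P)
    (hresP : ∀ f, ∃ q : k[X], P ∣ f - Polynomial.aeval F q)
    (horP : Horizontal k F P) (hQ : Prime Q)
    (hresQ : ∀ f, ∃ q : k[X], Q ∣ f - Polynomial.aeval F q) (horQ : Horizontal k F Q)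
    (hQP : ¬ Q ∣ P) {x : L} (hx : IntermediateField.adjoin K {x} = ⊤)
    (hxP : (primeVal L P hP).valuation x < 1) (hxQ : (primeVal L Q hQ).valuation x⁻¹ < 1)
    {l : E} (hl : l ≠ 0) (hxl : Lead (ψ x) 0 l)
    (O : ValuationSubring E) (hO : ∀ c : k, algebraMap k E c ∈ O)
    (hϑ : ∃ c : k, O.valuation (ε - algebraMap k E c) < 1) (hlO : O.valuation l < 1)
    (O' : ValuationSubring E) (hO' : ∀ c : k, algebraMap k E c ∈ O')
    (hϑ' : ∃ c : k, O'.valuation (ε - algebraMap k E c) < 1)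
    (hlO' : O'.valuation l⁻¹ < 1) : RegularAtInfinity F K hP x := by
  have hc1 (c : k) := (hc c).1
  choose h U hh hU hF using fun c => (hc c).2
  have key (c : k) := exists_isSection (ψ := ψ) (hc1 c)
    (algebraicIndependent_of_adjoin_eq_top _ _ (hc1 c).adjoin_eq_top)
    hz hez (by rw [map_sub, AlgHom.commutes]; exact hθ.sub (Lead.base c))
    (transcendental_sub_algebraMap hε c) (hh c) (hU c) (hF c)
  obtain ⟨c, hϑ⟩ := hϑ
  obtain ⟨c', hϑ'⟩ := hϑ'
  obtain ⟨S, _, _, _, _, _, _, _, _, t, e, et, hs⟩ := key c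
  obtain ⟨S', _, _, _, _, _, _, _, _, t', e', et', hs'⟩ := key c'
  exact mem_regularAt_of_isSection hs hs' hK hP hresP horP hQ hresQ horQ hQP hx hxP hxQ hl hxl O hO
    hϑ hlO O' hO' hϑ' hlO'

end

theorem valuation_ne_of_sub_eq_one {L : Type*} [Field L] (V W : ValuationSubring L) {y z : L}
    (hy : V.valuation y < 1) (hz : W.valuation z < 1) (hyz : y - z = 1) : V ≠ W := by
  rintro rfl
  have := Valuation.map_sub_lt _ hy hz
  rw [hyz, map_one] at this
  exact lt_irrefl _ this

theorem valuation_ne_of_mul_eq_one {L : Type*} [Field L] (V W : ValuationSubring L) {y z : L}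
    (hy : V.valuation y < 1) (hz : W.valuation z < 1) (hyz : y * z = 1) : V ≠ W := by
  rintro rfl
  have := mul_lt_one_of_lt_of_le hy hz.le
  rw [← map_mul, hyz, map_one] at this
  exact lt_irrefl _ this

theorem valuation_div_sub_one_lt_one {L : Type*} [Field L] (V : ValuationSubring L) {y : L}
    (hy : V.valuation y < 1) : V.valuation (y / (y - 1)) < 1 := by
  rw [map_div₀, Valuation.map_sub_eq_of_lt_right _ (by rwa [map_one]), map_one, div_one]
  exact hy

theorem valuation_inv_div_sub_one_lt_one {L : Type*} [Field L] (V : ValuationSubring L) {y : L}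
    (hy : V.valuation (y - 1) < 1) : V.valuation (y / (y - 1))⁻¹ < 1 := by
  have := valuation_div_sub_one_lt_one V (y := 1 - y) (by rwa [Valuation.map_sub_swap])
  rwa [inv_div, ← neg_div_neg_eq, neg_sub, ← sub_sub_cancel_left 1 y]

theorem valuation_inv_sub_one_lt_one {L : Type*} [Field L] (V : ValuationSubring L) {y : L}
    (hy : V.valuation y⁻¹ < 1) (hy0 : y ≠ 0) : V.valuation (y - 1)⁻¹ < 1 := by
  have h := valuation_div_sub_one_lt_one V hy
  have h1 : y⁻¹ - 1 = y⁻¹ * (1 - y) := by field_simp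
  rwa [h1, div_mul_eq_div_div, div_self (inv_ne_zero hy0), one_div, map_inv₀,
    Valuation.map_sub_swap, ← map_inv₀] at h

theorem adjoin_div_sub_one_eq_top {K L : Type*} [Field K] [Field L] [Algebra K L] {x : L}
    (hx : IntermediateField.adjoin K {x} = ⊤) (h : x - 1 ≠ 0) :
    IntermediateField.adjoin K {x / (x - 1)} = ⊤ := by
  refine adjoin_eq_top_of_mem hx ?_
  have h1 : x / (x - 1) - 1 = (x - 1)⁻¹ := by field_simp; ring
  have h2 : x / (x - 1) / (x / (x - 1) - 1) = x := by rw [h1]; field_simp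
  have h3 := IntermediateField.mem_adjoin_simple_self K (x / (x - 1))
  have h4 := div_mem h3 (sub_mem h3 (one_mem _))
  rwa [h2] at h4

theorem adjoin_inv_eq_top {K L : Type*} [Field K] [Field L] [Algebra K L] {x : L}
    (hx : IntermediateField.adjoin K {x} = ⊤) : IntermediateField.adjoin K {x⁻¹} = ⊤ := by
  refine adjoin_eq_top_of_mem hx ?_
  have h := inv_mem (IntermediateField.mem_adjoin_simple_self K x⁻¹)
  rwa [inv_inv] at h

theorem adjoin_sub_one_eq_top {K L : Type*} [Field K] [Field L] [Algebra K L] {x : L}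
    (hx : IntermediateField.adjoin K {x} = ⊤) : IntermediateField.adjoin K {x - 1} = ⊤ := by
  simpa using adjoin_sub_eq_top hx 1

section
variable {k L : Type*} [Field k] [Field L] [Algebra (MvPolynomial (Fin 2) k) L]
  [IsFractionRing (MvPolynomial (Fin 2) k) L] [Algebra k L]
  [IsScalarTower k (MvPolynomial (Fin 2) k) L]

theorem exists_regularAtInfinity {F : MvPolynomial (Fin 2) k}
    {ψ : L →ₐ[k] LaurentSeries (RatFunc k)}
    (hF : Lead (ψ (algebraMap (MvPolynomial (Fin 2) k) L F)) (-1) 1)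
    {K : IntermediateField k L}
    (hK : K = IntermediateField.adjoin k {algebraMap (MvPolynomial (Fin 2) k) L F})
    (P : Fin 3 → MvPolynomial (Fin 2) k) (hP : ∀ i, Prime (P i))
    (hres : ∀ i f, ∃ q : k[X], P i ∣ f - Polynomial.aeval F q)
    (hor : ∀ i, Horizontal k F (P i)) (hPP : ∀ i j, i ≠ j → ¬ P i ∣ P j)
    {x : L} (hx : IntermediateField.adjoin K {x} = ⊤)
    (hx0 : (primeVal L _ (hP 0)).valuation x < 1) (hx1 : (primeVal L _ (hP 1)).valuation (x - 1) < 1)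
    (hx2 : (primeVal L _ (hP 2)).valuation x⁻¹ < 1) (hxl : Lead (ψ x) 0 RatFunc.X)
    (hbad : ¬ ∃ G : MvPolynomial (Fin 2) k, IntermediateField.adjoin K
      {algebraMap (MvPolynomial (Fin 2) k) L G} = ⊤) :
    ∃ (i : Fin 3) (y : L), IntermediateField.adjoin K {y} = ⊤ ∧
      (primeVal L _ (hP i)).valuation y < 1 ∧ RegularAtInfinity F K (hP i) y := by
  have hE (e : RatFunc k) (he : e ∉ Set.range (algebraMap k (RatFunc k))) : Transcendental k e :=
    RatFunc.transcendental_of_ne_C _ fun ⟨c, hc⟩ => he ⟨c, hc.symm⟩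
  have hXC (c : k) : RatFunc.X - algebraMap k (RatFunc k) c ≠ 0 := by
    intro h
    exact RatFunc.transcendental_X (sub_eq_zero.1 h ▸ isAlgebraic_algebraMap c)
  have hX0 : (RatFunc.X : RatFunc k) ≠ 0 := by simpa using hXC 0
  have hX1 : (RatFunc.X : RatFunc k) - 1 ≠ 0 := by simpa using hXC 1
  subst hK
  obtain ⟨z, θ, ez, ε, hez, hε, hz, hθ, hc⟩ := exists_sections hE one_ne_zero hF
    RatFunc.transcendental_X RatFunc.adjoin_X hxl hx hbad
  have hεtop : IntermediateField.adjoin k {ε} = ⊤ := by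
    have hc1 := (hc 0).1
    obtain ⟨h, U, hh, hU, hhU⟩ := (hc 0).2
    obtain ⟨S, _, _, _, _, _, _, _, _, t, e, et, hs⟩ := exists_isSection (ψ := ψ) hc1
      (algebraicIndependent_of_adjoin_eq_top _ _ hc1.adjoin_eq_top) hz hez
      (by rw [map_sub, AlgHom.commutes]; exact hθ.sub (Lead.base 0))
      (transcendental_sub_algebraMap hε 0) hh hU hhU
    refine adjoin_eq_top_of_mem (RatFunc.adjoin_X (K := k)) ?_
    simpa using hs.lead_mem_adjoin_of_field hxl
  obtain ⟨O, O', O'', hO, hO', hO'', hXO, hXO', hXO''⟩ := exists_places k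
  have hXtop' := adjoin_sub_one_eq_top (RatFunc.adjoin_X (K := k))
  have hXtop'' := adjoin_inv_eq_top (RatFunc.adjoin_X (K := k))
  have h01 := exists_valuation_sub_lt_one O O' hO hO'
    (valuation_ne_of_sub_eq_one _ _ hXO hXO' (by ring)) hXO RatFunc.adjoin_X hXO' hXtop' hεtop
  have h02 := exists_valuation_sub_lt_one O O'' hO hO''
    (valuation_ne_of_mul_eq_one _ _ hXO hXO'' (mul_inv_cancel₀ hX0)) hXO RatFunc.adjoin_X hXO''
    hXtop'' hεtop
  have h12 := exists_valuation_sub_lt_one O' O'' hO' hO'' (by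
    rintro rfl
    have := O'.valuation.map_add_lt hXO''
      (show O'.valuation ((RatFunc.X - 1) * RatFunc.X⁻¹) < 1 by
        rw [map_mul]; exact mul_lt_one_of_lt_of_le hXO' hXO''.le)
    rw [sub_mul, one_mul, mul_inv_cancel₀ hX0, add_sub_cancel, map_one] at this
    exact lt_irrefl _ this) hXO' hXtop' hXO'' hXtop'' hεtop
  have key (i j : Fin 3) (hij : i ≠ j) (y : L)
      (hy : IntermediateField.adjoin (IntermediateField.adjoin k
        {algebraMap (MvPolynomial (Fin 2) k) L F}) {y} = ⊤)
      (hyi : (primeVal L _ (hP i)).valuation y < 1) (hyj : (primeVal L _ (hP j)).valuation y⁻¹ < 1)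
      (l : RatFunc k) (hl : l ≠ 0) (hyl : Lead (ψ y) 0 l) (V W : ValuationSubring (RatFunc k))
      (hV : ∀ c : k, algebraMap k (RatFunc k) c ∈ V) (hW : ∀ c : k, algebraMap k (RatFunc k) c ∈ W)
      (hlV : V.valuation l < 1) (hlW : W.valuation l⁻¹ < 1)
      (hεV : ∃ c : k, V.valuation (ε - algebraMap k (RatFunc k) c) < 1)
      (hεW : ∃ c : k, W.valuation (ε - algebraMap k (RatFunc k) c) < 1) :
      ∃ (i : Fin 3) (y : L), IntermediateField.adjoin (IntermediateField.adjoin k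
          {algebraMap (MvPolynomial (Fin 2) k) L F}) {y} = ⊤ ∧
        (primeVal L _ (hP i)).valuation y < 1 ∧ RegularAtInfinity F (IntermediateField.adjoin k
          {algebraMap (MvPolynomial (Fin 2) k) L F}) (hP i) y :=
    ⟨i, y, hy, hyi, regularAtInfinity_of_isChart hez hε hz hθ hc rfl (hP i) (hres i) (hor i) (hP j)
      (hres j) (hor j) (hPP j i hij.symm) hy hyi hyj hl hyl V hV hεV hlV W hW hεW hlW⟩
  have hx10 : x - 1 ≠ 0 := by
    intro h
    have h1 : Lead (ψ (x - 1)) 0 (RatFunc.X - 1) := by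
      rw [map_sub, map_one]; exact hxl.sub Lead.one
    rw [h, map_zero] at h1
    exact hX1 (h1.unique (Lead.zero 0))
  have hl1 : Lead (ψ (x - 1)) 0 (RatFunc.X - 1) := by
    rw [map_sub, map_one]; exact hxl.sub Lead.one
  have hl2 : Lead (ψ (x / (x - 1))) 0 (RatFunc.X / (RatFunc.X - 1)) := by
    rw [map_div₀]; simpa using hxl.div hl1 hX1
  by_cases h0 : ∃ c : k, O.valuation (ε - algebraMap k (RatFunc k) c) < 1
  · rcases h12 with h1 | h2
    · refine key 0 1 (by decide) _ (adjoin_div_sub_one_eq_top hx hx10)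
        (valuation_div_sub_one_lt_one _ hx0) (valuation_inv_div_sub_one_lt_one _ hx1) _
        (div_ne_zero hX0 hX1) hl2 O O' hO hO' (valuation_div_sub_one_lt_one _ hXO)
        (valuation_inv_div_sub_one_lt_one _ hXO') h0 h1
    · exact key 0 2 (by decide) x hx hx0 hx2 _ hX0 hxl O O'' hO hO'' hXO hXO'' h0 h2
  · have hx' : x ≠ 0 := by
      rintro rfl
      rw [map_zero] at hxl
      exact hX0 (hxl.unique (Lead.zero 0))
    exact key 1 2 (by decide) _ (adjoin_sub_one_eq_top hx) hx1
      (valuation_inv_sub_one_lt_one _ hx2 hx') _ hX1 hl1 O' O'' hO' hO'' hXO'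
      (valuation_inv_sub_one_lt_one _ hXO'' hX0) (h01.resolve_left h0) (h02.resolve_left h0)
end

/-- An element with a simple pole at the place `y = ∞` of `K(y)` and leading coefficient `1`. -/
theorem exists_monic_fraction {K L : Type*} [Field K] [Field L] [Algebra K L]
    (V : ValuationSubring L) (hK : ∀ c : K, algebraMap K L c ∈ V) {y p : L}
    (hy : IntermediateField.adjoin K {y} = ⊤) (hp0 : p ≠ 0) (hp : V.valuation p < 1)
    (hpy : V.valuation (p * y - 1) < 1) :
    ∃ a b : K[X], IsCoprime a b ∧ a.Monic ∧ b.Monic ∧ b.natDegree = a.natDegree + 1 ∧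
      Polynomial.aeval y a = p * Polynomial.aeval y b := by
  have hpy1 : V.valuation (p * y) = 1 := by
    have := V.valuation.map_add_eq_of_lt_right (x := p * y - 1) (y := 1) (by rwa [map_one])
    rwa [sub_add_cancel, map_one] at this
  have hy0 : y ≠ 0 := by
    rintro rfl
    simp at hpy1
  obtain ⟨ω, rfl⟩ : ∃ ω, y = ω⁻¹ := ⟨y⁻¹, (inv_inv y).symm⟩
  have hω0 : ω ≠ 0 := by simpa using hy0
  have hpω : V.valuation p = V.valuation ω := by
    rw [← div_eq_mul_inv, map_div₀] at hpy1
    exact eq_of_div_eq_one hpy1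
  have hω : V.valuation ω < 1 := hpω ▸ hp
  obtain ⟨a, b, hab, hb0, h⟩ := exists_coprime_of_adjoin_eq_top hy p
  have hb : b ≠ 0 := by rintro rfl; simp at hb0
  have ha : a ≠ 0 := by
    rintro rfl
    rw [map_zero, mul_eq_zero] at h
    exact h.elim hp0 hb0
  have hca : a.leadingCoeff ≠ 0 := by simpa using ha
  have hcb : b.leadingCoeff ≠ 0 := by simpa using hb
  have hval (a : K[X]) (ha : a ≠ 0) : V.valuation (Polynomial.aeval ω⁻¹ a) *
      V.valuation ω ^ a.natDegree = 1 := by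
    rw [← map_pow, ← map_mul, aeval_eq_reverse hω0]
    exact valuation_aeval_eq_one V hK hω (by rwa [Polynomial.coeff_zero_reverse,
      Polynomial.leadingCoeff_ne_zero])
  have hdeg : b.natDegree = a.natDegree + 1 := by
    have h1 := hval a ha
    rw [← h, map_mul, hpω] at h1
    have h2 : V.valuation ω ^ b.natDegree = V.valuation ω ^ (a.natDegree + 1) := by
      have h3 := hval b hb
      have h4 : V.valuation (Polynomial.aeval ω⁻¹ b) ≠ 0 := by simpa using hb0
      apply mul_left_cancel₀ h4
      rw [h3, ← h1, pow_succ', mul_assoc, mul_left_comm]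
    exact pow_right_injective₀ (by simpa [zero_lt_iff] using hω0) hω.ne h2
  have hrev : p * ω⁻¹ * Polynomial.aeval ω b.reverse = Polynomial.aeval ω a.reverse := by
    rw [← aeval_eq_reverse hω0, ← aeval_eq_reverse hω0, ← h, hdeg, pow_succ]
    field_simp
  have hlc : b.leadingCoeff = a.leadingCoeff := by
    by_contra hne
    have h1 : V.valuation (Polynomial.aeval ω (b.reverse - a.reverse)) < 1 := by
      have h2 : Polynomial.aeval ω (b.reverse - a.reverse) =
          - ((p * ω⁻¹ - 1) * Polynomial.aeval ω b.reverse) := by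
        rw [map_sub, ← hrev]; ring
      rw [h2, Valuation.map_neg, map_mul]
      exact mul_lt_one_of_lt_of_le hpy ((V.valuation_le_one_iff _).2
        (valuation_aeval_le_one V hK (valuation_lt_one_mem V hω) _))
    rw [valuation_aeval_eq_one V hK hω (by
      rwa [Polynomial.coeff_sub, Polynomial.coeff_zero_reverse, Polynomial.coeff_zero_reverse,
        sub_ne_zero])] at h1
    exact lt_irrefl _ h1
  have hu (c : K) (hc : c ≠ 0) : IsUnit (Polynomial.C c) :=
    (isUnit_iff_ne_zero.2 hc).map Polynomial.C
  refine ⟨a * Polynomial.C a.leadingCoeff⁻¹, b * Polynomial.C b.leadingCoeff⁻¹, ?_,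
    Polynomial.monic_mul_leadingCoeff_inv ha, Polynomial.monic_mul_leadingCoeff_inv hb, ?_, ?_⟩
  · exact (isCoprime_mul_unit_right_left (hu _ (inv_ne_zero hca)) _ _).2
      ((isCoprime_mul_unit_right_right (hu _ (inv_ne_zero hcb)) _ _).2 hab)
  · rw [Polynomial.natDegree_mul_C (inv_ne_zero hca), Polynomial.natDegree_mul_C (inv_ne_zero hcb),
      hdeg]
  · rw [map_mul, map_mul, ← h, hlc, mul_assoc]

/-- Membership of the coefficients in a subring is invariant under affine substitutions. -/
theorem coeff_mem_of_affine {K L : Type*} [Field K] [Field L] [Algebra K L] (T : Subring K)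
    {ε δ : K} (hε0 : ε ≠ 0) (hε : ε ∈ T) (hδ : δ ∈ T) {x p : L}
    (hT : ∀ (a b : K[X]), IsCoprime a b → a.Monic → b.Monic → b.natDegree = a.natDegree + 1 →
      Polynomial.aeval x a = algebraMap K L ε * p * Polynomial.aeval x b →
      ∀ i, a.coeff i ∈ T ∧ b.coeff i ∈ T) {a b : K[X]} (hab : IsCoprime a b) (ha : a.Monic)
    (hb : b.Monic) (hdeg : b.natDegree = a.natDegree + 1)
    (h : Polynomial.aeval (algebraMap K L ε * x + algebraMap K L δ) a =
      p * Polynomial.aeval (algebraMap K L ε * x + algebraMap K L δ) b) (i : ℕ) :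
    a.coeff i ∈ T ∧ b.coeff i ∈ T := by
  have hε0' : algebraMap K L ε ≠ 0 := by simpa using hε0
  have haeval (a : K[X]) : algebraMap K L ε ^ a.natDegree *
      Polynomial.aeval x ((Polynomial.taylor δ a).scaleRoots ε⁻¹) =
        Polynomial.aeval (algebraMap K L ε * x + algebraMap K L δ) a := by
    have h1 := Polynomial.scaleRoots_eval₂_mul (p := Polynomial.taylor δ a) (algebraMap K L)
      (algebraMap K L ε * x) ε⁻¹
    rw [map_inv₀, inv_mul_cancel_left₀ hε0', Polynomial.natDegree_taylor] at h1
    rw [Polynomial.aeval_def, h1, ← mul_assoc, ← mul_pow, mul_inv_cancel₀ hε0', one_pow, one_mul,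
      Polynomial.taylor_apply, ← Polynomial.aeval_def, Polynomial.aeval_comp]
    simp
  have hmem (a : K[X]) (ha : ∀ i, ((Polynomial.taylor δ a).scaleRoots ε⁻¹).coeff i ∈ T) (i : ℕ) :
      a.coeff i ∈ T := by
    have h1 (i : ℕ) : (Polynomial.taylor δ a).coeff i ∈ T := by
      have h2 := ha i
      rw [Polynomial.coeff_scaleRoots] at h2
      have h3 := mul_mem h2 (pow_mem hε ((Polynomial.taylor δ a).natDegree - i))
      rwa [mul_assoc, ← mul_pow, inv_mul_cancel₀ hε0, one_pow, mul_one] at h3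
    obtain ⟨a', ha'⟩ : Polynomial.taylor δ a ∈ Polynomial.lifts T.subtype := by
      rw [Polynomial.lifts_iff_coeff_lifts]
      exact fun i => ⟨⟨_, h1 i⟩, rfl⟩
    have h4 : a = (Polynomial.taylor (-(⟨δ, hδ⟩ : T)) a').map T.subtype := by
      rw [Polynomial.map_taylor]
      change _ = Polynomial.taylor _ (Polynomial.mapRingHom T.subtype a')
      erw [ha']
      rw [Polynomial.taylor_taylor]
      simp
    rw [h4, Polynomial.coeff_map]
    exact SetLike.coe_mem _
  have hmonic {a : K[X]} (ha : a.Monic) :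
      ((Polynomial.taylor δ a).scaleRoots ε⁻¹).Monic := by
    rw [Polynomial.monic_scaleRoots_iff, Polynomial.Monic, Polynomial.leadingCoeff_taylor]
    exact ha
  have key := hT ((Polynomial.taylor δ a).scaleRoots ε⁻¹) ((Polynomial.taylor δ b).scaleRoots ε⁻¹)
    (Polynomial.isCoprime_scaleRoots _ _ _ (isUnit_iff_ne_zero.2 (inv_ne_zero hε0))
      (hab.map (Polynomial.taylorAlgHom δ).toRingHom)) (hmonic ha) (hmonic hb)
    (by simpa using hdeg) (by
      apply mul_left_cancel₀ (pow_ne_zero a.natDegree hε0')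
      rw [haeval, h, ← haeval, hdeg]
      ring)
  exact ⟨hmem a (fun i => (key i).1) i, hmem b (fun i => (key i).2) i⟩

section
variable {k L : Type*} [Field k] [Field L] [Algebra k L]

theorem exists_add_mem_regularAt_inv {x : L} (hx : Transcendental k x) {c : L}
    (hc : c ∈ IntermediateField.adjoin k {x}) :
    ∃ r : k[X], c + Polynomial.aeval x r ∈ regularAt x⁻¹ (Polynomial.prime_X (R := k)) := by
  obtain ⟨a, b, rfl⟩ := (IntermediateField.mem_adjoin_simple_iff k c).1 hc
  by_cases hb : b = 0
  · exact ⟨0, by simp [hb, zero_mem]⟩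
  have hx0 : x⁻¹ ≠ 0 := by
    intro h
    rw [inv_eq_zero] at h
    exact hx (h ▸ isAlgebraic_zero)
  have hbx : Polynomial.aeval x b ≠ 0 := fun h => hb (transcendental_iff.1 hx b h)
  have hle : (a % b).natDegree ≤ b.natDegree := Polynomial.natDegree_le_natDegree (EuclideanDomain.mod_lt a hb).le
  have h1 := aeval_eq_reverse hx0 b
  have h2 := aeval_eq_reverse hx0 (a % b)
  rw [inv_inv] at h1 h2
  refine ⟨-(a / b), (a % b).reverse * Polynomial.X ^ (b.natDegree - (a % b).natDegree), b.reverse,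
    ?_, ?_⟩
  · rwa [Polynomial.X_dvd_iff, Polynomial.coeff_zero_reverse, Polynomial.leadingCoeff_eq_zero]
  · have h3 : Polynomial.aeval x a / Polynomial.aeval x b + Polynomial.aeval x (-(a / b)) =
        Polynomial.aeval x (a % b) / Polynomial.aeval x b := by
      rw [map_neg, ← sub_eq_add_neg, div_sub' hbx]
      congr 1
      rw [← map_mul, ← map_sub, EuclideanDomain.mod_eq_sub_mul_div]
    rw [h3, ← h1, map_mul, ← h2, map_pow, Polynomial.aeval_X, mul_assoc, ← pow_add,
      Nat.add_sub_cancel' hle, ← mul_assoc, div_mul_cancel₀ _ hbx]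

/-- A rational function without poles is constant. -/
theorem mem_range_of_mem_regularAt {x : L} (hx : Transcendental k x) {c : L}
    (h : ∀ (π : k[X]) (hπ : Prime π), c ∈ regularAt x hπ)
    (h' : c ∈ regularAt x⁻¹ (Polynomial.prime_X (R := k))) : ∃ d : k, algebraMap k L d = c := by
  have hinj {f : k[X]} (hf : Polynomial.aeval x f = 0) : f = 0 := transcendental_iff.1 hx f hf
  have key (g : k[X]) : g ≠ 0 → ∀ f : k[X], c * Polynomial.aeval x g = Polynomial.aeval x f →
      ∃ f : k[X], c = Polynomial.aeval x f := by
    induction g using WfDvdMonoid.induction_on_irreducible with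
    | zero => exact fun h => absurd rfl h
    | unit u hu =>
      intro _ f hf
      obtain ⟨v, hv⟩ := hu.exists_right_inv
      refine ⟨f * v, ?_⟩
      rw [map_mul, ← hf, mul_assoc, ← map_mul, hv, map_one, mul_one]
    | mul g π hg hπ ih =>
      intro _ f hf
      obtain ⟨f₁, g₁, hg₁, h₁⟩ := h π hπ.prime
      have h2 : f * g₁ = f₁ * (π * g) := by
        apply (transcendental_iff_injective.1 hx)
        rw [map_mul, map_mul, ← hf, ← h₁]
        ring
      have h3 : π ∣ f := (hπ.prime.dvd_or_dvd (h2 ▸ (dvd_mul_right π g).mul_left f₁)).resolve_right hg₁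
      obtain ⟨f₂, rfl⟩ := h3
      refine ih hg f₂ ?_
      apply mul_left_cancel₀ (fun h0 => hπ.ne_zero (hinj h0))
      rw [← map_mul, ← hf, map_mul]
      ring
  obtain ⟨f₀, g₀, hg₀, h₀⟩ := h _ (Polynomial.prime_X (R := k))
  obtain ⟨f, rfl⟩ := key g₀ (by rintro rfl; exact hg₀ (dvd_zero _)) f₀ h₀
  by_cases hf : f = 0
  · exact ⟨0, by simp [hf]⟩
  have hx0 : x⁻¹ ≠ 0 := by
    intro h
    rw [inv_eq_zero] at h
    exact hx (h ▸ isAlgebraic_zero)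
  have hx' : Transcendental k x⁻¹ := fun h => hx (by simpa using h.inv)
  obtain ⟨f₁, g₁, hg₁, h₁⟩ := h'
  have h2 := aeval_eq_reverse hx0 f
  rw [inv_inv] at h2
  have h3 : f.reverse * g₁ = f₁ * Polynomial.X ^ f.natDegree := by
    apply transcendental_iff_injective.1 hx'
    rw [map_mul, map_mul, ← h2, ← h₁, map_pow, Polynomial.aeval_X]
    ring
  have h4 : f.natDegree = 0 := by
    by_contra h0
    rcases Polynomial.prime_X.dvd_or_dvd (h3 ▸ (dvd_pow_self _ h0).mul_left f₁) with h5 | h5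
    · rw [Polynomial.X_dvd_iff, Polynomial.coeff_zero_reverse, Polynomial.leadingCoeff_eq_zero] at h5
      exact hf h5
    · exact hg₁ h5
  rw [Polynomial.eq_C_of_natDegree_eq_zero h4]
  exact ⟨_, (Polynomial.aeval_C x _).symm⟩

end

/-- The place `ω = 0` of `k(ω)` has residue field `k`. -/
theorem exists_sub_lt_one_of_mem_adjoin {k L : Type*} [Field k] [Field L] [Algebra k L]
    (V : ValuationSubring L) (hk : ∀ c : k, algebraMap k L c ∈ V) {ω l : L}
    (hω : V.valuation ω < 1) (hl : l ∈ IntermediateField.adjoin k {ω}) (hlV : l ∈ V) :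
    ∃ c : k, V.valuation (l - algebraMap k L c) < 1 := by
  obtain ⟨c, v, hv, h⟩ := exists_sub_eq_mul_of_mem_adjoin V hk hω hl hlV
  refine ⟨c, ?_⟩
  rw [h, map_mul]
  exact mul_lt_one_of_lt_of_le hω ((V.valuation_le_one_iff _).2 hv)

section
variable {k σ L : Type*} [Field k] [Field L] [Algebra (MvPolynomial σ k) L]
  [IsFractionRing (MvPolynomial σ k) L] [Algebra k L] [IsScalarTower k (MvPolynomial σ k) L]

theorem exists_aeval_eq_of_mem_adjoin {P : MvPolynomial σ k} (hP : Prime P) {ω : L}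
    (hω : (primeVal L P hP).valuation ω < 1)
    (hPω : algebraMap (MvPolynomial σ k) L P ∈ IntermediateField.adjoin k {ω})
    (f : MvPolynomial σ k)
    (hf : algebraMap (MvPolynomial σ k) L f ∈ IntermediateField.adjoin k {ω}) :
    ∃ s : k[X], f = Polynomial.aeval P s := by
  have hP0 : algebraMap (MvPolynomial σ k) L P ≠ 0 := by simpa using hP.ne_zero
  have hdeg : 0 < P.totalDegree := by
    rw [Nat.pos_iff_ne_zero]
    intro h
    rw [totalDegree_eq_zero_iff_eq_C] at h
    have h0 : coeff 0 P ≠ 0 := by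
      intro h0
      rw [h0, C_0] at h
      exact hP.ne_zero h
    exact hP.not_isUnit (h ▸ (isUnit_iff_ne_zero.2 h0).map C)
  induction hn : f.totalDegree using Nat.strong_induction_on generalizing f with
  | _ n ih =>
    obtain ⟨c, hc⟩ := exists_sub_lt_one_of_mem_adjoin (primeVal L P hP) (fun c => by
      rw [IsScalarTower.algebraMap_apply k (MvPolynomial σ k) L]
      exact algebraMap_mem_primeVal hP _) hω hf (algebraMap_mem_primeVal hP f)
    rw [IsScalarTower.algebraMap_apply k (MvPolynomial σ k) L, ← map_sub,
      valuation_algebraMap_lt_one] at hc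
    obtain ⟨g, hg⟩ := hc
    have hfg : f = algebraMap k _ c + P * g := by rw [← hg]; ring
    by_cases hg0 : g = 0
    · exact ⟨Polynomial.C c, by rw [hfg, hg0]; simp⟩
    have hlt : g.totalDegree < f.totalDegree := by
      have h1 := totalDegree_mul_of_isDomain hP.ne_zero hg0
      rw [hfg, algebraMap_eq, totalDegree_add_eq_right_of_totalDegree_lt, h1]
      · lia
      · rw [totalDegree_C, h1]
        lia
    obtain ⟨s, hs⟩ := ih _ (hn ▸ hlt) g (by
      have h1 : algebraMap (MvPolynomial σ k) L g =
          (algebraMap (MvPolynomial σ k) L f - algebraMap k L c) /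
            algebraMap (MvPolynomial σ k) L P := by
        rw [hfg, map_add, ← IsScalarTower.algebraMap_apply, add_sub_cancel_left, map_mul,
          mul_div_cancel_left₀ _ hP0]
      rw [h1]
      exact div_mem (sub_mem hf (IntermediateField.algebraMap_mem _ c)) hPω) rfl
    exact ⟨Polynomial.C c + Polynomial.X * s, by rw [hfg, hs]; simp⟩

end

theorem aeval_mem_of_mem {k L : Type*} [Field k] [Field L] [Algebra k L]
    {M : IntermediateField k L} {y : L} (hy : y ∈ M) (a : k[X]) : Polynomial.aeval y a ∈ M := by
  rw [Polynomial.aeval_eq_sum_range]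
  exact sum_mem fun i _ => M.smul_mem (pow_mem hy i)

section
variable {k R L : Type*} [Field k] [CommRing R] [IsDomain R] [UniqueFactorizationMonoid R]
  [Algebra k R] [Field L] [Algebra R L] [IsFractionRing R L] [Algebra k L] [IsScalarTower k R L]

/-- If the coordinate `x` is regular at infinity, then some pole coordinate `y` expresses the prime
`P` as a fraction with constant coefficients. -/
theorem RegularAtInfinity.exists_constant_fraction {F P : R} (hP : Prime P)
    (hFt : Transcendental k (algebraMap R L F))
    (hres : ∀ f : R, ∃ q : k[X], P ∣ f - Polynomial.aeval F q) (hor : Horizontal k F P)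
    {K : IntermediateField k L} (hK : K = IntermediateField.adjoin k {algebraMap R L F})
    {x : L} (hx : IntermediateField.adjoin K {x} = ⊤) (hxP : (primeVal L P hP).valuation x < 1)
    (hreg : RegularAtInfinity F K hP x) :
    ∃ y : L, IntermediateField.adjoin K {y} = ⊤ ∧
      (primeVal L P hP).valuation (algebraMap R L P * y - 1) < 1 ∧
      ∃ a b : k[X], b.Monic ∧ b.natDegree = a.natDegree + 1 ∧
        Polynomial.aeval y a = algebraMap R L P * Polynomial.aeval y b := by
  have hle (p : R) (hp : Prime p) (h : Horizontal k F p) (c : K) :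
      algebraMap K L c ∈ primeVal L p hp :=
    adjoin_le_primeVal hp h (hK ▸ c.2)
  have hKV := hle P hP hor
  have hP0 : algebraMap R L P ≠ 0 := by simpa using hP.ne_zero
  have hPV : (primeVal L P hP).valuation (algebraMap R L P) < 1 :=
    (valuation_algebraMap_lt_one hP).2 dvd_rfl
  have hx0 : x ≠ 0 := by
    rintro rfl
    have h1 : (algebraMap R L P)⁻¹ ∈ IntermediateField.adjoin K {(0 : L)} := by rw [hx]; trivial
    rw [IntermediateField.adjoin_zero] at h1
    obtain ⟨c, hc⟩ := IntermediateField.mem_bot.1 h1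
    exact not_mem_primeVal hP (l := (algebraMap R L P)⁻¹) (a := 1) (b := P)
      (fun h => hP.not_isUnit (isUnit_of_dvd_one h)) dvd_rfl (by simp [hP0]) (hc ▸ hKV c)
  have hxPmem : x / algebraMap R L P ∈ primeVal L P hP := by
    obtain ⟨a, b, hb, hab⟩ := valuation_lt_one_mem _ hxP
    have hPa : P ∣ a := by
      rw [← valuation_algebraMap_lt_one (L := L) hP, ← hab, map_mul]
      exact mul_lt_one_of_lt_of_le hxP (((primeVal L P hP).valuation_le_one_iff _).2
        (algebraMap_mem_primeVal hP b))
    obtain ⟨c, rfl⟩ := hPa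
    refine ⟨c, b, hb, ?_⟩
    rw [div_mul_eq_mul_div, hab, map_mul, mul_div_cancel_left₀ _ hP0]
  obtain ⟨ε, v, hv, hε⟩ := exists_sub_eq_mul _ hKV hxP hx hxPmem
  have hlt {v : L} (hv : v ∈ primeVal L P hP) {u : L} (hu : (primeVal L P hP).valuation u < 1) :
      (primeVal L P hP).valuation (u * v) < 1 := by
    rw [map_mul]
    exact mul_lt_one_of_lt_of_le hu (((primeVal L P hP).valuation_le_one_iff _).2 hv)
  have hε0 : (ε : L) ≠ 0 := by
    intro h
    have h1 : (algebraMap R L P)⁻¹ = v := by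
      rw [IntermediateField.algebraMap_apply, h, sub_zero, div_eq_mul_inv] at hε
      exact mul_left_cancel₀ hx0 hε
    exact not_mem_primeVal hP (l := (algebraMap R L P)⁻¹) (a := 1) (b := P)
      (fun h => hP.not_isUnit (isUnit_of_dvd_one h)) dvd_rfl (by simp [hP0]) (h1 ▸ hv)
  have hεinf := hreg.1 ε (by
    rw [← IntermediateField.algebraMap_apply, hε]
    exact hlt hv hxP)
  set y := (ε : L) * x⁻¹ with hy
  have hytop : IntermediateField.adjoin K {y} = ⊤ := by
    refine adjoin_eq_top_of_mem (adjoin_inv_eq_top hx) ?_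
    have h1 : x⁻¹ = algebraMap K L ε⁻¹ * y := by
      rw [hy, map_inv₀, IntermediateField.algebraMap_apply, inv_mul_cancel_left₀ hε0]
    rw [h1]
    exact mul_mem (IntermediateField.algebraMap_mem _ _)
      (IntermediateField.mem_adjoin_simple_self K y)
  rw [IntermediateField.algebraMap_apply] at hε
  have hPy : algebraMap R L P * y - 1 = algebraMap R L P * -v := by
    rw [hy, show (ε : L) = x / algebraMap R L P - x * v by rw [← hε]; ring]
    field_simp
    ring
  have hyP : y - (algebraMap R L P)⁻¹ = -v := by
    apply mul_left_cancel₀ hP0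
    rw [mul_sub, mul_inv_cancel₀ hP0, hPy]
  obtain ⟨β, w, hw, hβ⟩ := exists_sub_eq_mul _ hKV hxP hx (neg_mem hv)
  have hβ1 : (primeVal L P hP).valuation (y - (algebraMap R L P)⁻¹ - β) < 1 := by
    rw [hyP, ← IntermediateField.algebraMap_apply, hβ]
    exact hlt hw hxP
  obtain ⟨σ, hσ, g, hg⟩ := exists_aeval_mul_mem (k := k) F (algebraMap R L P * y) (by
    intro p hp hph
    by_cases h1 : (primeVal L p hp).valuation x < 1
    · rw [eq_of_valuation_lt_one _ _ (hle p hp hph) hKV h1 hxP hx,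
        show algebraMap R L P * y = algebraMap R L P * -v + 1 by rw [← hPy]; ring]
      exact add_mem (mul_mem (algebraMap_mem_primeVal hP P) (neg_mem hv)) (one_mem _)
    · refine mul_mem (algebraMap_mem_primeVal hp P) (mul_mem (hle p hp hph ε) ?_)
      rw [← ValuationSubring.valuation_le_one_iff, map_inv₀]
      exact inv_le_one_of_one_le₀ (not_lt.1 h1))
  have hFK : ∀ c : k[X], algebraMap R L (Polynomial.aeval F c) ∈ K := fun c =>
    hK ▸ aeval_mem_adjoin F c
  obtain ⟨r, hr⟩ := exists_add_mem_regularAt_inv hFt (c := -(β : L)) (neg_mem (hK ▸ β.2))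
  rw [Polynomial.aeval_algebraMap_apply] at hr
  let δ : K := -β + ⟨_, hFK r⟩
  have hδ : (δ : L) = -(β : L) + algebraMap R L (Polynomial.aeval F r) := rfl
  have hz : y - β + algebraMap R L (Polynomial.aeval F r) = y - algebraMap K L (-δ) := by
    rw [map_neg, IntermediateField.algebraMap_apply, hδ]; ring
  have hztop := adjoin_sub_eq_top hytop (-δ)
  rw [← hz] at hztop
  have hPz : (primeVal L P hP).valuation
      (algebraMap R L P * (y - β + algebraMap R L (Polynomial.aeval F r)) - 1) < 1 := by
    rw [show algebraMap R L P * (y - β + algebraMap R L (Polynomial.aeval F r)) - 1 =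
      algebraMap R L P * (-v + δ) by rw [hδ, mul_add _ (-v), ← hPy]; ring]
    exact hlt (add_mem (neg_mem hv) (hKV δ)) hPV
  obtain ⟨a, b, hab, ha, hb, hdeg, h⟩ := exists_monic_fraction _ hKV hztop hP0 hPV hPz
  have hinf (i : ℕ) := coeff_mem_of_affine
    ((regularAt (algebraMap R L F)⁻¹ (Polynomial.prime_X (R := k))).comap (algebraMap K L))
    (ε := ε) (δ := δ) (x := x⁻¹) (p := algebraMap R L P) (by simpa using hε0) hεinf
    (by rw [← hδ] at hr; exact hr) (fun a b h1 h2 h3 h4 h5 i => hreg.2 ε a b h1 h2 h3 h4 h5 i)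
    hab ha hb hdeg (by
      have : algebraMap K L ε * x⁻¹ + algebraMap K L δ =
          y - β + algebraMap R L (Polynomial.aeval F r) := by
        rw [hz, map_neg, sub_neg_eq_add]; rfl
      rw [this, h]) i
  have hfin {π : k[X]} (hπ : Prime π) (i : ℕ) := coeff_mem_regularAt_of_prime hP hres hor hπ hK
    hytop (by rw [hPy]; exact hlt (neg_mem hv) hPV) hσ ⟨g, by rw [← hg, map_mul]; ring⟩ β hβ1 r
    hab ha hb hdeg h i
  have hal : a ∈ Polynomial.lifts (algebraMap k K) := by
    rw [Polynomial.lifts_iff_coeff_lifts]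
    intro i
    obtain ⟨d, hd⟩ := mem_range_of_mem_regularAt hFt (fun π hπ => (hfin hπ i).1) (hinf i).1
    exact ⟨d, Subtype.ext hd⟩
  have hbl : b ∈ Polynomial.lifts (algebraMap k K) := by
    rw [Polynomial.lifts_iff_coeff_lifts]
    intro i
    obtain ⟨d, hd⟩ := mem_range_of_mem_regularAt hFt (fun π hπ => (hfin hπ i).2) (hinf i).2
    exact ⟨d, Subtype.ext hd⟩
  obtain ⟨a', rfl⟩ := (Polynomial.mem_lifts _).1 hal
  obtain ⟨b', rfl⟩ := (Polynomial.mem_lifts _).1 hbl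
  refine ⟨_, hztop, hPz, a', b', ?_, ?_, ?_⟩
  · exact Polynomial.monic_of_injective (algebraMap k K).injective hb
  · simpa using hdeg
  · simpa using h

end

section
variable {k σ L : Type*} [Field k] [Field L] [Algebra (MvPolynomial σ k) L]
  [IsFractionRing (MvPolynomial σ k) L] [Algebra k L] [IsScalarTower k (MvPolynomial σ k) L]

theorem adjoin_prime_eq_top {P : MvPolynomial σ k} (hP : Prime P) {K : IntermediateField k L}
    {y : L} (hy : IntermediateField.adjoin K {y} = ⊤)
    (hPy : (primeVal L P hP).valuation (algebraMap (MvPolynomial σ k) L P * y - 1) < 1)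
    {a b : k[X]} (hb : b.Monic) (hdeg : b.natDegree = a.natDegree + 1)
    (h : Polynomial.aeval y a = algebraMap (MvPolynomial σ k) L P * Polynomial.aeval y b) :
    IntermediateField.adjoin K {algebraMap (MvPolynomial σ k) L P} = ⊤ := by
  have hP0 : algebraMap (MvPolynomial σ k) L P ≠ 0 := by simpa using hP.ne_zero
  have hPV : (primeVal L P hP).valuation (algebraMap (MvPolynomial σ k) L P) < 1 :=
    (valuation_algebraMap_lt_one hP).2 dvd_rfl
  have hk (c : k) : algebraMap k L c ∈ primeVal L P hP := by
    rw [IsScalarTower.algebraMap_apply k (MvPolynomial σ k) L]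
    exact algebraMap_mem_primeVal hP _
  have hPy1 : (primeVal L P hP).valuation (algebraMap (MvPolynomial σ k) L P * y) = 1 := by
    have := (primeVal L P hP).valuation.map_add_eq_of_lt_right
      (x := algebraMap (MvPolynomial σ k) L P * y - 1) (y := 1) (by rwa [map_one])
    rwa [sub_add_cancel, map_one] at this
  have hy0 : y ≠ 0 := by
    rintro rfl
    simp at hPy1
  have hω : (primeVal L P hP).valuation y⁻¹ < 1 := by
    rw [map_mul, mul_eq_one_iff_eq_inv₀ (by simpa using hy0), ← map_inv₀] at hPy1
    rwa [← hPy1]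
  have hyk : y ∈ IntermediateField.adjoin k {y⁻¹} := by
    simpa using inv_mem (IntermediateField.mem_adjoin_simple_self k y⁻¹)
  have haeval (a : k[X]) : Polynomial.aeval y a ∈ IntermediateField.adjoin k {y⁻¹} :=
    aeval_mem_of_mem hyk a
  have hPk : algebraMap (MvPolynomial σ k) L P ∈ IntermediateField.adjoin k {y⁻¹} := by
    by_cases hb0 : Polynomial.aeval y b = 0
    · have h1 := aeval_eq_reverse (inv_ne_zero hy0) b
      rw [inv_inv, hb0, zero_mul] at h1
      have h2 := valuation_aeval_eq_one _ hk hω (a := b.reverse) (by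
        rw [Polynomial.coeff_zero_reverse, hb.leadingCoeff]
        exact one_ne_zero)
      simp [← h1] at h2
    · rw [show algebraMap (MvPolynomial σ k) L P = Polynomial.aeval y a / Polynomial.aeval y b by
        rw [h, mul_div_cancel_right₀ _ hb0]]
      exact div_mem (haeval a) (haeval b)
  have hint : IsIntegral (MvPolynomial σ k) (algebraMap (MvPolynomial σ k) L P * y) := by
    let f : (MvPolynomial σ k)[X] := Polynomial.C P * b.map (algebraMap k _) -
      a.map (algebraMap k _)
    have hdeg : (a.map (algebraMap k (MvPolynomial σ k))).degree <
        (Polynomial.C P * b.map (algebraMap k (MvPolynomial σ k))).degree := by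
      rw [Polynomial.degree_C_mul hP.ne_zero, Polynomial.degree_map, Polynomial.degree_map]
      exact Polynomial.degree_lt_degree (by lia)
    have hf : f.leadingCoeff = P := by
      rw [Polynomial.leadingCoeff_sub_of_degree_lt hdeg, Polynomial.leadingCoeff_mul,
        Polynomial.leadingCoeff_C, (hb.map _).leadingCoeff, mul_one]
    have := isIntegral_leadingCoeff_smul f y (by
      rw [map_sub, map_mul, Polynomial.aeval_map_algebraMap, Polynomial.aeval_map_algebraMap,
        Polynomial.aeval_C, h, sub_self])
    rwa [hf, Algebra.smul_def] at this
  obtain ⟨g, hg⟩ := IsIntegrallyClosed.isIntegral_iff.1 hint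
  obtain ⟨s, rfl⟩ := exists_aeval_eq_of_mem_adjoin hP hω hPk g (by
    rw [hg]
    exact mul_mem hPk hyk)
  refine adjoin_eq_top_of_mem hy ?_
  have hPm := IntermediateField.mem_adjoin_simple_self K (algebraMap (MvPolynomial σ k) L P)
  rw [show y = algebraMap (MvPolynomial σ k) L (Polynomial.aeval P s) /
    algebraMap (MvPolynomial σ k) L P by rw [hg, mul_div_cancel_left₀ _ hP0]]
  refine div_mem ?_ hPm
  rw [← Polynomial.aeval_algebraMap_apply, ← Polynomial.aeval_map_algebraMap K]
  exact aeval_mem_of_mem hPm _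

end

theorem ringKrullDim_quotient_add_one_le_of_mem {S : Type*} [CommRing S] [IsDomain S]
    {p : Ideal S} {r : S}
    (hr0 : r ≠ 0) (hr : r ∈ p) : ringKrullDim (S ⧸ p) + 1 ≤ ringKrullDim S := by
  refine le_trans ?_ (ringKrullDim_quotient_succ_le_of_nonZeroDivisor
    (mem_nonZeroDivisors_of_ne_zero hr0))
  have hle : Ideal.span {r} ≤ p := (Ideal.span_singleton_le_iff_mem p).2 hr
  gcongr
  exact ringKrullDim_le_of_surjective _ (Ideal.Quotient.factor_surjective hle)

/-- A prime of `k[X,Y]` with one-dimensional quotient is principal. -/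
theorem exists_prime_span_eq {k : Type*} [Field k] {p : Ideal (MvPolynomial (Fin 2) k)}
    (hp : p.IsPrime) (hdim : ringKrullDim (MvPolynomial (Fin 2) k ⧸ p) = 1) :
    ∃ P, Prime P ∧ p = Ideal.span {P} := by
  have hR : ringKrullDim (MvPolynomial (Fin 2) k) = 2 := by
    rw [MvPolynomial.ringKrullDim_of_isNoetherianRing, ringKrullDim_eq_zero_of_field]
    simp
  have hp0 : p ≠ ⊥ := by
    rintro rfl
    rw [ringKrullDim_eq_of_ringEquiv (RingEquiv.quotientBot _), hR] at hdim
    exact absurd hdim (by decide)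
  obtain ⟨P, hPp, hP⟩ := hp.exists_mem_prime_of_ne_bot hp0
  refine ⟨P, hP, le_antisymm (fun h hh => ?_) ((Ideal.span_singleton_le_iff_mem p).2 hPp)⟩
  by_contra hhP
  have hprime : (Ideal.span {P}).IsPrime := (Ideal.span_singleton_prime hP.ne_zero).2 hP
  have h1 := ringKrullDim_quotient_add_one_le_of_mem
    (p := p.map (Ideal.Quotient.mk (Ideal.span {P}))) (r := Ideal.Quotient.mk (Ideal.span {P}) h)
    (by rwa [Ne, Ideal.Quotient.eq_zero_iff_mem]) (Ideal.mem_map_of_mem _ hh)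
  have h2 := ringKrullDim_quotient_add_one_le_of_mem (p := Ideal.span {P}) hP.ne_zero
    (Ideal.mem_span_singleton_self P)
  have h3 := ringKrullDim_eq_of_ringEquiv (DoubleQuot.quotQuotEquivQuotOfLE
    ((Ideal.span_singleton_le_iff_mem p).2 hPp))
  rw [h3, hdim] at h1
  rw [hR] at h2
  have h4 : (1 : WithBot ℕ∞) + 1 + 1 ≤ 2 := le_trans (by gcongr) h2
  exact absurd h4 (by decide)

theorem exists_prime_of_mem_gammaAlg {k : Type} [Field k] {F : MvPolynomial (Fin 2) k}
    {p : Ideal (MvPolynomial (Fin 2) k)} (hp : p ∈ GammaAlg k F) :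
    ∃ P, Prime P ∧ p = Ideal.span {P} ∧ (∀ f, ∃ q : k[X], P ∣ f - Polynomial.aeval F q) ∧
      Horizontal k F P := by
  obtain ⟨hp, hinj, hsurj⟩ := hp
  let φ : k[X] →+* MvPolynomial (Fin 2) k ⧸ p :=
    (Ideal.Quotient.mk p).comp (Polynomial.aeval F).toRingHom
  have hdim : ringKrullDim (MvPolynomial (Fin 2) k ⧸ p) = 1 := by
    rw [← ringKrullDim_eq_of_ringEquiv (RingEquiv.ofBijective φ ⟨hinj, hsurj⟩),
      Polynomial.ringKrullDim_of_isNoetherianRing, ringKrullDim_eq_zero_of_field, zero_add]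
  obtain ⟨P, hP, rfl⟩ := exists_prime_span_eq hp hdim
  refine ⟨P, hP, rfl, fun f => ?_, fun b hb hPb => hb (hinj ?_)⟩
  · obtain ⟨q, hq⟩ := hsurj (Ideal.Quotient.mk _ f)
    exact ⟨q, by rw [← Ideal.mem_span_singleton, ← Ideal.Quotient.eq, ← hq]⟩
  · simpa [Ideal.Quotient.eq_zero_iff_mem, Ideal.mem_span_singleton] using hPb

theorem exists_valuation_sub_lt_one_of_dvd {k R L : Type*} [Field k] [CommRing R] [IsDomain R]
    [UniqueFactorizationMonoid R] [Algebra k R] [Field L] [Algebra R L] [IsFractionRing R L]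
    [Algebra k L] [IsScalarTower k R L] {F P : R} (hP : Prime P)
    (hres : ∀ f : R, ∃ q : k[X], P ∣ f - Polynomial.aeval F q)
    {K : IntermediateField k L} (hK : K = IntermediateField.adjoin k {algebraMap R L F})
    {l : L} (hl : l ∈ primeVal L P hP) :
    ∃ ε : K, (primeVal L P hP).valuation (l - algebraMap K L ε) < 1 := by
  obtain ⟨f, h, hh, hfh⟩ := hl
  obtain ⟨q, hq⟩ := hres f
  obtain ⟨r, hr⟩ := hres h
  have hr0 : ¬ P ∣ Polynomial.aeval F r := fun h1 => hh ((dvd_sub_left h1).1 hr)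
  have hh0 : algebraMap R L h ≠ 0 := by
    simpa using fun h0 : h = 0 => hh (h0 ▸ dvd_zero P)
  have hr1 : algebraMap R L (Polynomial.aeval F r) ≠ 0 := by
    simpa using fun h0 : Polynomial.aeval F r = 0 => hr0 (h0 ▸ dvd_zero P)
  refine ⟨⟨algebraMap R L (Polynomial.aeval F q) / algebraMap R L (Polynomial.aeval F r),
    hK ▸ div_mem (aeval_mem_adjoin F q) (aeval_mem_adjoin F r)⟩, ?_⟩
  have hl : l = algebraMap R L f / algebraMap R L h := by rw [← hfh, mul_div_cancel_right₀ _ hh0]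
  have h1 : l - algebraMap R L (Polynomial.aeval F q) / algebraMap R L (Polynomial.aeval F r) =
      algebraMap R L ((f - Polynomial.aeval F q) * h - f * (h - Polynomial.aeval F r)) *
        ((algebraMap R L h)⁻¹ * (algebraMap R L (Polynomial.aeval F r))⁻¹) := by
    rw [hl]
    simp only [map_sub, map_mul]
    field_simp
    ring
  rw [IntermediateField.algebraMap_apply, h1, map_mul]
  refine mul_lt_one_of_lt_of_le ((valuation_algebraMap_lt_one hP).2 ?_)
    (((primeVal L P hP).valuation_le_one_iff _).2
    (mul_mem (inv_algebraMap_mem_primeVal hP hh) (inv_algebraMap_mem_primeVal hP hr0)))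
  exact dvd_sub (hq.mul_right _) (hr.mul_left _)

theorem adjoin_algebraMap_mul_eq_top {K L : Type*} [Field K] [Field L] [Algebra K L] {x : L}
    (hx : IntermediateField.adjoin K {x} = ⊤) {c : K} (hc : c ≠ 0) :
    IntermediateField.adjoin K {algebraMap K L c * x} = ⊤ := by
  refine adjoin_eq_top_of_mem hx ?_
  have hc' : algebraMap K L c ≠ 0 := by simpa using hc
  have h1 : x = algebraMap K L c⁻¹ * (algebraMap K L c * x) := by
    rw [map_inv₀, inv_mul_cancel_left₀ hc']
  have h2 := mul_mem (IntermediateField.algebraMap_mem _ c⁻¹)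
    (IntermediateField.mem_adjoin_simple_self K (algebraMap K L c * x))
  rwa [← h1] at h2

/-- Three distinct rational places of a rational function field can be moved to `0, 1, ∞`. -/
theorem exists_coordinate {K L : Type*} [Field K] [Field L] [Algebra K L]
    (V : Fin 3 → ValuationSubring L) (hV : Function.Injective V)
    (hK : ∀ i, ∀ c : K, algebraMap K L c ∈ V i)
    (hres : ∀ i, ∀ l ∈ V i, ∃ ε : K, (V i).valuation (l - algebraMap K L ε) < 1)
    {g : L} (hg : IntermediateField.adjoin K {g} = ⊤) :
    ∃ x : L, IntermediateField.adjoin K {x} = ⊤ ∧ (V 0).valuation x < 1 ∧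
      (V 1).valuation (x - 1) < 1 ∧ (V 2).valuation x⁻¹ < 1 := by
  obtain ⟨t, ht, ht0⟩ : ∃ t : L, IntermediateField.adjoin K {t} = ⊤ ∧ (V 0).valuation t < 1 := by
    by_cases hgV : g ∈ V 0
    · obtain ⟨ε, hε⟩ := hres 0 g hgV
      exact ⟨_, adjoin_sub_eq_top hg ε, hε⟩
    · rw [← ValuationSubring.valuation_le_one_iff, not_le] at hgV
      refine ⟨_, adjoin_inv_eq_top hg, ?_⟩
      rw [map_inv₀]
      exact inv_lt_one_of_one_lt₀ hgV
  have hne {i j : Fin 3} (hij : i ≠ j) {y : L} (hy : IntermediateField.adjoin K {y} = ⊤)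
      (hi : (V i).valuation y < 1) : ¬ (V j).valuation y < 1 := fun hj =>
    hij (hV (eq_of_valuation_lt_one _ _ (hK i) (hK j) hi hj hy))
  have hmem_inv {V : ValuationSubring L} {y : L} (hy : ¬ V.valuation y < 1) : y⁻¹ ∈ V := by
    rw [← ValuationSubring.valuation_le_one_iff, map_inv₀]
    exact inv_le_one_of_one_le₀ (not_lt.1 hy)
  obtain ⟨c, hc⟩ := hres 2 t⁻¹ (hmem_inv (hne (by decide) ht ht0))
  set w := t⁻¹ - algebraMap K L c with hw
  have hwtop : IntermediateField.adjoin K {w} = ⊤ := adjoin_sub_eq_top (adjoin_inv_eq_top ht) c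
  have hw0 : (V 0).valuation w⁻¹ < 1 := by
    have ht0' : t ≠ 0 := by
      rintro rfl
      exact hne (i := 0) (j := 1) (by decide) ht (by simp) (by simp)
    have h1 : (V 0).valuation (1 - t * algebraMap K L c) = 1 := by
      rw [Valuation.map_one_sub_of_lt]
      rw [map_mul]
      exact mul_lt_one_of_lt_of_le ht0 (((V 0).valuation_le_one_iff _).2 (hK 0 c))
    have h2 : w = t⁻¹ * (1 - t * algebraMap K L c) := by
      rw [hw, mul_sub, mul_one, inv_mul_cancel_left₀ ht0']
    rw [h2, map_inv₀, map_mul, h1, mul_one, map_inv₀, inv_inv]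
    exact ht0
  obtain ⟨d, hd⟩ := hres 1 w⁻¹ (hmem_inv (hne (by decide) hwtop hc))
  have hd0 : d ≠ 0 := by
    rintro rfl
    rw [map_zero, sub_zero] at hd
    exact hne (by decide) (adjoin_inv_eq_top hwtop) hw0 hd
  have hd' : algebraMap K L d ≠ 0 := by simpa using hd0
  refine ⟨algebraMap K L d⁻¹ * w⁻¹, adjoin_algebraMap_mul_eq_top (adjoin_inv_eq_top hwtop)
    (inv_ne_zero hd0), ?_, ?_, ?_⟩
  · rwa [map_mul, valuation_algebraMap_eq_one _ (hK 0) (inv_ne_zero hd0), one_mul]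
  · rw [show algebraMap K L d⁻¹ * w⁻¹ - 1 = algebraMap K L d⁻¹ * (w⁻¹ - algebraMap K L d) by
      rw [mul_sub, map_inv₀, inv_mul_cancel₀ hd'], map_mul,
      valuation_algebraMap_eq_one _ (hK 1) (inv_ne_zero hd0), one_mul]
    exact hd
  · rw [mul_inv, inv_inv, map_inv₀, inv_inv, map_mul,
      valuation_algebraMap_eq_one _ (hK 2) hd0, one_mul]
    exact hc

theorem adjoin_pair_eq_top_iff {k L : Type*} [Field k] [Field L] [Algebra k L] {a b : L}
    {K : IntermediateField k L} (hK : K = IntermediateField.adjoin k {a}) :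
    IntermediateField.adjoin k {a, b} = ⊤ ↔ IntermediateField.adjoin K {b} = ⊤ := by
  subst hK
  rw [← IntermediateField.adjoin_simple_adjoin_simple,
    IntermediateField.restrictScalars_eq_top_iff]

/-- Laurent series with a simple pole in `f` and a transcendental residue in `x`. -/
theorem exists_laurentEmbedding {k L : Type*} [Field k] [Field L]
    [Algebra (MvPolynomial (Fin 2) k) L] [IsFractionRing (MvPolynomial (Fin 2) k) L] [Algebra k L]
    [IsScalarTower k (MvPolynomial (Fin 2) k) L] {f x : L}
    (hfx : IntermediateField.adjoin k {f, x} = ⊤) :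
    ∃ ψ : L →ₐ[k] LaurentSeries (RatFunc k), Lead (ψ f) (-1) 1 ∧ Lead (ψ x) 0 RatFunc.X := by
  have h1 := algebraicIndependent_single (k := k) (E := RatFunc k) RatFunc.transcendental_X
  have h2 : AlgebraicIndependent k ![(HahnSeries.single (-1) 1 : LaurentSeries (RatFunc k)),
      HahnSeries.single 0 RatFunc.X] := by
    refine algebraicIndependent_of_mem_adjoin h1 ?_ (IntermediateField.subset_adjoin k _ (by simp))
    have h3 : (HahnSeries.single 1 1 : LaurentSeries (RatFunc k)) =
        (HahnSeries.single (-1) 1)⁻¹ := by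
      rw [HahnSeries.inv_single]; simp
    rw [h3]
    exact inv_mem (IntermediateField.subset_adjoin k _ (by simp))
  obtain ⟨ψ, h3, h4⟩ := exists_algHom_of_adjoin_eq_top
    (algebraicIndependent_of_adjoin_eq_top f x hfx) hfx h2
  exact ⟨ψ, h3 ▸ Lead.single (-1) 1, h4 ▸ Lead.single 0 RatFunc.X⟩

/-- A field generator with three pairwise non-associated rational prime divisors is good. -/
theorem exists_adjoin_eq_top_of_three_primes {k L : Type*} [Field k] [Field L]
    [Algebra (MvPolynomial (Fin 2) k) L] [IsFractionRing (MvPolynomial (Fin 2) k) L] [Algebra k L]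
    [IsScalarTower k (MvPolynomial (Fin 2) k) L] {F : MvPolynomial (Fin 2) k} {g : L}
    (hg : IntermediateField.adjoin k {algebraMap (MvPolynomial (Fin 2) k) L F, g} = ⊤)
    (P : Fin 3 → MvPolynomial (Fin 2) k) (hP : ∀ i, Prime (P i))
    (hres : ∀ i f, ∃ q : k[X], P i ∣ f - Polynomial.aeval F q)
    (hor : ∀ i, Horizontal k F (P i)) (hPP : ∀ i j, i ≠ j → ¬ P i ∣ P j) :
    ∃ G : MvPolynomial (Fin 2) k, IntermediateField.adjoin k
      {algebraMap (MvPolynomial (Fin 2) k) L F, algebraMap (MvPolynomial (Fin 2) k) L G} = ⊤ := by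
  by_contra hbad
  have hFt : Transcendental k (algebraMap (MvPolynomial (Fin 2) k) L F) := by
    simpa using (algebraicIndependent_of_adjoin_eq_top _ _ hg).transcendental 0
  obtain ⟨K, hK⟩ : ∃ K, K = IntermediateField.adjoin k {algebraMap (MvPolynomial (Fin 2) k) L F} :=
    ⟨_, rfl⟩
  have hbadK : ¬ ∃ G, IntermediateField.adjoin K {algebraMap (MvPolynomial (Fin 2) k) L G} = ⊤ :=
    fun ⟨G, hG⟩ => hbad ⟨G, (adjoin_pair_eq_top_iff hK).2 hG⟩
  have hgK : IntermediateField.adjoin K {g} = ⊤ := (adjoin_pair_eq_top_iff hK).1 hg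
  obtain ⟨x, hx, hx0, hx1, hx2⟩ := exists_coordinate (fun i => primeVal L (P i) (hP i))
    (fun i j hij => by
      by_contra hne
      have h1 : (primeVal L (P j) (hP j)).valuation (algebraMap (MvPolynomial (Fin 2) k) L (P i))
          < 1 := by
        have h2 : primeVal L (P i) (hP i) = primeVal L (P j) (hP j) := hij
        rw [← h2, valuation_algebraMap_lt_one]
      exact hPP j i (Ne.symm hne) ((valuation_algebraMap_lt_one (hP j)).1 h1))
    (fun i c => adjoin_le_primeVal (hP i) (hor i) (hK ▸ c.2))
    (fun i l hl => exists_valuation_sub_lt_one_of_dvd (hP i) (hres i) hK hl) hgK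
  obtain ⟨ψ, hψF, hψx⟩ := exists_laurentEmbedding ((adjoin_pair_eq_top_iff hK).2 hx)
  obtain ⟨i, y, hy, hyP, hreg⟩ :=
    exists_regularAtInfinity hψF hK P hP hres hor hPP hx hx0 hx1 hx2 hψx hbadK
  obtain ⟨z, hz, hPz, a, b, hb, hdeg, h⟩ :=
    hreg.exists_constant_fraction (hP i) hFt (hres i) (hor i) hK hy hyP
  exact hbadK ⟨P i, adjoin_prime_eq_top (hP i) hz hPz hb hdeg h⟩

end FieldGen

/-- If `F` is a bad field generator of `A = k[X,Y]` (a field generator such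
that `k(F,G) = k(X,Y)` holds for no `G ∈ A`), then `|Γ_alg(F,A)| ≤ 2`. -/
theorem stmt14 (k : Type) [Field k] (L : Type) [Field L]
    [Algebra (MvPolynomial (Fin 2) k) L] [IsFractionRing (MvPolynomial (Fin 2) k) L]
    [Algebra k L] [IsScalarTower k (MvPolynomial (Fin 2) k) L]
    (F : MvPolynomial (Fin 2) k)
    (hFG : ∃ g : L, IntermediateField.adjoin k
        {algebraMap (MvPolynomial (Fin 2) k) L F, g} = ⊤)
    (hbad : ¬ ∃ G : MvPolynomial (Fin 2) k, IntermediateField.adjoin k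
        {algebraMap (MvPolynomial (Fin 2) k) L F,
         algebraMap (MvPolynomial (Fin 2) k) L G} = ⊤) :
    ∀ p ∈ GammaAlg k F, ∀ q ∈ GammaAlg k F, ∀ r ∈ GammaAlg k F,
      p = q ∨ p = r ∨ q = r := by
  intro p hp q hq r hr
  by_contra hne
  push Not at hne
  obtain ⟨hpq, hpr, hqr⟩ := hne
  obtain ⟨g, hg⟩ := hFG
  let I : Fin 3 → Ideal (MvPolynomial (Fin 2) k) := ![p, q, r]
  have hI : ∀ i, I i ∈ GammaAlg k F := by
    intro i
    fin_cases i <;> assumption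
  have hII : ∀ i j, i ≠ j → I i ≠ I j := by
    intro i j
    fin_cases i <;> fin_cases j <;> simp [I, *, Ne.symm]
  choose P hP hIP hres hor using fun i => FieldGen.exists_prime_of_mem_gammaAlg (hI i)
  refine hbad (FieldGen.exists_adjoin_eq_top_of_three_primes hg P hP hres hor fun i j hij h => ?_)
  refine hII i j hij ?_
  rw [hIP, hIP, Ideal.span_singleton_eq_span_singleton]
  exact (hP i).associated_of_dvd (hP j) h
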